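/- There exists an absolute constant β₀ such that for β > β₀ there exists a sequence (λ_c^{(i)})_{i=0}^∞ of positive reals with I_i ⊂ [λ_c^{(i)}, λ_c^{(i−1)}] for every i ≥ 0 (where λ_c^{(−1)} := ∞ and I_i = [e^{−4βi−2β}, e^{−4βi−β}]) such that: (1) if λ_c^{(i)} < λ < λ_c^{(i−1)} then f^tr_i(λ) > f^tr_j(λ) for all j ≠ i; and (2) if λ = λ_c^{(i)} then f^tr_{i+1}(λ) = f^tr_i(λ) > f^tr_j(λ) for all j ∉ {i, i+1}. -/

import Mathlib

open scoped BigOperators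
open Filter

noncomputable section

attribute [local instance] Classical.propDecidable

/-! ### Basic geometry of the square lattice -/

/-- Sites of the square lattice `ℤ²`. -/
abbrev Site := ℤ × ℤ

/-- The four unit directions. -/
def dirs : Finset Site := {(1, 0), (-1, 0), (0, 1), (0, -1)}

/-- The box `Λ_n = ⟦-n/2, n/2⟧² ∩ ℤ²`. -/
def box (n : ℕ) : Finset Site :=
  Finset.Icc (-((n : ℤ) / 2)) ((n : ℤ) / 2) ×ˢ Finset.Icc (-((n : ℤ) / 2)) ((n : ℤ) / 2)

/-- SOS gradient energy of a height function on a domain `V`: each nearest-neighbour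
edge with at least one endpoint in `V` contributes the absolute height gradient
(the directed sum below counts internal edges twice, whence the factor `1/2`). -/
def sosEnergy (V : Finset Site) (ψ : Site → ℤ) : ℝ :=
  ∑ v ∈ V, ∑ d ∈ dirs,
    (if v + d ∈ V then (1 : ℝ) / 2 else 1) * |(ψ v : ℝ) - (ψ (v + d) : ℝ)|

/-- The bulk field term `Σ_{v ∈ V} ψ_v`. -/
def sosField (V : Finset Site) (ψ : Site → ℤ) : ℝ := ∑ v ∈ V, (ψ v : ℝ)

/-- The SOS weight `exp(-β Σ|∇ψ| - λ Σ ψ)`. -/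
def sosWt (β lam : ℝ) (V : Finset Site) (ψ : Site → ℤ) : ℝ :=
  Real.exp (-(β * sosEnergy V ψ + lam * sosField V ψ))

/-- The inner boundary `∂_i V`. -/
def innerBdry (V : Finset Site) : Finset Site :=
  V.filter fun v => ∃ d ∈ dirs, v + d ∉ V

/-- The interior `V̊ = V ∖ ∂_i V`. -/
def interiorSites (V : Finset Site) : Finset Site := V \ innerBdry V

/-- The number of edges `|∂_e V|` between `V` and its complement. -/
def edgeBdryCard (V : Finset Site) : ℕ :=
  ∑ v ∈ V, (dirs.filter fun d => v + d ∉ V).card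

/-- Nearest-neighbour adjacency. -/
def adjS (u v : Site) : Prop := v - u ∈ dirs

/-- A set of sites is connected (as a subgraph of `ℤ²`). -/
def connectedIn (S : Set Site) : Prop :=
  ∀ x ∈ S, ∀ y ∈ S,
    Relation.ReflTransGen (fun a b => adjS a b ∧ a ∈ S ∧ b ∈ S) x y

/-- A finite set of sites is simply connected: it is connected and its complement is
connected. -/
def SimplyConn (V : Finset Site) : Prop :=
  connectedIn (↑V : Set Site) ∧ connectedIn ((↑V : Set Site)ᶜ)

/-! ### SOS measures with a boundary signing -/

/-- A boundary signing value: `+`, `-`, `∅` or free. -/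
inductive BSign | plus | minus | zero | free

/-- The constraint imposed at an inner-boundary site by a signing, for boundary height
`h`: `+` forces `≥ h`, `-` forces `≤ h`, `∅` forces `= h`, and `f` forces nothing. -/
def BSign.ok : BSign → ℤ → ℤ → Prop
  | .plus, h, t => h ≤ t
  | .minus, h, t => t ≤ h
  | .zero, h, t => t = h
  | .free, _, _ => True

/-- Height functions with boundary condition identically `h` outside `V`, floor `0`
on `V` (and no ceiling), compatible with the boundary signing `η` along `∂_i V`. -/
def signedConfigs (V : Finset Site) (η : Site → BSign) (h : ℤ) : Set (Site → ℤ) :=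
  {ψ | (∀ x, x ∉ V → ψ x = h) ∧ (∀ v ∈ V, 0 ≤ ψ v) ∧
       ∀ v ∈ innerBdry V, BSign.ok (η v) h (ψ v)}

/-- The partition function `Z_{η,h,V}`. -/
def Zsos (β lam : ℝ) (η : Site → BSign) (h : ℤ) (V : Finset Site) : ℝ :=
  ∑' ψ : Site → ℤ, Set.indicator (signedConfigs V η h) (sosWt β lam V) ψ

/-- Probability of an event under the SOS measure `μ_{η,h,V}`. -/
def Psos (β lam : ℝ) (η : Site → BSign) (h : ℤ) (V : Finset Site)
    (E : Set (Site → ℤ)) : ℝ :=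
  (∑' ψ : Site → ℤ, Set.indicator (signedConfigs V η h ∩ E) (sosWt β lam V) ψ) /
    Zsos β lam η h V

/-! ### Contours -/

/-- A (signed geometric) contour, encoded by the finite set of sites it encloses and its
sign (up/down); the contour itself is the dual circuit `(∂_e Int)^*`. -/
structure Contour where
  int : Finset Site
  up : Bool

/-- The length `|γ|` of a contour: the number of boundary edges of its interior. -/
def Contour.len (γ : Contour) : ℕ := edgeBdryCard γ.int

/-- A valid contour encloses a nonempty simply-connected set of sites. -/
def Contour.valid (γ : Contour) : Prop :=
  γ.int.Nonempty ∧ connectedIn (↑γ.int : Set Site) ∧ connectedIn ((↑γ.int : Set Site)ᶜ)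

/-- The constant boundary signing. -/
def constSign (s : BSign) : Site → BSign := fun _ => s

/-- The `h`-renormalized weight `W^rn_h(γ)`. -/
def Wrn (β lam : ℝ) (h : ℤ) (γ : Contour) : ℝ :=
  if γ.up then
    Real.exp (-β * (γ.len : ℝ)) *
      (Zsos β lam (constSign .plus) (h + 1) γ.int / Zsos β lam (constSign .plus) h γ.int)
  else
    Real.exp (-β * (γ.len : ℝ)) *
      (Zsos β lam (constSign .minus) (h - 1) γ.int / Zsos β lam (constSign .minus) h γ.int)

/-- The `h`-truncated weight `W^tr_h(γ) = min{W^rn_h(γ), e^{-(β-5)|γ|}}`. -/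
def Wtr (β lam : ℝ) (h : ℤ) (γ : Contour) : ℝ :=
  min (Wrn β lam h γ) (Real.exp (-(β - 5) * (γ.len : ℝ)))

/-- The elementary diameter bound `min{λ⁻¹, e^{3β(h+1)}}`. -/
def elemBound (β lam : ℝ) (h : ℤ) : ℝ := min (1 / lam) (Real.exp (3 * β * ((h : ℝ) + 1)))

/-- A set of sites is `h`-elementary small: the enclosing contour (whose ℓ∞-diameter is
one more than that of the enclosed set) has diameter at most `min{λ⁻¹, e^{3β(h+1)}}`. -/
def elemSet (β lam : ℝ) (h : ℤ) (S : Set Site) : Prop :=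
  ∀ x ∈ S, ∀ y ∈ S,
    ((max |x.1 - y.1| |x.2 - y.2| : ℤ) : ℝ) + 1 ≤ elemBound β lam h

/-- A contour is `h`-elementary if `diam(γ) ≤ min{λ⁻¹, e^{3β(h+1)}}`. -/
def IsElem (β lam : ℝ) (h : ℤ) (γ : Contour) : Prop := elemSet β lam h (↑γ.int : Set Site)

/-- Two finite sets of sites share a (primal, equivalently dual) boundary edge. -/
def shareEdge (A B : Finset Site) : Prop :=
  ∃ v, ∃ d ∈ dirs, (v ∈ A ∧ v + d ∉ A) ∧ ((v ∈ B ∧ v + d ∉ B) ∨ (v + d ∈ B ∧ v ∉ B))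

/-- Compatibility of a pair of signed contours: they may not cross, and if they overlap
on an edge their signs agree when nested and differ when mutually external. -/
def compatPair (γ γ' : Contour) : Prop :=
  (γ.int ⊆ γ'.int ∨ γ'.int ⊆ γ.int ∨ Disjoint γ.int γ'.int) ∧
  (shareEdge γ.int γ'.int →
    ((γ.int ⊆ γ'.int ∨ γ'.int ⊆ γ.int) → γ.up = γ'.up) ∧
    (Disjoint γ.int γ'.int → γ.up ≠ γ'.up))

/-- Admissible renormalized families of signed contours in `U`, compatible with the
boundary signing `η` at reference height `h` (no floor constraint except that no
down-contours are allowed when `h = 0`). -/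
def famOK (η : Site → BSign) (h : ℤ) (U : Finset Site) (Γ : Multiset Contour) : Prop :=
  (∀ γ ∈ Γ, Contour.valid γ ∧ γ.int ⊆ U) ∧
  (∀ γ ∈ Γ, ∀ γ' ∈ Γ, compatPair γ γ') ∧
  (∀ v ∈ innerBdry U, ∀ γ ∈ Γ, v ∈ γ.int →
    (γ.up = true → η v ≠ BSign.minus ∧ η v ≠ BSign.zero) ∧
    (γ.up = false → η v ≠ BSign.plus ∧ η v ≠ BSign.zero)) ∧
  (h = 0 → ∀ γ ∈ Γ, γ.up = true)

/-- The product of weights of a family of contours. -/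
def prodW (w : Contour → ℝ) (Γ : Multiset Contour) : ℝ := (Γ.map w).prod

/-- The truncated partition function `Z^tr_{η,h,U}`. -/
def Ztr (β lam : ℝ) (η : Site → BSign) (h : ℤ) (U : Finset Site) : ℝ :=
  Real.exp (-lam * (h : ℝ) * (U.card : ℝ)) *
    ∑' Γ : Multiset Contour, Set.indicator {Γ | famOK η h U Γ} (prodW (Wtr β lam h)) Γ

/-- The renormalized partition function `Z^rn_{η,h,U}`. -/
def Zrn (β lam : ℝ) (η : Site → BSign) (h : ℤ) (U : Finset Site) : ℝ :=
  Real.exp (-lam * (h : ℝ) * (U.card : ℝ)) *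
    ∑' Γ : Multiset Contour, Set.indicator {Γ | famOK η h U Γ} (prodW (Wrn β lam h)) Γ

/-- The renormalized elementary partition function `Z^{rn.el}_{η,h,U}`. -/
def Zrnel (β lam : ℝ) (η : Site → BSign) (h : ℤ) (U : Finset Site) : ℝ :=
  Real.exp (-lam * (h : ℝ) * (U.card : ℝ)) *
    ∑' Γ : Multiset Contour,
      Set.indicator {Γ | famOK η h U Γ ∧ ∀ γ ∈ Γ, IsElem β lam h γ}
        (prodW (Wrn β lam h)) Γ

/-! ### Elementary restriction of the SOS measure -/

/-- `*`-adjacency (adjacency allowing diagonal steps). -/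
def starAdj (u v : Site) : Prop := u ≠ v ∧ |u.1 - v.1| ≤ 1 ∧ |u.2 - v.2| ≤ 1

/-- The `*`-connected component of `x` within `S`. -/
def compStar (S : Set Site) (x : Site) : Set Site :=
  {y | Relation.ReflTransGen (fun a b => starAdj a b ∧ a ∈ S ∧ b ∈ S) x y}

/-- The fill of a set of sites: the set together with all sites whose
complement-component is finite. -/
def fill (C : Set Site) : Set Site :=
  C ∪ {x | {y | Relation.ReflTransGen (fun a b => adjS a b ∧ a ∉ C ∧ b ∉ C) x y}.Finite}

/-- All outermost contours of the configuration `ψ` (with boundary height `h` on `V`)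
are `h`-elementary: every filled deviation component is elementary-small. -/
def allOuterElem (β lam : ℝ) (h : ℤ) (V : Finset Site) (ψ : Site → ℤ) : Prop :=
  ∀ v ∈ V, ψ v ≠ h → elemSet β lam h (fill (compStar {u : Site | u ∈ V ∧ ψ u ≠ h} v))

/-- The elementary partition function `Z^el_{η,h,V}`: the contribution to `Z_{η,h,V}`
of configurations all of whose outermost contours are `h`-elementary. -/
def Zel (β lam : ℝ) (η : Site → BSign) (h : ℤ) (V : Finset Site) : ℝ :=
  ∑' ψ : Site → ℤ,
    Set.indicator (signedConfigs V η h ∩ {ψ | allOuterElem β lam h V ψ})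
      (sosWt β lam V) ψ

/-! ### Truncated free energies and the critical sequence -/

/-- `ftr h` is the truncated free energy `f^tr_h(λ)`: the infinite-volume limit of
`|Λ_n|⁻¹ log Z^tr_{η,h,Λ_n}`, for every boundary signing. -/
def FTRlimit (β : ℝ) (ftr : ℕ → ℝ → ℝ) : Prop :=
  ∀ h : ℕ, ∀ lam : ℝ, 0 < lam → lam ≤ 1 → ∀ η : Site → BSign,
    Tendsto (fun n => Real.log (Ztr β lam η (h : ℤ) (box n)) / ((box n).card : ℝ))
      atTop (nhds (ftr h lam))

/-- `lamc` is the strictly decreasing sequence `(λ_c^{(k)})_{k≥0}` of critical points,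
tending to `0`, at which the truncated free energies `ftr` exchange maximizer. -/
def CritSeq (ftr : ℕ → ℝ → ℝ) (lamc : ℕ → ℝ) : Prop :=
  StrictAnti lamc ∧ (∀ i, 0 < lamc i) ∧ Tendsto lamc atTop (nhds 0) ∧
  (∀ i : ℕ, ∀ lam : ℝ, 0 < lam → lam ≤ 1 → lamc i < lam →
    (i = 0 ∨ lam < lamc (i - 1)) → ∀ j : ℕ, j ≠ i → ftr j lam < ftr i lam) ∧
  (∀ i : ℕ, ftr (i + 1) (lamc i) = ftr i (lamc i) ∧
    ∀ j : ℕ, j ≠ i → j ≠ i + 1 → ftr j (lamc i) < ftr i (lamc i))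

/-- `d(x) = min_k |λ_c^{(k)} - x|`. -/
def dmin (lamc : ℕ → ℝ) (x : ℝ) : ℝ := ⨅ k : ℕ, |lamc k - x|

/-- `d⁺(x) = min{λ_c^{(k)} - x : λ_c^{(k)} > x}`. -/
def dplus (lamc : ℕ → ℝ) (x : ℝ) : ℝ := sInf {y : ℝ | ∃ k, x < lamc k ∧ y = lamc k - x}

/-! ### SOS measures with general boundary conditions (floor 0, no ceiling) -/

/-- Height functions equal to the boundary condition `φ` off `V` and nonnegative on `V`. -/
def bcConfigs (V : Finset Site) (φ : Site → ℤ) : Set (Site → ℤ) :=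
  {ψ | (∀ x, x ∉ V → ψ x = φ x) ∧ ∀ v ∈ V, 0 ≤ ψ v}

/-- The partition function with boundary condition `φ`. -/
def Zbc (β lam : ℝ) (V : Finset Site) (φ : Site → ℤ) : ℝ :=
  ∑' ψ : Site → ℤ, Set.indicator (bcConfigs V φ) (sosWt β lam V) ψ

/-- Probability of an event under the SOS measure `μ_{φ,V}` (floor 0, no ceiling). -/
def Pbc (β lam : ℝ) (V : Finset Site) (φ : Site → ℤ) (E : Set (Site → ℤ)) : ℝ :=
  (∑' ψ : Site → ℤ, Set.indicator (bcConfigs V φ ∩ E) (sosWt β lam V) ψ) /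
    Zbc β lam V φ

/-! ### Glauber dynamics on the box with a ceiling -/

/-- A configuration on `Λ_n` with floor `0` and ceiling `ℓ`. -/
abbrev Cfg (n ℓ : ℕ) := {x : Site // x ∈ box n} → Fin (ℓ + 1)

/-- Extension of a configuration by the zero boundary condition. -/
def cExt {n ℓ : ℕ} (ψ : Cfg n ℓ) : Site → ℤ :=
  fun x => if h : x ∈ box n then ((ψ ⟨x, h⟩ : ℕ) : ℤ) else 0

/-- The weight of a configuration (zero boundary conditions). -/
def cWt (n ℓ : ℕ) (β lam : ℝ) (ψ : Cfg n ℓ) : ℝ := sosWt β lam (box n) (cExt ψ)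

/-- The partition function on `Λ_n` with ceiling `ℓ` and zero boundary conditions. -/
def cZ (n ℓ : ℕ) (β lam : ℝ) : ℝ := ∑ ψ : Cfg n ℓ, cWt n ℓ β lam ψ

/-- The SOS probability measure `μ_{n,λ}` (ceiling `ℓ`, zero boundary conditions). -/
def cPi (n ℓ : ℕ) (β lam : ℝ) (ψ : Cfg n ℓ) : ℝ := cWt n ℓ β lam ψ / cZ n ℓ β lam

/-- Probability of an event under `μ_{n,λ}`. -/
def cProb (n ℓ : ℕ) (β lam : ℝ) (E : Set (Cfg n ℓ)) : ℝ :=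
  (∑ ψ : Cfg n ℓ, if ψ ∈ E then cWt n ℓ β lam ψ else 0) / cZ n ℓ β lam

/-- The Glauber (heat-bath) jump rate from `ψ` to `ψ' ≠ ψ`: nonzero only if they differ
at a single site `v` by exactly one, in which case `v`'s height is resampled among
`{ψ_v - 1, ψ_v, ψ_v + 1}` (truncated at the floor and the ceiling) according to the
conditional probabilities given the other heights. -/
def glRate (n ℓ : ℕ) (β lam : ℝ) (ψ ψ' : Cfg n ℓ) : ℝ :=
  if ψ = ψ' then 0
  else
    ∑ v : {x : Site // x ∈ box n},
      if (∀ u, u ≠ v → ψ u = ψ' u) ∧ (((ψ' v : ℕ) : ℤ) - ((ψ v : ℕ) : ℤ)) ^ 2 = 1 then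
        cWt n ℓ β lam ψ' /
          ∑ t : Fin (ℓ + 1),
            (if (((t : ℕ) : ℤ) - ((ψ v : ℕ) : ℤ)) ^ 2 ≤ 1 then
              cWt n ℓ β lam (Function.update ψ v t) else 0)
      else 0

/-- Mean of an observable under `μ_{n,λ}`. -/
def cMean (n ℓ : ℕ) (β lam : ℝ) (f : Cfg n ℓ → ℝ) : ℝ :=
  ∑ ψ : Cfg n ℓ, cPi n ℓ β lam ψ * f ψ

/-- Variance of an observable under `μ_{n,λ}`. -/
def cVar (n ℓ : ℕ) (β lam : ℝ) (f : Cfg n ℓ → ℝ) : ℝ :=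
  ∑ ψ : Cfg n ℓ, cPi n ℓ β lam ψ * (f ψ - cMean n ℓ β lam f) ^ 2

/-- The Dirichlet form of the Glauber dynamics. -/
def cDirichlet (n ℓ : ℕ) (β lam : ℝ) (f : Cfg n ℓ → ℝ) : ℝ :=
  (1 / 2) * ∑ ψ : Cfg n ℓ, ∑ ψ' : Cfg n ℓ,
    cPi n ℓ β lam ψ * glRate n ℓ β lam ψ ψ' * (f ψ' - f ψ) ^ 2

/-- The spectral gap `gap_{n,λ}` of the generator of the Glauber dynamics (ceiling `ℓ`):
by reversibility, the smallest nonzero eigenvalue of minus the generator equals the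
infimum of the Rayleigh quotients `E(f,f)/Var(f)`. -/
def specGap (n ℓ : ℕ) (β lam : ℝ) : ℝ :=
  sInf {r : ℝ | ∃ f : Cfg n ℓ → ℝ,
    cVar n ℓ β lam f ≠ 0 ∧ r = cDirichlet n ℓ β lam f / cVar n ℓ β lam f}

end

open scoped BigOperators
open Filter

noncomputable section

attribute [local instance] Classical.propDecidable

/-! ## Part 1: geometry -/

lemma mem_dirs (d : Site) : d ∈ dirs ↔ d = (1, 0) ∨ d = (-1, 0) ∨ d = (0, 1) ∨ d = (0, -1) := by
  simp [dirs]

lemma neg_mem_dirs {d : Site} (h : d ∈ dirs) : -d ∈ dirs := by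
  rw [mem_dirs] at *
  rcases h with rfl | rfl | rfl | rfl <;> simp

lemma adjS_symm {u v : Site} (h : adjS u v) : adjS v u := by
  unfold adjS at *
  have := neg_mem_dirs h
  rwa [neg_sub] at this

/-- Oriented boundary edges of `V`. -/
def bd (V : Finset Site) : Finset (Site × Site) :=
  (V ×ˢ dirs).filter fun p => p.1 + p.2 ∉ V

lemma mem_bd (V : Finset Site) (p : Site × Site) :
    p ∈ bd V ↔ p.1 ∈ V ∧ p.2 ∈ dirs ∧ p.1 + p.2 ∉ V := by
  simp [bd, and_assoc]

lemma card_bd (V : Finset Site) : (bd V).card = edgeBdryCard V := by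
  unfold bd edgeBdryCard
  rw [Finset.card_filter, Finset.sum_product]
  refine Finset.sum_congr rfl fun v _ => ?_
  rw [Finset.card_filter]

/-- Boundary edges in direction `d`. -/
def bdir (V : Finset Site) (d : Site) : Finset Site := V.filter fun v => v + d ∉ V

lemma len_eq (V : Finset Site) : edgeBdryCard V =
    (bdir V (1, 0)).card + (bdir V (-1, 0)).card + (bdir V (0, 1)).card
      + (bdir V (0, -1)).card := by
  unfold edgeBdryCard bdir
  simp only [Finset.card_filter]
  rw [Finset.sum_comm]
  unfold dirs
  rw [Finset.sum_insert (by decide), Finset.sum_insert (by decide),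
    Finset.sum_insert (by decide), Finset.sum_singleton]
  ring

lemma bdir_h (V : Finset Site) (s : ℤ) (hs : s ≠ 0) :
    (V.image Prod.snd).card ≤ (bdir V (s, 0)).card := by
  have hsub : V.image Prod.snd ⊆ (bdir V (s, 0)).image Prod.snd := by
    intro y hy
    obtain ⟨p, hp, rfl⟩ := Finset.mem_image.1 hy
    obtain ⟨q, hq, hmax⟩ := Finset.exists_max_image (V.filter fun q => q.2 = p.2)
      (fun q => s * q.1) ⟨p, by simp [hp]⟩
    simp only [Finset.mem_filter] at hq hmax
    refine Finset.mem_image.2 ⟨q, ?_, hq.2⟩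
    unfold bdir
    refine Finset.mem_filter.2 ⟨hq.1, fun hc => ?_⟩
    have := hmax _ ⟨hc, by simpa using hq.2⟩
    simp only [Prod.fst_add] at this
    nlinarith [sq_nonneg s, sq_pos_of_ne_zero hs]
  exact (Finset.card_le_card hsub).trans Finset.card_image_le

lemma bdir_v (V : Finset Site) (s : ℤ) (hs : s ≠ 0) :
    (V.image Prod.fst).card ≤ (bdir V (0, s)).card := by
  have hsub : V.image Prod.fst ⊆ (bdir V (0, s)).image Prod.fst := by
    intro y hy
    obtain ⟨p, hp, rfl⟩ := Finset.mem_image.1 hy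
    obtain ⟨q, hq, hmax⟩ := Finset.exists_max_image (V.filter fun q => q.1 = p.1)
      (fun q => s * q.2) ⟨p, by simp [hp]⟩
    simp only [Finset.mem_filter] at hq hmax
    refine Finset.mem_image.2 ⟨q, ?_, hq.2⟩
    unfold bdir
    refine Finset.mem_filter.2 ⟨hq.1, fun hc => ?_⟩
    have := hmax _ ⟨hc, by simpa using hq.2⟩
    simp only [Prod.snd_add] at this
    nlinarith [sq_nonneg s, sq_pos_of_ne_zero hs]
  exact (Finset.card_le_card hsub).trans Finset.card_image_le

lemma len_ge (V : Finset Site) :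
    2 * (V.image Prod.fst).card + 2 * (V.image Prod.snd).card ≤ edgeBdryCard V := by
  rw [len_eq]
  have h1 := bdir_h V 1 (by norm_num)
  have h2 := bdir_h V (-1) (by norm_num)
  have h3 := bdir_v V 1 (by norm_num)
  have h4 := bdir_v V (-1) (by norm_num)
  omega

lemma card_le_prod (V : Finset Site) :
    V.card ≤ (V.image Prod.fst).card * (V.image Prod.snd).card := by
  rw [← Finset.card_product]
  refine Finset.card_le_card fun p hp => ?_
  exact Finset.mem_product.2 ⟨Finset.mem_image_of_mem _ hp, Finset.mem_image_of_mem _ hp⟩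

/-- Crude isoperimetric inequality. -/
lemma isoper (V : Finset Site) : V.card ≤ edgeBdryCard V ^ 2 := by
  have h1 := len_ge V
  have h2 := card_le_prod V
  nlinarith

lemma len_ge_four {V : Finset Site} (h : V.Nonempty) : 4 ≤ edgeBdryCard V := by
  have h1 := len_ge V
  have h2 : 0 < (V.image Prod.fst).card := Finset.card_pos.2 (h.image _)
  have h3 : 0 < (V.image Prod.snd).card := Finset.card_pos.2 (h.image _)
  omega

lemma len_ge_six {V : Finset Site} (h : 2 ≤ V.card) : 6 ≤ edgeBdryCard V := by
  have h1 := len_ge V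
  have h2 := card_le_prod V
  have hne : V.Nonempty := Finset.card_pos.1 (by omega)
  have h4 : 0 < (V.image Prod.fst).card := Finset.card_pos.2 (hne.image _)
  have h3 : 0 < (V.image Prod.snd).card := Finset.card_pos.2 (hne.image _)
  have : 3 ≤ (V.image Prod.fst).card + (V.image Prod.snd).card := by
    by_contra hlt
    have e1 : (V.image Prod.fst).card = 1 := by omega
    have e2 : (V.image Prod.snd).card = 1 := by omega
    rw [e1, e2] at h2
    omega
  omega

lemma len_singleton (v : Site) : edgeBdryCard {v} = 4 := by
  unfold edgeBdryCard
  simp only [Finset.sum_singleton, Finset.mem_singleton]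
  rw [Finset.filter_true_of_mem]
  · rfl
  · intro d hd
    rw [mem_dirs] at hd
    rcases hd with rfl | rfl | rfl | rfl <;> simp [Prod.ext_iff]

/-- The first exit along the ray to the right. -/
lemma ray_exit (V : Finset Site) (v : Site) (hv : v ∈ V) :
    ∃ i : ℕ, i < edgeBdryCard V ∧ (∀ j ≤ i, v + ((j : ℤ), 0) ∈ V) ∧
      v + (((i + 1 : ℕ) : ℤ), 0) ∉ V := by
  have hex : ∃ i : ℕ, v + (((i + 1 : ℕ) : ℤ), 0) ∉ V := by
    by_contra hcon
    push Not at hcon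
    have hinj : Function.Injective (fun i : ℕ => v + (((i + 1 : ℕ) : ℤ), (0 : ℤ))) := by
      intro a b hab
      simp [Prod.ext_iff] at hab
      exact hab
    exact (Set.infinite_of_injective_forall_mem hinj (s := (↑V : Set Site))
      (fun i => hcon i)) V.finite_toSet
  have hall : ∀ j ≤ Nat.find hex, v + ((j : ℤ), 0) ∈ V := by
    intro j hj
    rcases j with _ | j
    · simpa [Prod.add_def] using hv
    · have := Nat.find_min hex (m := j) (by omega)
      push Not at this
      exact this
  refine ⟨Nat.find hex, ?_, hall, Nat.find_spec hex⟩
  have h1 : Nat.find hex + 1 ≤ (V.image Prod.fst).card := by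
    have : ((Finset.range (Nat.find hex + 1)).image (fun j : ℕ => v.1 + (j : ℤ))) ⊆
        V.image Prod.fst := by
      intro x hx
      obtain ⟨j, hj, rfl⟩ := Finset.mem_image.1 hx
      exact Finset.mem_image.2 ⟨_, hall j (by simpa [Nat.lt_succ_iff] using hj), by simp⟩
    have h2 := Finset.card_le_card this
    rw [Finset.card_image_of_injective _ (fun a b hab => by simpa using hab)] at h2
    simpa using h2
  have := len_ge V
  omega

/-- The boundary determines the finite set. -/
lemma bd_sub {V V' : Finset Site} (h : bd V = bd V') : V ⊆ V' := by
  intro v hv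
  obtain ⟨i, -, hall, hout⟩ := ray_exit V v hv
  have key : ∀ k ≤ i, v + (((i - k : ℕ) : ℤ), 0) ∈ V' := by
    intro k hk
    induction k with
    | zero =>
      have : (v + ((i : ℤ), 0), ((1 : ℤ), (0 : ℤ))) ∈ bd V := by
        rw [mem_bd]
        refine ⟨hall i le_rfl, by simp [dirs], ?_⟩
        convert hout using 1
        simp [add_assoc]
      rw [h, mem_bd] at this
      simpa using this.1
    | succ k ih =>
      have ih := ih (by omega)
      by_contra hcon
      have : (v + (((i - k : ℕ) : ℤ), 0), ((-1 : ℤ), (0 : ℤ))) ∈ bd V' := by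
        rw [mem_bd]
        refine ⟨ih, by simp [dirs], ?_⟩
        convert hcon using 1
        have : ((i - k : ℕ) : ℤ) = ((i - (k + 1) : ℕ) : ℤ) + 1 := by omega
        rw [this]
        simp [add_assoc]
      rw [← h, mem_bd] at this
      apply this.2.2
      have h2 := hall (i - (k + 1)) (by omega)
      convert h2 using 1
      have : ((i - k : ℕ) : ℤ) = ((i - (k + 1) : ℕ) : ℤ) + 1 := by omega
      rw [this]
      simp [add_assoc]
  have := key i le_rfl
  simpa [Prod.add_def] using this

lemma bd_inj {V V' : Finset Site} (h : bd V = bd V') : V = V' :=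
  Finset.Subset.antisymm (bd_sub h) (bd_sub h.symm)

/-! ### Connectivity of the boundary -/

lemma antideriv (c : ℤ → ZMod 2) : ∃ F : ℤ → ZMod 2, F 0 = 0 ∧ ∀ x, F (x + 1) = F x + c x := by
  refine ⟨fun x => ∑ i ∈ Finset.range x.toNat, c i - ∑ i ∈ Finset.range (-x).toNat, c (-1 - i),
    by simp, fun x => ?_⟩
  rcases le_or_gt 0 x with h | h
  · have e1 : (x + 1).toNat = x.toNat + 1 := by omega
    have e2 : (-(x + 1)).toNat = 0 := by omega
    have e3 : (-x).toNat = 0 := by omega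
    have e4 : ((x.toNat : ℕ) : ℤ) = x := by omega
    simp only [e1, e2, e3, Finset.sum_range_succ, e4]
    simp
  · have e1 : (x + 1).toNat = 0 := by omega
    have e2 : (-x).toNat = (-(x + 1)).toNat + 1 := by omega
    have e3 : x.toNat = 0 := by omega
    have e4 : (-1 - (((-(x + 1)).toNat : ℕ) : ℤ)) = x := by omega
    simp only [e1, e2, e3, Finset.sum_range_succ, e4, Finset.range_zero, Finset.sum_empty]
    ring

lemma exact_cochain (a b : ℤ → ℤ → ZMod 2)
    (hcl : ∀ x y, a x y + b (x + 1) y = b x y + a x (y + 1)) :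
    ∃ f : ℤ → ℤ → ZMod 2, (∀ x y, f (x + 1) y = f x y + a x y) ∧
      (∀ x y, f x (y + 1) = f x y + b x y) := by
  obtain ⟨F, hF0, hF⟩ := antideriv (fun x => a x 0)
  choose G hG0 hG using fun x => antideriv (fun y => b x y)
  refine ⟨fun x y => F x + G x y, fun x y => ?_, fun x y => ?_⟩
  · have key : ∀ y, G (x + 1) y + a x 0 = G x y + a x y := by
      intro y
      induction y using Int.induction_on with
      | zero => simp [hG0]
      | succ n ih =>
        rw [hG, hG]
        have := hcl x n
        linear_combination ih + this
      | pred n ih =>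
        have h1 := hG (x + 1) (-n - 1)
        have h2 := hG x (-n - 1)
        have h3 := hcl x (-n - 1)
        rw [sub_add_cancel] at h1 h2 h3
        linear_combination ih - h1 + h2 - h3
    have := key y
    simp only [hF]
    linear_combination this
  · simp only [hG]
    ring

def near (e e' : Site × Site) : Prop :=
  |e'.1.1 - e.1.1| ≤ 1 ∧ |e'.1.2 - e.1.2| ≤ 1

lemma bd_connected (V : Finset Site) (hV : connectedIn (↑V : Set Site))
    (hV' : connectedIn ((↑V : Set Site)ᶜ)) (T : Finset (Site × Site)) (hT : T ⊆ bd V)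
    (hne : T.Nonempty) (hcl : ∀ e ∈ T, ∀ e' ∈ bd V, near e e' → e' ∈ T) : T = bd V := by
  obtain ⟨E, hE⟩ : ∃ E : Site → Site → Prop,
      ∀ p q, E p q ↔ ((p, q - p) ∈ T ∨ (q, p - q) ∈ T) := ⟨_, fun _ _ => Iff.rfl⟩
  let a : ℤ → ℤ → ZMod 2 := fun x y => if E (x, y) (x + 1, y) then 1 else 0
  let b : ℤ → ℤ → ZMod 2 := fun x y => if E (x, y) (x, y + 1) then 1 else 0
  -- membership in T in a plaquette
  have hplaq : ∀ x y, a x y + b (x + 1) y = b x y + a x (y + 1) := by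
    intro x y
    let P : Site → Prop := fun p => (p.1 = x ∨ p.1 = x + 1) ∧ (p.2 = y ∨ p.2 = y + 1)
    have hnear : ∀ p q d d', P p → P q → near (p, d) (q, d') := by
      rintro ⟨p1, p2⟩ ⟨q1, q2⟩ d d' ⟨hp1, hp2⟩ ⟨hq1, hq2⟩
      simp only at hp1 hp2 hq1 hq2
      refine ⟨?_, ?_⟩ <;> simp only [abs_le] <;> constructor <;> omega
    let t : Prop := ∃ e ∈ T, P e.1
    have hmem : ∀ p q, P p → q - p ∈ dirs → ((p, q - p) ∈ T ↔ (p ∈ V ∧ q ∉ V ∧ t)) := by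
      intro p q hp hd
      constructor
      · intro h
        have := (mem_bd _ _).1 (hT h)
        simp only [add_sub_cancel] at this
        exact ⟨this.1, this.2.2, _, h, hp⟩
      · rintro ⟨h1, h2, e, he, hPe⟩
        refine hcl e he _ ?_ (hnear _ _ _ _ hPe hp)
        rw [mem_bd]
        simp only [add_sub_cancel]
        exact ⟨h1, hd, h2⟩
    have hEE : ∀ p q, P p → P q → q - p ∈ dirs →
        (E p q ↔ ((p ∈ V ∧ q ∉ V ∧ t) ∨ (q ∈ V ∧ p ∉ V ∧ t))) := by
      intro p q hp hq hd
      have hd' : p - q ∈ dirs := by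
        have := neg_mem_dirs hd
        rwa [neg_sub] at this
      rw [hE, hmem p q hp hd, hmem q p hq hd']
    have p00 : P (x, y) := by simp [P]
    have p10 : P (x + 1, y) := by simp [P]
    have p01 : P (x, y + 1) := by simp [P]
    have p11 : P (x + 1, y + 1) := by simp [P]
    simp only [a, b]
    rw [hEE _ _ p00 p10 (by simp [dirs]), hEE _ _ p10 p11 (by simp [dirs]),
      hEE _ _ p00 p01 (by simp [dirs]), hEE _ _ p01 p11 (by simp [dirs])]
    have h2 : (1 : ZMod 2) + 1 = 0 := by decide
    by_cases h00 : (x, y) ∈ V <;> by_cases h10 : (x + 1, y) ∈ V <;>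
      by_cases h01 : (x, y + 1) ∈ V <;> by_cases h11 : (x + 1, y + 1) ∈ V <;>
      by_cases ht : t <;> simp [h00, h10, h01, h11, ht, h2]
  obtain ⟨f, hf1, hf2⟩ := exact_cochain a b hplaq
  have hstep : ∀ p q : Site, q - p ∈ dirs →
      f q.1 q.2 = f p.1 p.2 + (if E p q then 1 else 0) := by
    have hsymm : ∀ p q, E p q ↔ E q p := fun p q => by rw [hE, hE]; exact or_comm
    have hneg : ∀ z : ZMod 2, z + z = 0 := by decide
    rintro ⟨p1, p2⟩ ⟨q1, q2⟩ hd
    rw [mem_dirs] at hd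
    simp only [Prod.mk_sub_mk, Prod.mk.injEq] at hd
    rcases hd with ⟨h1, h2⟩ | ⟨h1, h2⟩ | ⟨h1, h2⟩ | ⟨h1, h2⟩
    · obtain rfl : q1 = p1 + 1 := by omega
      obtain rfl : q2 = p2 := by omega
      exact hf1 _ _
    · obtain rfl : p1 = q1 + 1 := by omega
      obtain rfl : q2 = p2 := by omega
      rw [hsymm]
      have := hf1 q1 q2
      simp only [a] at this
      have h3 := hneg (if E (q1, q2) (q1 + 1, q2) then 1 else 0)
      linear_combination -this - h3
    · obtain rfl : q1 = p1 := by omega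
      obtain rfl : q2 = p2 + 1 := by omega
      exact hf2 _ _
    · obtain rfl : q1 = p1 := by omega
      obtain rfl : p2 = q2 + 1 := by omega
      rw [hsymm]
      have := hf2 q1 q2
      simp only [b] at this
      have h3 := hneg (if E (q1, q2) (q1, q2 + 1) then 1 else 0)
      linear_combination -this - h3
  have hconst : ∀ S : Set Site, connectedIn S → (∀ p ∈ S, ∀ q ∈ S, ¬ E p q) →
      ∀ p ∈ S, ∀ q ∈ S, f p.1 p.2 = f q.1 q.2 := by
    intro S hS hno p hp q hq
    have := hS p hp q hq
    clear hq
    induction this with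
    | refl => rfl
    | tail _ h ih =>
      rw [ih, hstep _ _ h.1, if_neg (hno _ h.2.1 _ h.2.2), add_zero]
  have c1 := hconst _ hV (by
    intro p hp q hq h
    rcases (hE _ _).1 h with h | h
    · have := (mem_bd _ _).1 (hT h)
      simp only [add_sub_cancel] at this
      exact this.2.2 hq
    · have := (mem_bd _ _).1 (hT h)
      simp only [add_sub_cancel] at this
      exact this.2.2 hp)
  have c2 := hconst _ hV' (by
    intro p hp q hq h
    rcases (hE _ _).1 h with h | h
    · exact hp ((mem_bd _ _).1 (hT h)).1
    · exact hq ((mem_bd _ _).1 (hT h)).1)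
  obtain ⟨e0, he0⟩ := hne
  refine Finset.Subset.antisymm hT fun e he => ?_
  have m0 := (mem_bd _ _).1 (hT he0)
  have m1 := (mem_bd _ _).1 he
  have s0 := hstep e0.1 (e0.1 + e0.2) (by simpa using m0.2.1)
  have s1 := hstep e.1 (e.1 + e.2) (by simpa using m1.2.1)
  rw [if_pos ((hE _ _).2 (Or.inl (by simpa using he0)))] at s0
  have d1 := c1 _ m0.1 _ m1.1
  have d2 := c2 _ m0.2.2 _ m1.2.2
  rw [d1, d2, s1] at s0
  by_cases hEe : E e.1 (e.1 + e.2)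
  · rcases (hE _ _).1 hEe with h | h
    · simpa using h
    · exact absurd ((mem_bd _ _).1 (hT h)).1 m1.2.2
  · rw [if_neg hEe] at s0
    simp at s0

/-! ### Counting -/

def nbE (e : Site × Site) : Finset (Site × Site) :=
  ((Finset.Icc (e.1.1 - 1) (e.1.1 + 1)) ×ˢ (Finset.Icc (e.1.2 - 1) (e.1.2 + 1))) ×ˢ dirs

lemma card_nbE (e : Site × Site) : (nbE e).card ≤ 36 := by
  have : dirs.card = 4 := rfl
  simp only [nbE, Finset.card_product, Int.card_Icc, this]
  have e1 : (e.1.1 + 1 + 1 - (e.1.1 - 1)).toNat = 3 := by omega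
  have e2 : (e.1.2 + 1 + 1 - (e.1.2 - 1)).toNat = 3 := by omega
  rw [e1, e2]

lemma mem_nbE {e e' : Site × Site} (h : near e e') (hd : e'.2 ∈ dirs) : e' ∈ nbE e := by
  unfold near at h
  rw [abs_le, abs_le] at h
  simp only [nbE, Finset.mem_product, Finset.mem_Icc, hd, and_true]
  omega

lemma near_symm {e e' : Site × Site} (h : near e e') : near e' e := by
  unfold near at *
  rwa [abs_sub_comm, abs_sub_comm e.1.2]

def walks : ℕ → Site × Site → Finset (List (Site × Site))
  | 0, e => {[e]}
  | n + 1, e => (nbE e).biUnion fun e' => (walks n e').image (fun l => e :: l)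

lemma card_walks (n : ℕ) (e : Site × Site) : (walks n e).card ≤ 36 ^ n := by
  induction n generalizing e with
  | zero => simp [walks]
  | succ n ih =>
    rw [walks, pow_succ, mul_comm]
    refine Finset.card_biUnion_le.trans ?_
    refine (Finset.sum_le_card_nsmul _ _ (36 ^ n) fun e' _ =>
      Finset.card_image_le.trans (ih e')).trans ?_
    rw [smul_eq_mul]
    exact Nat.mul_le_mul_right _ (card_nbE e)

lemma walks_insert (n : ℕ) (e : Site × Site) (l : List (Site × Site)) (hl : l ∈ walks n e)
    (x y : Site × Site) (hx : x ∈ l) (hy : y ∈ nbE x) (hxy : x ∈ nbE y) :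
    ∃ l' ∈ walks (n + 2) e, l'.toFinset = insert y l.toFinset := by
  induction n generalizing e l with
  | zero =>
    simp only [walks, Finset.mem_singleton] at hl
    subst hl
    simp only [List.mem_singleton] at hx
    subst hx
    refine ⟨[x, y, x], ?_, ?_⟩
    · simp only [walks]
      refine Finset.mem_biUnion.2 ⟨y, hy, Finset.mem_image.2 ⟨[y, x], ?_, rfl⟩⟩
      exact Finset.mem_biUnion.2 ⟨x, hxy, Finset.mem_image.2 ⟨[x], by simp, rfl⟩⟩
    · ext z
      simp only [List.mem_toFinset, List.mem_cons, Finset.mem_insert, List.not_mem_nil]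
      tauto
  | succ n ih =>
    have hl0 := hl
    rw [walks] at hl
    obtain ⟨e', he', h2⟩ := Finset.mem_biUnion.1 hl
    obtain ⟨l1, hl1, rfl⟩ := Finset.mem_image.1 h2
    rcases List.mem_cons.1 hx with rfl | hx'
    · refine ⟨x :: y :: x :: l1, ?_, ?_⟩
      · rw [walks]
        refine Finset.mem_biUnion.2 ⟨y, hy, Finset.mem_image.2 ⟨y :: x :: l1, ?_, rfl⟩⟩
        rw [walks]
        exact Finset.mem_biUnion.2 ⟨x, hxy, Finset.mem_image.2 ⟨x :: l1, hl0, rfl⟩⟩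
      · ext z
        simp only [List.mem_toFinset, List.mem_cons, Finset.mem_insert]
        tauto
    · obtain ⟨l', hl', h3⟩ := ih e' l1 hl1 hx'
      refine ⟨e :: l', ?_, ?_⟩
      · rw [walks]
        exact Finset.mem_biUnion.2 ⟨e', he', Finset.mem_image.2 ⟨l', hl', rfl⟩⟩
      · rw [List.toFinset_cons, h3, List.toFinset_cons, Finset.insert_comm]

lemma walks_grow (S : Finset (Site × Site)) (hd : ∀ e ∈ S, e.2 ∈ dirs)
    (hS : ∀ T ⊆ S, T.Nonempty → (∀ e ∈ T, ∀ e' ∈ S, near e e' → e' ∈ T) → T = S)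
    (e : Site × Site) (he : e ∈ S) (m : ℕ) (hm : m < S.card) :
    ∃ l ∈ walks (2 * m) e, l.toFinset ⊆ S ∧ l.toFinset.card = m + 1 := by
  induction m with
  | zero => exact ⟨[e], by simp [walks], by simpa using he, by simp⟩
  | succ m ih =>
    obtain ⟨l, hl, hsub, hcard⟩ := ih (by omega)
    have hne : l.toFinset ≠ S := by
      intro h
      rw [h] at hcard
      omega
    have : ∃ x ∈ l.toFinset, ∃ y ∈ S, near x y ∧ y ∉ l.toFinset := by
      by_contra hcon
      push Not at hcon
      exact hne (hS _ hsub (Finset.card_pos.1 (by omega)) hcon)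
    obtain ⟨x, hx, y, hy, hxy, hyn⟩ := this
    obtain ⟨l', hl', h3⟩ := walks_insert _ e l hl x y (List.mem_toFinset.1 hx)
      (mem_nbE hxy (hd y hy)) (mem_nbE (near_symm hxy) (hd x (hsub hx)))
    refine ⟨l', hl', ?_, ?_⟩
    · rw [h3]
      exact Finset.insert_subset hy hsub
    · rw [h3, Finset.card_insert_of_notMem hyn, hcard]

/-- Validity of an interior. -/
def VInt (V : Finset Site) : Prop :=
  V.Nonempty ∧ connectedIn (↑V : Set Site) ∧ connectedIn ((↑V : Set Site)ᶜ)

lemma count_len (v : Site) (ℓ : ℕ) (G : Finset (Finset Site))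
    (hG : ∀ V ∈ G, VInt V ∧ v ∈ V ∧ edgeBdryCard V = ℓ) : G.card ≤ 2592 ^ ℓ := by
  let R : Finset (Finset (Site × Site)) := (Finset.range ℓ).biUnion fun i =>
    (walks (2 * (ℓ - 1)) (v + ((i : ℤ), 0), (1, 0))).image List.toFinset
  have hR : R.card ≤ ℓ * 36 ^ (2 * (ℓ - 1)) := by
    refine Finset.card_biUnion_le.trans ?_
    refine (Finset.sum_le_card_nsmul _ _ (36 ^ (2 * (ℓ - 1))) fun i _ =>
      Finset.card_image_le.trans (card_walks _ _)).trans ?_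
    simp
  have hmap : G.card ≤ R.card := by
    refine Finset.card_le_card_of_injOn bd ?_ (fun V _ V' _ h => bd_inj h)
    intro V hV
    obtain ⟨⟨hne, hc, hc'⟩, hv, hlen⟩ := hG V hV
    obtain ⟨i, hi, hall, hout⟩ := ray_exit V v hv
    have he : (v + ((i : ℤ), 0), ((1 : ℤ), (0 : ℤ))) ∈ bd V := by
      rw [mem_bd]
      refine ⟨hall i le_rfl, by simp [dirs], ?_⟩
      convert hout using 1
      simp [add_assoc]
    have h4 := len_ge_four hne
    obtain ⟨l, hl, hsub, hcard⟩ := walks_grow (bd V) (fun e he => ((mem_bd _ _).1 he).2.1)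
      (fun T hT hTne hcl => bd_connected V hc hc' T hT hTne hcl) _ he (ℓ - 1)
      (by rw [card_bd, hlen]; omega)
    have heq : l.toFinset = bd V := Finset.eq_of_subset_of_card_le hsub (by
      rw [card_bd, hlen, hcard]; omega)
    refine Finset.mem_coe.2 (Finset.mem_biUnion.2 ⟨i, by simpa [← hlen] using hi, ?_⟩)
    exact Finset.mem_image.2 ⟨l, hl, heq⟩
  refine hmap.trans (hR.trans ?_)
  calc ℓ * 36 ^ (2 * (ℓ - 1)) ≤ 2 ^ ℓ * 36 ^ (2 * ℓ) :=
        Nat.mul_le_mul (Nat.lt_two_pow_self).le (Nat.pow_le_pow_right (by norm_num) (by omega))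
    _ = 2592 ^ ℓ := by rw [pow_mul, ← mul_pow]; norm_num

/-- Peierls sum. -/
lemma peierls (v : Site) (G : Finset (Finset Site))
    (hG : ∀ V ∈ G, VInt V ∧ v ∈ V) :
    ∑ V ∈ G, Real.exp (-(10 : ℝ) * (edgeBdryCard V : ℝ)) ≤ 1 := by
  have h1 : ∑ V ∈ G, Real.exp (-(10 : ℝ) * (edgeBdryCard V : ℝ)) =
      ∑ ℓ ∈ G.image edgeBdryCard, ∑ V ∈ G.filter (fun V => edgeBdryCard V = ℓ),
        Real.exp (-(10 : ℝ) * (edgeBdryCard V : ℝ)) :=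
    (Finset.sum_fiberwise_of_maps_to (fun V hV => Finset.mem_image_of_mem _ hV) _).symm
  have hexp : 2592 * Real.exp (-10) ≤ 1 / 2 := by
    have : (2.7182818283 : ℝ) ^ 10 ≤ Real.exp 10 := by
      have := Real.exp_one_gt_d9.le
      calc (2.7182818283 : ℝ) ^ 10 ≤ Real.exp 1 ^ 10 := by gcongr
        _ = Real.exp 10 := by rw [← Real.exp_nat_mul]; norm_num
    rw [Real.exp_neg, ← div_eq_mul_inv, div_le_iff₀ (Real.exp_pos _)]
    norm_num at this
    linarith
  have h2 : ∀ ℓ ∈ G.image edgeBdryCard, ∑ V ∈ G.filter (fun V => edgeBdryCard V = ℓ),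
        Real.exp (-(10 : ℝ) * (edgeBdryCard V : ℝ)) ≤ (1 / 2) ^ ℓ := by
    intro ℓ _
    have hc := count_len v ℓ (G.filter (fun V => edgeBdryCard V = ℓ)) (by
      intro V hV
      obtain ⟨a, b⟩ := Finset.mem_filter.1 hV
      exact ⟨(hG V a).1, (hG V a).2, b⟩)
    have hc' : ((G.filter (fun V => edgeBdryCard V = ℓ)).card : ℝ) ≤ 2592 ^ ℓ := by
      exact_mod_cast hc
    calc ∑ V ∈ G.filter (fun V => edgeBdryCard V = ℓ),
          Real.exp (-(10 : ℝ) * (edgeBdryCard V : ℝ))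
        = ∑ V ∈ G.filter (fun V => edgeBdryCard V = ℓ), Real.exp (-10) ^ ℓ := by
          refine Finset.sum_congr rfl fun V hV => ?_
          rw [(Finset.mem_filter.1 hV).2, ← Real.exp_nat_mul, mul_comm]
      _ = ((G.filter (fun V => edgeBdryCard V = ℓ)).card : ℝ) * Real.exp (-10) ^ ℓ := by
          rw [Finset.sum_const, nsmul_eq_mul]
      _ ≤ 2592 ^ ℓ * Real.exp (-10) ^ ℓ := by gcongr
      _ = (2592 * Real.exp (-10)) ^ ℓ := by rw [mul_pow]
      _ ≤ (1 / 2) ^ ℓ := by gcongr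
  rw [h1]
  refine (Finset.sum_le_sum h2).trans ?_
  have h3 : G.image edgeBdryCard ⊆ (Finset.range ((G.image edgeBdryCard).sup id + 1)).erase 0 := by
    intro ℓ hℓ
    refine Finset.mem_erase.2 ⟨?_, Finset.mem_range.2 (Nat.lt_succ_of_le (Finset.le_sup (f := id) hℓ))⟩
    obtain ⟨V, hV, rfl⟩ := Finset.mem_image.1 hℓ
    have := len_ge_four (hG V hV).1.1
    omega
  refine (Finset.sum_le_sum_of_subset_of_nonneg h3 (fun _ _ _ => by positivity)).trans ?_
  generalize (G.image edgeBdryCard).sup id = N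
  have h4 : ∑ ℓ ∈ Finset.range (N + 1), (1 / 2 : ℝ) ^ ℓ ≤ 2 := by
    have := Summable.sum_le_tsum (Finset.range (N + 1)) (f := fun n : ℕ => (1 / 2 : ℝ) ^ n)
      (fun _ _ => by positivity) summable_geometric_two
    rwa [tsum_geometric_two] at this
  have h5 := Finset.add_sum_erase (Finset.range (N + 1)) (fun ℓ => (1 / 2 : ℝ) ^ ℓ)
    (a := 0) (by simp)
  simp only [pow_zero] at h5
  linarith

lemma peierls' (v : Site) (G : Finset (Finset Site)) (hG : ∀ V ∈ G, VInt V ∧ v ∈ V)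
    (c : ℝ) (hc : 10 ≤ c) (m : ℕ) (hm : ∀ V ∈ G, m ≤ edgeBdryCard V) :
    ∑ V ∈ G, Real.exp (-c * (edgeBdryCard V : ℝ)) ≤ Real.exp (-(c - 10) * m) := by
  calc ∑ V ∈ G, Real.exp (-c * (edgeBdryCard V : ℝ))
      ≤ ∑ V ∈ G, Real.exp (-(c - 10) * m) * Real.exp (-(10 : ℝ) * (edgeBdryCard V : ℝ)) := by
        refine Finset.sum_le_sum fun V hV => ?_
        rw [← Real.exp_add]
        refine Real.exp_le_exp.2 ?_
        have : (m : ℝ) ≤ edgeBdryCard V := by exact_mod_cast hm V hV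
        nlinarith
    _ = Real.exp (-(c - 10) * m) * ∑ V ∈ G, Real.exp (-(10 : ℝ) * (edgeBdryCard V : ℝ)) := by
        rw [Finset.mul_sum]
    _ ≤ Real.exp (-(c - 10) * m) * 1 := by
        gcongr
        exact peierls v G hG
    _ = _ := mul_one _

end

open scoped BigOperators
open Filter

noncomputable section

attribute [local instance] Classical.propDecidable

/-! ## Part 2: abstract gas of compatible objects -/

def cset {α : Type} (R : α → α → Prop) (S : Finset α) : Prop := ∀ x ∈ S, ∀ y ∈ S, R x y

def gz {α : Type} (P : Finset α → Prop) (C : Finset α) (z : α → ℝ) : ℝ :=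
  ∑ S ∈ C.powerset, if P S then ∏ x ∈ S, z x else 0

lemma gz_insert {α : Type} (P : Finset α → Prop) (C : Finset α) (z : α → ℝ) (a : α) (ha : a ∉ C) :
    gz P (insert a C) z = gz P C z + z a * gz (fun S => P (insert a S)) C z := by
  unfold gz
  rw [Finset.sum_powerset_insert ha, Finset.mul_sum]
  congr 1
  refine Finset.sum_congr rfl fun S hS => ?_
  rw [Finset.prod_insert (fun h => ha (Finset.mem_powerset.1 hS h))]
  split_ifs <;> simp

lemma gz_nonneg {α : Type} (P : Finset α → Prop) (C : Finset α) (z : α → ℝ) (hz : ∀ x, 0 ≤ z x) :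
    0 ≤ gz P C z := by
  unfold gz
  refine Finset.sum_nonneg fun S _ => ?_
  split_ifs
  · exact Finset.prod_nonneg fun x _ => hz x
  · exact le_rfl

lemma gz_mono_P {α : Type} (P Q : Finset α → Prop) (C : Finset α) (z : α → ℝ) (hz : ∀ x, 0 ≤ z x)
    (h : ∀ S, Q S → P S) : gz Q C z ≤ gz P C z := by
  unfold gz
  refine Finset.sum_le_sum fun S _ => ?_
  have := Finset.prod_nonneg (s := S) fun x _ => hz x
  by_cases hQ : Q S
  · simp [hQ, h S hQ]
  · simp only [hQ, if_false]
    split_ifs <;> simp [this]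

lemma gz_congr {α : Type} (P : Finset α → Prop) (C : Finset α) (z z' : α → ℝ)
    (h : ∀ x ∈ C, z x = z' x) : gz P C z = gz P C z' := by
  unfold gz
  refine Finset.sum_congr rfl fun S hS => ?_
  rw [Finset.prod_congr rfl fun x hx => h x (Finset.mem_powerset.1 hS hx)]

lemma gz_ge_one {α : Type} (P : Finset α → Prop) (hP : P ∅) (C : Finset α) (z : α → ℝ)
    (hz : ∀ x, 0 ≤ z x) : 1 ≤ gz P C z := by
  unfold gz
  have := Finset.single_le_sum (f := fun S => if P S then ∏ x ∈ S, z x else 0)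
    (s := C.powerset) (fun S _ => by
      show 0 ≤ if P S then ∏ x ∈ S, z x else 0
      split_ifs
      · exact Finset.prod_nonneg fun x _ => hz x
      · exact le_rfl) (Finset.empty_mem_powerset C)
  simpa [hP] using this

lemma gz_split {α : Type} (P : Finset α → Prop) (C : Finset α) (z : α → ℝ) (a : α) (ha : a ∈ C) :
    gz P C z = gz P (C.erase a) z + z a * gz (fun S => P (insert a S)) (C.erase a) z := by
  have := gz_insert P (C.erase a) z a (Finset.notMem_erase a C)
  rwa [Finset.insert_erase ha] at this

lemma gz_ub_aux {α : Type} (P : Finset α → Prop) (hP0 : P ∅) (hP : ∀ S T, S ⊆ T → P T → P S)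
    (C : Finset α)
    (z z' : α → ℝ) (hz : ∀ x, 0 ≤ z x) (hz' : ∀ x, 0 ≤ z' x) (D : Finset α) (hD : D ⊆ C) :
    gz P C (fun x => if x ∈ D then z' x else z x) ≤
      gz P C z * Real.exp (∑ x ∈ D, max (z' x - z x) 0) := by
  induction D using Finset.induction_on with
  | empty => simp
  | insert a D haD ih =>
    have haC : a ∈ C := hD (Finset.mem_insert_self _ _)
    have ih := ih (fun x hx => hD (Finset.mem_insert_of_mem hx))
    set y : α → ℝ := fun x => if x ∈ D then z' x else z x with hy
    set y' : α → ℝ := fun x => if x ∈ insert a D then z' x else z x with hy'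
    have hy0 : ∀ x, 0 ≤ y x := fun x => by
      simp only [hy]; split_ifs; exacts [hz' x, hz x]
    have hcongr : ∀ x ∈ C.erase a, y' x = y x := by
      intro x hx
      have : x ≠ a := Finset.ne_of_mem_erase hx
      simp [hy, hy', this]
    have e1 := gz_split P C y' a haC
    have e2 := gz_split P C y a haC
    rw [gz_congr _ _ _ _ hcongr, gz_congr _ _ _ _ hcongr] at e1
    set A0 := gz P (C.erase a) y
    set A := gz (fun S => P (insert a S)) (C.erase a) y
    have hA0 : 0 ≤ A := gz_nonneg _ _ _ hy0
    have hA : A ≤ A0 := gz_mono_P _ _ _ _ hy0 fun S h => hP _ _ (Finset.subset_insert _ _) h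
    have ya : y a = z a := by simp [hy, haD]
    have ya' : y' a = z' a := by simp [hy']
    rw [ya] at e2
    rw [ya'] at e1
    have hm : z' a - z a ≤ max (z' a - z a) 0 := le_max_left _ _
    have hm0 : 0 ≤ max (z' a - z a) 0 := le_max_right _ _
    set M := max (z' a - z a) 0
    have hza := hz a
    rw [Finset.sum_insert haD, Real.exp_add, e1]
    have hstep : A0 + z' a * A ≤ gz P C y * Real.exp M := by
      have h1 : A0 + z' a * A ≤ gz P C y * (1 + M) := by
        rw [e2]
        nlinarith [mul_nonneg hza hA0, mul_le_mul_of_nonneg_right hm hA0,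
          mul_le_mul_of_nonneg_left hA hm0, mul_nonneg (mul_nonneg hza hA0) hm0]
      refine h1.trans ?_
      have : 1 + M ≤ Real.exp M := by linarith [Real.add_one_le_exp M]
      exact mul_le_mul_of_nonneg_left this (gz_nonneg _ _ _ hy0)
    calc A0 + z' a * A ≤ gz P C y * Real.exp M := hstep
      _ ≤ (gz P C z * Real.exp (∑ x ∈ D, max (z' x - z x) 0)) * Real.exp M := by gcongr
      _ = _ := by ring

lemma gz_ub {α : Type} (P : Finset α → Prop) (hP0 : P ∅) (hP : ∀ S T, S ⊆ T → P T → P S)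
    (C : Finset α)
    (z z' : α → ℝ) (hz : ∀ x, 0 ≤ z x) (hz' : ∀ x, 0 ≤ z' x) :
    gz P C z' ≤ gz P C z * Real.exp (∑ x ∈ C, max (z' x - z x) 0) := by
  have := gz_ub_aux P hP0 hP C z z' hz hz' C (Finset.Subset.refl _)
  rwa [gz_congr P C _ z' (fun x hx => by simp [hx])] at this

lemma gz_A_lb {α : Type} (R : α → α → Prop) (C : Finset α) (y : α → ℝ) (hy : ∀ x, 0 ≤ y x)
    (a : α) (haC : a ∈ C) (haa : R a a)
    (hbad : ∑ b ∈ C.filter (fun b => b = a ∨ ¬ R a b ∨ ¬ R b a), y b ≤ 1 / 2) :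
    gz (cset R) C y / 2 ≤ gz (fun S => cset R (insert a S)) (C.erase a) y := by
  set Bad := C.filter (fun b => b = a ∨ ¬ R a b ∨ ¬ R b a) with hBad
  have hdown : ∀ S T : Finset α, S ⊆ T → cset R T → cset R S :=
    fun S T h hT x hx y hy => hT x (h hx) y (h hy)
  -- the sum restricted to sets containing b
  have hb : ∀ b ∈ C, (∑ S ∈ C.powerset, if cset R S ∧ b ∈ S then ∏ x ∈ S, y x else 0) ≤
      y b * gz (cset R) C y := by
    intro b hbC
    have e1 : (∑ S ∈ C.powerset, if cset R S ∧ b ∈ S then ∏ x ∈ S, y x else 0) =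
        gz (fun S => cset R S ∧ b ∈ S) C y := by
      unfold gz; refine Finset.sum_congr rfl fun S _ => ?_; congr
    rw [e1, gz_split _ _ _ b hbC]
    have e2 : gz (fun S => cset R S ∧ b ∈ S) (C.erase b) y = 0 := by
      unfold gz
      refine Finset.sum_eq_zero fun S hS => ?_
      have : b ∉ S := fun h => Finset.notMem_erase b C (Finset.mem_powerset.1 hS h)
      simp [this]
    rw [e2, zero_add]
    refine mul_le_mul_of_nonneg_left ?_ (hy b)
    have h1 : gz (fun S => cset R (insert b S) ∧ b ∈ insert b S) (C.erase b) y ≤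
        gz (cset R) (C.erase b) y :=
      gz_mono_P _ _ _ _ hy fun S h => hdown _ _ (Finset.subset_insert _ _) h.1
    refine h1.trans ?_
    rw [gz_split (cset R) C y b hbC]
    have := mul_nonneg (hy b) (gz_nonneg (fun S => cset R (insert b S)) (C.erase b) y hy)
    linarith
  have hA : gz (fun S => cset R (insert a S)) (C.erase a) y =
      ∑ S ∈ C.powerset, if cset R (insert a S) ∧ a ∉ S then ∏ x ∈ S, y x else 0 := by
    have e1 : (∑ S ∈ C.powerset, if cset R (insert a S) ∧ a ∉ S then ∏ x ∈ S, y x else 0) =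
        gz (fun S => cset R (insert a S) ∧ a ∉ S) C y := by
      unfold gz; refine Finset.sum_congr rfl fun S _ => ?_; congr
    rw [e1, gz_split _ _ _ a haC]
    have e2 : gz (fun S => cset R (insert a (insert a S)) ∧ a ∉ insert a S) (C.erase a) y = 0 := by
      unfold gz
      refine Finset.sum_eq_zero fun S hS => ?_
      simp
    rw [e2, mul_zero, add_zero]
    unfold gz
    refine Finset.sum_congr rfl fun S hS => ?_
    have : a ∉ S := fun h => Finset.notMem_erase a C (Finset.mem_powerset.1 hS h)
    simp [this]
  have hmain : gz (cset R) C y ≤ gz (fun S => cset R (insert a S)) (C.erase a) y +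
      ∑ b ∈ Bad, ∑ S ∈ C.powerset, if cset R S ∧ b ∈ S then ∏ x ∈ S, y x else 0 := by
    rw [hA, Finset.sum_comm, ← Finset.sum_add_distrib]
    unfold gz
    refine Finset.sum_le_sum fun S hS => ?_
    have hp := Finset.prod_nonneg (s := S) fun x _ => hy x
    have hS' := Finset.mem_powerset.1 hS
    by_cases hc : cset R S
    · rw [if_pos hc]
      by_cases hbad' : ∃ b ∈ Bad, b ∈ S
      · obtain ⟨b, hbB, hbS⟩ := hbad'
        have h1 := Finset.single_le_sum (s := Bad)
          (f := fun b => if cset R S ∧ b ∈ S then ∏ x ∈ S, y x else 0)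
          (fun i _ => by
            show 0 ≤ if cset R S ∧ i ∈ S then ∏ x ∈ S, y x else 0
            split_ifs <;> simp [hp]) hbB
        simp only [hc, hbS, and_self, if_true, true_and] at h1
        have h2 : 0 ≤ if cset R (insert a S) ∧ a ∉ S then ∏ x ∈ S, y x else 0 := by
          split_ifs <;> simp [hp]
        simp only [hc, true_and]
        linarith
      · push Not at hbad'
        have hgood : ∀ b ∈ S, b ≠ a ∧ R a b ∧ R b a := by
          intro b hbS
          by_contra hcon
          refine hbad' b (Finset.mem_filter.2 ⟨hS' hbS, ?_⟩) hbS
          tauto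
        have haS : a ∉ S := fun h => (hgood a h).1 rfl
        have hci : cset R (insert a S) := by
          intro x hx x' hx'
          rcases Finset.mem_insert.1 hx with hx1 | hx1 <;>
            rcases Finset.mem_insert.1 hx' with hx2 | hx2
          · rw [hx1, hx2]; exact haa
          · rw [hx1]; exact (hgood _ hx2).2.1
          · rw [hx2]; exact (hgood _ hx1).2.2
          · exact hc x hx1 x' hx2
        rw [if_pos ⟨hci, haS⟩]
        have : 0 ≤ ∑ b ∈ Bad, if cset R S ∧ b ∈ S then ∏ x ∈ S, y x else 0 :=
          Finset.sum_nonneg fun i _ => by split_ifs <;> simp [hp]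
        linarith
    · rw [if_neg hc]
      refine add_nonneg (by split_ifs <;> simp [hp])
        (Finset.sum_nonneg fun i _ => by split_ifs <;> simp [hp])
  have h2 : ∑ b ∈ Bad, (∑ S ∈ C.powerset, if cset R S ∧ b ∈ S then ∏ x ∈ S, y x else 0) ≤
      (∑ b ∈ Bad, y b) * gz (cset R) C y := by
    rw [Finset.sum_mul]
    exact Finset.sum_le_sum fun b hbB => hb b (Finset.mem_filter.1 hbB).1
  have h3 := gz_nonneg (cset R) C y hy
  have h4 := mul_le_mul_of_nonneg_right hbad h3
  linarith

lemma gz_lb {α : Type} (R : α → α → Prop) (C : Finset α) (z z' zb : α → ℝ) (hz : ∀ x, 0 ≤ z x)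
    (hzb : ∀ x, z x ≤ zb x) (hzb' : ∀ x, z' x ≤ zb x)
    (D : Finset α) (hD : D ⊆ C) (hDz : ∀ x ∈ D, z x ≤ z' x) (hDz1 : ∀ x ∈ D, z' x - z x ≤ 1)
    (hRR : ∀ a ∈ D, R a a)
    (hbad : ∀ a ∈ D, ∑ b ∈ C.filter (fun b => b = a ∨ ¬ R a b ∨ ¬ R b a), zb b ≤ 1 / 2) :
    gz (cset R) C z * Real.exp (∑ x ∈ D, (z' x - z x) / 4) ≤
      gz (cset R) C (fun x => if x ∈ D then z' x else z x) := by
  induction D using Finset.induction_on with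
  | empty => simp
  | insert a D haD ih =>
    have haI : a ∈ insert a D := Finset.mem_insert_self _ _
    have haC : a ∈ C := hD haI
    have ih := ih (fun x hx => hD (Finset.mem_insert_of_mem hx))
      (fun x hx => hDz x (Finset.mem_insert_of_mem hx))
      (fun x hx => hDz1 x (Finset.mem_insert_of_mem hx))
      (fun x hx => hRR x (Finset.mem_insert_of_mem hx))
      (fun x hx => hbad x (Finset.mem_insert_of_mem hx))
    set y : α → ℝ := fun x => if x ∈ D then z' x else z x with hy
    set y' : α → ℝ := fun x => if x ∈ insert a D then z' x else z x with hy'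
    have hy0 : ∀ x, 0 ≤ y x := fun x => by
      simp only [hy]; split_ifs with h
      · exact (hz x).trans (hDz x (Finset.mem_insert_of_mem h))
      · exact hz x
    have hyb : ∀ x, y x ≤ zb x := fun x => by
      simp only [hy]; split_ifs with h
      · exact hzb' x
      · exact hzb x
    have hcongr : ∀ x ∈ C.erase a, y' x = y x := by
      intro x hx
      have : x ≠ a := Finset.ne_of_mem_erase hx
      simp [hy, hy', this]
    have e1 := gz_split (cset R) C y' a haC
    have e2 := gz_split (cset R) C y a haC
    rw [gz_congr _ _ _ _ hcongr, gz_congr _ _ _ _ hcongr] at e1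
    have hA := gz_A_lb R C y hy0 a haC (hRR a haI)
      ((Finset.sum_le_sum fun b _ => hyb b).trans (hbad a haI))
    have hG := gz_nonneg (cset R) C y hy0
    set A0 := gz (cset R) (C.erase a) y
    set A := gz (fun S => cset R (insert a S)) (C.erase a) y
    set Gy := gz (cset R) C y
    have ya : y a = z a := by simp [hy, haD]
    have ya' : y' a = z' a := by simp [hy']
    rw [ya] at e2
    rw [ya'] at e1
    have d0 : 0 ≤ z' a - z a := by linarith [hDz a haI]
    have d1 := hDz1 a haI
    have hstep : Gy * Real.exp ((z' a - z a) / 4) ≤ gz (cset R) C y' := by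
      have hexp : Real.exp ((z' a - z a) / 4) ≤ 1 + (z' a - z a) / 2 := by
        set t := (z' a - z a) / 4 with ht
        have h1 : 1 - t ≤ Real.exp (-t) := by linarith [Real.add_one_le_exp (-t)]
        have h2 : Real.exp t * Real.exp (-t) = 1 := by rw [← Real.exp_add]; simp
        have h3 : Real.exp t * (1 - t) ≤ 1 := by
          calc Real.exp t * (1 - t) ≤ Real.exp t * Real.exp (-t) :=
                mul_le_mul_of_nonneg_left h1 (Real.exp_pos _).le
            _ = 1 := h2
        have h4 := Real.exp_pos t
        have h5 : (z' a - z a) / 2 = 2 * t := by rw [ht]; ring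
        rw [h5]
        nlinarith
      have h1 : gz (cset R) C y' = Gy + (z' a - z a) * A := by rw [e1, e2]; ring
      rw [h1]
      calc Gy * Real.exp ((z' a - z a) / 4) ≤ Gy * (1 + (z' a - z a) / 2) := by gcongr
        _ ≤ _ := by nlinarith
    rw [Finset.sum_insert haD, Real.exp_add]
    calc gz (cset R) C z * (Real.exp ((z' a - z a) / 4) * Real.exp (∑ x ∈ D, (z' x - z x) / 4))
        = (gz (cset R) C z * Real.exp (∑ x ∈ D, (z' x - z x) / 4)) *
            Real.exp ((z' a - z a) / 4) := by ring
      _ ≤ Gy * Real.exp ((z' a - z a) / 4) := by gcongr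
      _ ≤ _ := hstep

/-! ### Multisets to sets -/

lemma hasSum_prod_nonneg {ι κ : Type} {f : ι → ℝ} {g : κ → ℝ} {a b : ℝ} (hf : HasSum f a)
    (hg : HasSum g b) (f0 : ∀ i, 0 ≤ f i) (g0 : ∀ i, 0 ≤ g i) :
    HasSum (fun p : ι × κ => f p.1 * g p.2) (a * b) :=
  hf.mul hg (Summable.mul_of_nonneg hf.summable hg.summable f0 g0)

lemma hasSum_multiset {α : Type} (w : α → ℝ) (S : Finset α) (hw : ∀ x ∈ S, 0 ≤ w x ∧ w x < 1) :
    HasSum (fun Γ : Multiset α => if Γ.toFinset = S then (Γ.map w).prod else 0)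
      (∏ x ∈ S, w x / (1 - w x)) := by
  induction S using Finset.induction_on with
  | empty =>
    have : (fun Γ : Multiset α => if Γ.toFinset = ∅ then (Γ.map w).prod else 0) =
        fun Γ => if Γ = 0 then 1 else 0 := by
      funext Γ
      by_cases h : Γ = 0
      · simp [h]
      · simp [h]
    rw [this]
    simpa using hasSum_ite_eq (0 : Multiset α) (1 : ℝ)
  | insert a S haS ih =>
    have ih := ih fun x hx => hw x (Finset.mem_insert_of_mem hx)
    have ha := hw a (Finset.mem_insert_self _ _)
    have hgeo : HasSum (fun k : ℕ => w a ^ (k + 1)) (w a / (1 - w a)) := by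
      have := (hasSum_geometric_of_lt_one ha.1 ha.2).mul_left (w a)
      simpa [pow_succ, mul_comm, div_eq_mul_inv] using this
    rw [Finset.prod_insert haS]
    have hnn : ∀ Γ : Multiset α, 0 ≤ (if Γ.toFinset = S then (Γ.map w).prod else 0) := by
      intro Γ
      split_ifs with h
      · refine Multiset.prod_nonneg ?_
        intro t ht
        obtain ⟨x, hx, rfl⟩ := Multiset.mem_map.1 ht
        exact (hw x (Finset.mem_insert_of_mem (by rw [← h]; exact Multiset.mem_toFinset.2 hx))).1
      · exact le_rfl
    have hprod := hasSum_prod_nonneg hgeo ih (fun k => pow_nonneg ha.1 _) hnn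
    refine (hasSum_iff_hasSum_of_ne_zero_bij (f := fun Γ : Multiset α =>
      if Γ.toFinset = insert a S then (Γ.map w).prod else 0)
      (g := fun p : ℕ × Multiset α => w a ^ (p.1 + 1) *
        (if p.2.toFinset = S then (p.2.map w).prod else 0))
      (fun p => Multiset.replicate (p.1.1 + 1) a + p.1.2) ?_ ?_ ?_).2 hprod
    · rintro ⟨⟨k, Γ⟩, hk⟩ ⟨⟨k', Γ'⟩, hk'⟩ heq
      simp only [Function.mem_support, ne_eq, mul_eq_zero, not_or, ite_eq_right_iff,
        Classical.not_imp] at hk hk'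
      simp only at heq
      have hcount : ∀ Δ : Multiset α, Δ.toFinset = S → Δ.count a = 0 := by
        intro Δ h
        rw [Multiset.count_eq_zero]
        intro hmem
        exact haS (by rw [← h]; exact Multiset.mem_toFinset.2 hmem)
      have h1 := congrArg (Multiset.count a) heq
      simp only [Multiset.count_add, Multiset.count_replicate_self, hcount Γ hk.2.1,
        hcount Γ' hk'.2.1] at h1
      have h2 : k = k' := by omega
      subst h2
      have h3 := add_left_cancel heq
      simp [h3]
    · intro Γ hΓ
      simp only [Function.mem_support, ne_eq, ite_eq_right_iff, Classical.not_imp] at hΓ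
      have hmem : a ∈ Γ := Multiset.mem_toFinset.1 (by rw [hΓ.1]; exact Finset.mem_insert_self _ _)
      have hc : 0 < Γ.count a := Multiset.count_pos.2 hmem
      have hsplit : Multiset.replicate (Γ.count a - 1 + 1) a + Γ.filter (fun x => x ≠ a) = Γ := by
        rw [Nat.sub_add_cancel hc, ← Multiset.filter_eq']
        exact Multiset.filter_add_not _ _
      have hfin : (Γ.filter (fun x => x ≠ a)).toFinset = S := by
        rw [Multiset.toFinset_filter, hΓ.1]
        ext x
        simp only [Finset.mem_filter, Finset.mem_insert]
        constructor
        · rintro ⟨h1 | h1, h2⟩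
          · exact absurd h1 h2
          · exact h1
        · intro h
          exact ⟨Or.inr h, fun h' => haS (h' ▸ h)⟩
      refine ⟨⟨(Γ.count a - 1, Γ.filter (fun x => x ≠ a)), ?_⟩, hsplit⟩
      simp only [Function.mem_support]
      rw [if_pos hfin]
      have h2 := hΓ.2
      rw [← hsplit, Multiset.map_add, Multiset.prod_add, Multiset.map_replicate,
        Multiset.prod_replicate] at h2
      exact h2
    · rintro ⟨⟨k, Γ⟩, hk⟩
      simp only [Function.mem_support, ne_eq, mul_eq_zero, not_or, ite_eq_right_iff,
        Classical.not_imp] at hk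
      have : (Multiset.replicate (k + 1) a + Γ).toFinset = insert a S := by
        rw [Multiset.toFinset_add, hk.2.1, Multiset.toFinset_replicate]
        simp
      simp only [this, hk.2.1, if_true, Multiset.map_add, Multiset.prod_add,
        Multiset.map_replicate, Multiset.prod_replicate]

lemma hasSum_gz {α : Type} (P : Finset α → Prop) (C : Finset α) (w : α → ℝ)
    (hw : ∀ x ∈ C, 0 ≤ w x ∧ w x < 1) :
    HasSum (fun Γ : Multiset α => if Γ.toFinset ⊆ C ∧ P Γ.toFinset then (Γ.map w).prod else 0)
      (gz P C (fun x => w x / (1 - w x))) := by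
  have h := hasSum_sum (s := C.powerset.filter P)
    (f := fun S (Γ : Multiset α) => if Γ.toFinset = S then (Γ.map w).prod else 0)
    (fun S hS => hasSum_multiset w S
      (fun x hx => hw x (Finset.mem_powerset.1 (Finset.mem_filter.1 hS).1 hx)))
  have e : gz P C (fun x => w x / (1 - w x)) =
      ∑ S ∈ C.powerset.filter P, ∏ x ∈ S, w x / (1 - w x) := by
    unfold gz
    rw [Finset.sum_filter]
  rw [e]
  convert h using 2 with Γ
  rw [Finset.sum_ite_eq]
  simp [Finset.mem_filter]

/-! ### The contour gas -/

def CU (U : Finset Site) : Finset Contour :=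
  ((U.powerset ×ˢ (Finset.univ : Finset Bool)).image
    (fun p => (⟨p.1, p.2⟩ : Contour))).filter Contour.valid

lemma mem_CU (U : Finset Site) (γ : Contour) : γ ∈ CU U ↔ γ.valid ∧ γ.int ⊆ U := by
  unfold CU
  rw [Finset.mem_filter, Finset.mem_image]
  constructor
  · rintro ⟨⟨p, hp, rfl⟩, hv⟩
    exact ⟨hv, Finset.mem_powerset.1 (Finset.mem_product.1 hp).1⟩
  · rintro ⟨hv, hs⟩
    exact ⟨⟨(γ.int, γ.up), by simp [hs], rfl⟩, hv⟩

def FF (U : Finset Site) (w : Contour → ℝ) : ℝ :=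
  gz (cset compatPair) (CU U) (fun γ => w γ / (1 - w γ))

lemma Ztr_eq (β lam : ℝ) (h : ℤ) (U : Finset Site)
    (hw : ∀ γ ∈ CU U, 0 ≤ Wtr β lam h γ ∧ Wtr β lam h γ < 1)
    (h0 : h = 0 → ∀ γ ∈ CU U, γ.up = false → Wtr β lam h γ = 0) :
    Ztr β lam (constSign .free) h U =
      Real.exp (-lam * (h : ℝ) * (U.card : ℝ)) * FF U (Wtr β lam h) := by
  unfold Ztr FF
  rw [← (hasSum_gz (cset compatPair) (CU U) (Wtr β lam h) hw).tsum_eq]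
  congr 1
  refine tsum_congr fun Γ => ?_
  have hiff : (Γ.toFinset ⊆ CU U ∧ cset compatPair Γ.toFinset) ↔
      ((∀ γ ∈ Γ, Contour.valid γ ∧ γ.int ⊆ U) ∧ (∀ γ ∈ Γ, ∀ γ' ∈ Γ, compatPair γ γ')) := by
    constructor
    · rintro ⟨h1, h2⟩
      exact ⟨fun γ hγ => (mem_CU U γ).1 (h1 (Multiset.mem_toFinset.2 hγ)),
        fun γ hγ γ' hγ' => h2 γ (Multiset.mem_toFinset.2 hγ) γ' (Multiset.mem_toFinset.2 hγ')⟩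
    · rintro ⟨h1, h2⟩
      exact ⟨fun γ hγ => (mem_CU U γ).2 (h1 γ (Multiset.mem_toFinset.1 hγ)),
        fun γ hγ γ' hγ' => h2 γ (Multiset.mem_toFinset.1 hγ) γ' (Multiset.mem_toFinset.1 hγ')⟩
  by_cases hok : famOK (constSign .free) h U Γ
  · rw [Set.indicator_of_mem (by exact hok), if_pos (hiff.2 ⟨hok.1, hok.2.1⟩)]
    rfl
  · rw [Set.indicator_of_notMem (by exact hok)]
    by_cases hc : Γ.toFinset ⊆ CU U ∧ cset compatPair Γ.toFinset
    · rw [if_pos hc]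
      have hc' := hiff.1 hc
      have hno : ¬ (h = 0 → ∀ γ ∈ Γ, γ.up = true) := by
        intro hh
        refine hok ⟨hc'.1, hc'.2, ?_, hh⟩
        intro v _ γ _ _
        simp [constSign]
      push Not at hno
      obtain ⟨h00, γ, hγ, hup⟩ := hno
      have hz := h0 h00 γ ((mem_CU U γ).2 (hc'.1 γ hγ)) (by simpa using hup)
      symm
      rw [Multiset.prod_eq_zero_iff]
      exact Multiset.mem_map.2 ⟨γ, hγ, hz⟩
    · rw [if_neg hc]

lemma zdiff_ub {w w' : ℝ} (h0 : 0 ≤ w) (h1 : w ≤ 1 / 2) (h0' : 0 ≤ w') (h1' : w' ≤ 1 / 2) :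
    max (w' / (1 - w') - w / (1 - w)) 0 ≤ 4 * max (w' - w) 0 := by
  have e : w' / (1 - w') - w / (1 - w) = (w' - w) / ((1 - w') * (1 - w)) := by
    have : (1 - w') ≠ 0 := by linarith
    have : (1 - w) ≠ 0 := by linarith
    field_simp
    ring
  have hpos : 1 / 4 ≤ (1 - w') * (1 - w) := by nlinarith
  refine max_le ?_ (by have := le_max_right (w' - w) 0; linarith)
  rw [e, div_le_iff₀ (by linarith)]
  have a1 := le_max_left (w' - w) 0
  have a2 := le_max_right (w' - w) 0
  nlinarith

lemma zdiff_lb {w w' : ℝ} (h0 : 0 ≤ w) (h1 : w ≤ 1 / 2) (h1' : w' ≤ 1 / 2) (h : w ≤ w') :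
    w' - w ≤ w' / (1 - w') - w / (1 - w) := by
  have e : w' / (1 - w') - w / (1 - w) = (w' - w) / ((1 - w') * (1 - w)) := by
    have : (1 - w') ≠ 0 := by linarith
    have : (1 - w) ≠ 0 := by linarith
    field_simp
    ring
  rw [e, le_div_iff₀ (by nlinarith)]
  have h2 : (1 - w') * (1 - w) ≤ 1 := by nlinarith
  nlinarith

lemma cset_down {α : Type} (R : α → α → Prop) (S T : Finset α) (h : S ⊆ T) (hT : cset R T) :
    cset R S := fun x hx y hy => hT x (h hx) y (h hy)

/-- Weights made to vanish off `CU U` (harmless). -/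
lemma FF_congr (U : Finset Site) (w w' : Contour → ℝ) (h : ∀ γ ∈ CU U, w γ = w' γ) :
    FF U w = FF U w' := by
  unfold FF
  exact gz_congr _ _ _ _ fun γ hγ => by rw [h γ hγ]

lemma FF_ge_one (U : Finset Site) (w : Contour → ℝ) (hw : ∀ γ ∈ CU U, 0 ≤ w γ ∧ w γ ≤ 1 / 2) :
    1 ≤ FF U w := by
  rw [FF_congr U w (fun γ => if γ ∈ CU U then w γ else 0) (fun γ hγ => by simp [hγ])]
  unfold FF
  refine gz_ge_one _ (fun x hx => by simp at hx) _ _ fun γ => ?_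
  show 0 ≤ (if γ ∈ CU U then w γ else 0) / (1 - if γ ∈ CU U then w γ else 0)
  split_ifs with h
  · exact div_nonneg (hw γ h).1 (by linarith [(hw γ h).2])
  · simp

lemma FF_ub (U : Finset Site) (w w' : Contour → ℝ) (hw : ∀ γ ∈ CU U, 0 ≤ w γ ∧ w γ ≤ 1 / 2)
    (hw' : ∀ γ ∈ CU U, 0 ≤ w' γ ∧ w' γ ≤ 1 / 2) :
    Real.log (FF U w') ≤ Real.log (FF U w) + 4 * ∑ γ ∈ CU U, max (w' γ - w γ) 0 := by
  have p := FF_ge_one U w hw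
  have p' := FF_ge_one U w' hw'
  set u : Contour → ℝ := fun γ => if γ ∈ CU U then w γ else 0 with hu
  set u' : Contour → ℝ := fun γ => if γ ∈ CU U then w' γ else 0 with hu'
  have bu : ∀ γ, 0 ≤ u γ ∧ u γ ≤ 1 / 2 := fun γ => by
    simp only [hu]; split_ifs with h
    · exact hw γ h
    · norm_num
  have bu' : ∀ γ, 0 ≤ u' γ ∧ u' γ ≤ 1 / 2 := fun γ => by
    simp only [hu']; split_ifs with h
    · exact hw' γ h
    · norm_num
  have e : FF U w = FF U u := FF_congr U w u (fun γ hγ => by simp [hu, hγ])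
  have e' : FF U w' = FF U u' := FF_congr U w' u' (fun γ hγ => by simp [hu', hγ])
  have hs : ∑ γ ∈ CU U, max (w' γ - w γ) 0 = ∑ γ ∈ CU U, max (u' γ - u γ) 0 :=
    Finset.sum_congr rfl fun γ hγ => by simp [hu, hu', hγ]
  have key := gz_ub (cset compatPair) (fun x hx => by simp at hx) (cset_down _) (CU U)
    (fun γ => u γ / (1 - u γ)) (fun γ => u' γ / (1 - u' γ))
    (fun γ => div_nonneg (bu γ).1 (by linarith [(bu γ).2]))
    (fun γ => div_nonneg (bu' γ).1 (by linarith [(bu' γ).2]))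
  have h2 : ∑ γ ∈ CU U, max (u' γ / (1 - u' γ) - u γ / (1 - u γ)) 0 ≤
      4 * ∑ γ ∈ CU U, max (u' γ - u γ) 0 := by
    rw [Finset.mul_sum]
    exact Finset.sum_le_sum fun γ _ => zdiff_ub (bu γ).1 (bu γ).2 (bu' γ).1 (bu' γ).2
  have key2 : FF U w' ≤ FF U w * Real.exp (4 * ∑ γ ∈ CU U, max (w' γ - w γ) 0) := by
    rw [e, e', hs]
    refine key.trans ?_
    have : 0 ≤ FF U u := by rw [← e]; linarith
    exact mul_le_mul_of_nonneg_left (Real.exp_le_exp.2 h2) this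
  have := Real.log_le_log (by linarith) key2
  rwa [Real.log_mul (by linarith) (Real.exp_pos _).ne', Real.log_exp] at this

end

open scoped BigOperators
open Filter

noncomputable section

attribute [local instance] Classical.propDecidable

/-! ### Elementary lattice connectivity -/

lemma rtg_symm_in {S : Set Site} {x y : Site}
    (h : Relation.ReflTransGen (fun a b => adjS a b ∧ a ∈ S ∧ b ∈ S) x y) :
    Relation.ReflTransGen (fun a b => adjS a b ∧ a ∈ S ∧ b ∈ S) y x := by
  induction h with
  | refl => exact Relation.ReflTransGen.refl
  | tail _ hbc ih => exact Relation.ReflTransGen.head ⟨adjS_symm hbc.1, hbc.2.2, hbc.2.1⟩ ih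

lemma row_conn_aux (S : Set Site) (b : ℤ) (h : ∀ t, (t, b) ∈ S) (a : ℤ) (n : ℕ) :
    Relation.ReflTransGen (fun x y => adjS x y ∧ x ∈ S ∧ y ∈ S) (a, b) (a + n, b) := by
  induction n with
  | zero => simpa using Relation.ReflTransGen.refl
  | succ n ih =>
    refine ih.tail ⟨?_, h _, h _⟩
    unfold adjS
    rw [mem_dirs]
    left
    ext <;> simp

lemma row_conn (S : Set Site) (b : ℤ) (h : ∀ t, (t, b) ∈ S) (a a' : ℤ) :
    Relation.ReflTransGen (fun x y => adjS x y ∧ x ∈ S ∧ y ∈ S) (a, b) (a', b) := by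
  rcases le_total a a' with hle | hle
  · obtain ⟨n, rfl⟩ := Int.le.dest hle
    exact row_conn_aux S b h a n
  · obtain ⟨n, rfl⟩ := Int.le.dest hle
    exact rtg_symm_in (row_conn_aux S b h a' n)

lemma col_conn_aux (S : Set Site) (a : ℤ) (h : ∀ t, (a, t) ∈ S) (b : ℤ) (n : ℕ) :
    Relation.ReflTransGen (fun x y => adjS x y ∧ x ∈ S ∧ y ∈ S) (a, b) (a, b + n) := by
  induction n with
  | zero => simpa using Relation.ReflTransGen.refl
  | succ n ih =>
    refine ih.tail ⟨?_, h _, h _⟩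
    unfold adjS
    rw [mem_dirs]
    right; right; left
    ext <;> simp

lemma col_conn (S : Set Site) (a : ℤ) (h : ∀ t, (a, t) ∈ S) (b b' : ℤ) :
    Relation.ReflTransGen (fun x y => adjS x y ∧ x ∈ S ∧ y ∈ S) (a, b) (a, b') := by
  rcases le_total b b' with hle | hle
  · obtain ⟨n, rfl⟩ := Int.le.dest hle
    exact col_conn_aux S a h b n
  · obtain ⟨n, rfl⟩ := Int.le.dest hle
    exact rtg_symm_in (col_conn_aux S a h b' n)

lemma univ_conn : connectedIn (Set.univ : Set Site) := by
  rintro ⟨a, b⟩ - ⟨c, d⟩ -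
  exact (row_conn _ b (fun _ => Set.mem_univ _) a c).trans (col_conn _ c (fun _ => Set.mem_univ _) b d)

lemma compl_singleton_conn (v : Site) : connectedIn ((↑({v} : Finset Site) : Set Site)ᶜ) := by
  obtain ⟨p, q⟩ := v
  have key : ∀ x ∈ ((↑({(p, q)} : Finset Site) : Set Site)ᶜ),
      Relation.ReflTransGen (fun a b => adjS a b ∧ a ∈ ((↑({(p, q)} : Finset Site) : Set Site)ᶜ)
        ∧ b ∈ ((↑({(p, q)} : Finset Site) : Set Site)ᶜ)) x (p + 1, q + 1) := by
    rintro ⟨a, b⟩ hx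
    have hrow : ∀ y, y ≠ q → ∀ t, (t, y) ∈ ((↑({(p, q)} : Finset Site) : Set Site)ᶜ) := by
      intro y hy t
      simp [hy]
    have hcol : ∀ y, y ≠ p → ∀ t, (y, t) ∈ ((↑({(p, q)} : Finset Site) : Set Site)ᶜ) := by
      intro y hy t
      simp [hy]
    by_cases hb : b = q
    · have ha : a ≠ p := by
        intro ha
        simp [ha, hb] at hx
      exact (col_conn _ a (hcol a ha) b (q + 1)).trans (row_conn _ (q + 1) (hrow _ (by omega)) a (p + 1))
    · exact (row_conn _ b (hrow b hb) a (p + 1)).trans (col_conn _ (p + 1) (hcol _ (by omega)) b (q + 1))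
  intro x hx y hy
  exact (key x hx).trans (rtg_symm_in (key y hy))

lemma singleton_VInt (v : Site) : VInt {v} := by
  refine ⟨⟨v, by simp⟩, ?_, compl_singleton_conn v⟩
  intro x hx y hy
  simp at hx hy
  rw [hx, hy]

/-! ### Sums over contours -/

lemma sum_CU_eq (U : Finset Site) (p : Finset Site → Prop) (g : Finset Site → ℝ) :
    ∑ γ ∈ (CU U).filter (fun γ => p γ.int), g γ.int =
      2 * ∑ V ∈ U.powerset.filter (fun V => VInt V ∧ p V), g V := by
  have h : ∑ q ∈ (U.powerset.filter (fun V => VInt V ∧ p V)) ×ˢ (Finset.univ : Finset Bool), g q.1 =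
      ∑ γ ∈ (CU U).filter (fun γ => p γ.int), g γ.int := by
    refine Finset.sum_bij' (fun q _ => (⟨q.1, q.2⟩ : Contour)) (fun γ _ => (γ.int, γ.up))
      ?_ ?_ ?_ ?_ ?_
    · intro q hq
      simp only [Finset.mem_product, Finset.mem_filter, Finset.mem_powerset] at hq
      rw [Finset.mem_filter, mem_CU]
      exact ⟨⟨hq.1.2.1, hq.1.1⟩, hq.1.2.2⟩
    · intro γ hγ
      rw [Finset.mem_filter, mem_CU] at hγ
      simp only [Finset.mem_product, Finset.mem_filter, Finset.mem_powerset, Finset.mem_univ,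
        and_true]
      exact ⟨hγ.1.2, hγ.1.1, hγ.2⟩
    · intro q _; rfl
    · intro γ _; rfl
    · intro q _; rfl
  rw [← h, Finset.sum_product, Finset.mul_sum]
  refine Finset.sum_congr rfl fun V _ => ?_
  simp

lemma sum_CU_eq_at (U : Finset Site) (x : Site) (g : Finset Site → ℝ) :
    ∑ γ ∈ (CU U).filter (fun γ => x ∈ γ.int), g γ.int =
      2 * ∑ V ∈ U.powerset.filter (fun V => VInt V ∧ x ∈ V), g V := by
  convert sum_CU_eq U (fun V => x ∈ V) g

lemma sum_CU_total (U : Finset Site) (g : Finset Site → ℝ) (hg : ∀ V, 0 ≤ g V) (B : ℝ)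
    (hB : ∀ v ∈ U, ∑ V ∈ U.powerset.filter (fun V => VInt V ∧ v ∈ V), g V ≤ B) :
    ∑ γ ∈ CU U, g γ.int ≤ 2 * B * (U.card : ℝ) := by
  calc ∑ γ ∈ CU U, g γ.int ≤ ∑ γ ∈ CU U, ∑ v ∈ U, if v ∈ γ.int then g γ.int else 0 := by
        refine Finset.sum_le_sum fun γ hγ => ?_
        rw [mem_CU] at hγ
        obtain ⟨v, hv⟩ := hγ.1.1
        have := Finset.single_le_sum (s := U) (f := fun v => if v ∈ γ.int then g γ.int else 0)
          (fun i _ => by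
            show 0 ≤ if i ∈ γ.int then g γ.int else 0
            split_ifs
            exacts [hg _, le_rfl]) (hγ.2 hv)
        simpa [hv] using this
    _ = ∑ v ∈ U, ∑ γ ∈ (CU U).filter (fun γ => v ∈ γ.int), g γ.int := by
        rw [Finset.sum_comm]
        refine Finset.sum_congr rfl fun v _ => ?_
        rw [Finset.sum_filter]
    _ ≤ ∑ v ∈ U, 2 * B := by
        refine Finset.sum_le_sum fun v hv => ?_
        rw [sum_CU_eq_at U v g]
        linarith [hB v hv]
    _ = _ := by rw [Finset.sum_const, nsmul_eq_mul]; ring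

lemma sum_biUnion_le {ι κ : Type} (N : Finset ι) (t : ι → Finset κ) (f : κ → ℝ)
    (hf : ∀ b, 0 ≤ f b) : ∑ b ∈ N.biUnion t, f b ≤ ∑ x ∈ N, ∑ b ∈ t x, f b := by
  induction N using Finset.induction_on with
  | empty => simp
  | insert a N ha ih =>
    rw [Finset.biUnion_insert, Finset.sum_insert ha]
    have := Finset.sum_union_inter (s₁ := t a) (s₂ := N.biUnion t) (f := f)
    have h2 : 0 ≤ ∑ b ∈ t a ∩ N.biUnion t, f b := Finset.sum_nonneg fun b _ => hf b
    linarith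

lemma compat_singleton (v : Site) (b : Contour) (s : Bool)
    (h : ∀ x, x = v ∨ (∃ d ∈ dirs, x = v + d) → x ∉ b.int) :
    compatPair ⟨{v}, s⟩ b ∧ compatPair b ⟨{v}, s⟩ := by
  have hv : v ∉ b.int := h v (Or.inl rfl)
  have hdis : Disjoint ({v} : Finset Site) b.int := by simpa using hv
  have hn1 : ¬ shareEdge {v} b.int := by
    rintro ⟨x, d, hd, ⟨h1, -⟩, h3⟩
    simp at h1
    subst h1
    rcases h3 with h3 | h3
    · exact hv h3.1
    · exact h _ (Or.inr ⟨d, hd, rfl⟩) h3.1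
  have hn2 : ¬ shareEdge b.int {v} := by
    rintro ⟨x, d, hd, ⟨h1, -⟩, h3⟩
    rcases h3 with h3 | h3
    · have := h3.1
      simp at this
      subst this
      exact hv h1
    · have := h3.1
      simp at this
      refine h x (Or.inr ⟨-d, neg_mem_dirs hd, ?_⟩) h1
      rw [← this]; simp
  exact ⟨⟨Or.inr (Or.inr hdis), fun hh => absurd hh hn1⟩,
    ⟨Or.inr (Or.inr hdis.symm), fun hh => absurd hh hn2⟩⟩

lemma exp_small {x : ℝ} (h : 10 ≤ x) : Real.exp (-x) ≤ 1 / 100 := by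
  have h1 : Real.exp (-x) ≤ Real.exp (-10) := Real.exp_le_exp.2 (by linarith)
  refine h1.trans ?_
  rw [Real.exp_neg, inv_eq_one_div]
  apply one_div_le_one_div_of_le (by norm_num)
  have : Real.exp 10 = Real.exp 1 ^ 10 := by rw [← Real.exp_nat_mul]; norm_num
  rw [this]
  have h2 : (2 : ℝ) ≤ Real.exp 1 := by linarith [Real.add_one_le_exp 1]
  calc (100 : ℝ) ≤ 2 ^ 10 := by norm_num
    _ ≤ _ := by gcongr

lemma compat_self (γ : Contour) : compatPair γ γ := by
  refine ⟨Or.inl (Finset.Subset.refl _), fun hs => ⟨fun _ => rfl, fun hd => ?_⟩⟩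
  obtain ⟨x, d, hd', ⟨h1, -⟩, -⟩ := hs
  exact absurd h1 (Finset.disjoint_left.1 hd h1)

lemma FF_lb (β : ℝ) (hβ : 100 ≤ β) (U : Finset Site) (w w' : Contour → ℝ)
    (hw : ∀ γ ∈ CU U, 0 ≤ w γ ∧ w γ ≤ Real.exp (-(β - 5) * (γ.len : ℝ)))
    (hw' : ∀ γ ∈ CU U, 0 ≤ w' γ ∧ w' γ ≤ Real.exp (-(β - 5) * (γ.len : ℝ)))
    (hle : ∀ v ∈ U, w ⟨{v}, false⟩ ≤ w' ⟨{v}, false⟩)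
    (heq : ∀ γ ∈ CU U, (∀ v, γ ≠ ⟨{v}, false⟩) → w' γ = w γ) :
    Real.log (FF U w) + ∑ v ∈ U, (w' ⟨{v}, false⟩ - w ⟨{v}, false⟩) / 4 ≤
      Real.log (FF U w') := by
  have hsmall : ∀ γ ∈ CU U, Real.exp (-(β - 5) * (γ.len : ℝ)) ≤ 1 / 2 := by
    intro γ hγ
    rw [mem_CU] at hγ
    have h4 : (4 : ℝ) ≤ (γ.len : ℝ) := by exact_mod_cast len_ge_four hγ.1.1
    have : Real.exp (-((β - 5) * (γ.len : ℝ))) ≤ 1 / 100 := exp_small (by nlinarith)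
    rw [neg_mul]
    linarith
  have hw2 : ∀ γ ∈ CU U, 0 ≤ w γ ∧ w γ ≤ 1 / 2 := fun γ hγ =>
    ⟨(hw γ hγ).1, (hw γ hγ).2.trans (hsmall γ hγ)⟩
  have hw2' : ∀ γ ∈ CU U, 0 ≤ w' γ ∧ w' γ ≤ 1 / 2 := fun γ hγ =>
    ⟨(hw' γ hγ).1, (hw' γ hγ).2.trans (hsmall γ hγ)⟩
  have p := FF_ge_one U w hw2
  have p' := FF_ge_one U w' hw2'
  set u : Contour → ℝ := fun γ => if γ ∈ CU U then w γ else 0 with hu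
  set u' : Contour → ℝ := fun γ => if γ ∈ CU U then w' γ else 0 with hu'
  set zb : Contour → ℝ := fun γ => if γ ∈ CU U then 2 * Real.exp (-(β - 5) * (γ.len : ℝ)) else 0
    with hzb
  have bu : ∀ γ, 0 ≤ u γ ∧ u γ ≤ 1 / 2 := fun γ => by
    simp only [hu]; split_ifs with h
    · exact hw2 γ h
    · norm_num
  have bu' : ∀ γ, 0 ≤ u' γ ∧ u' γ ≤ 1 / 2 := fun γ => by
    simp only [hu']; split_ifs with h
    · exact hw2' γ h
    · norm_num
  have e : FF U w = FF U u := FF_congr U w u (fun γ hγ => by simp [hu, hγ])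
  have hzle : ∀ t : ℝ, 0 ≤ t → t ≤ 1 / 2 → t / (1 - t) ≤ 2 * t := by
    intro t h0 h1
    rw [div_le_iff₀ (by linarith)]
    nlinarith
  set D : Finset Contour := U.image (fun v => (⟨{v}, false⟩ : Contour)) with hD
  have hDC : D ⊆ CU U := by
    intro γ hγ
    obtain ⟨v, hv, rfl⟩ := Finset.mem_image.1 hγ
    rw [mem_CU]
    exact ⟨singleton_VInt v, by simpa using hv⟩
  have hsum : ∀ f : Contour → ℝ, ∑ γ ∈ D, f γ = ∑ v ∈ U, f ⟨{v}, false⟩ := by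
    intro f
    rw [hD, Finset.sum_image]
    intro a _ b _ hab
    simpa using hab
  have hbad : ∀ a ∈ D, ∑ b ∈ (CU U).filter
      (fun b => b = a ∨ ¬ compatPair a b ∨ ¬ compatPair b a), zb b ≤ 1 / 2 := by
    intro a ha
    obtain ⟨v, hv, rfl⟩ := Finset.mem_image.1 ha
    set N : Finset Site := insert v (dirs.image (fun d => v + d)) with hN
    have hNc : (N.card : ℝ) ≤ 5 := by
      have h1 : N.card ≤ (dirs.image (fun d => v + d)).card + 1 := Finset.card_insert_le _ _
      have h2 : (dirs.image (fun d => v + d)).card ≤ dirs.card := Finset.card_image_le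
      have h3 : dirs.card = 4 := rfl
      have : N.card ≤ 5 := by omega
      exact_mod_cast this
    have hsub : (CU U).filter (fun b => b = ⟨{v}, false⟩ ∨ ¬ compatPair ⟨{v}, false⟩ b ∨
        ¬ compatPair b ⟨{v}, false⟩) ⊆
        N.biUnion (fun x => (CU U).filter (fun b => x ∈ b.int)) := by
      intro b hb
      rw [Finset.mem_filter] at hb
      rw [Finset.mem_biUnion]
      by_contra hcon
      push Not at hcon
      have hno : ∀ x ∈ N, x ∉ b.int := fun x hx hxb =>
        hcon x hx (Finset.mem_filter.2 ⟨hb.1, hxb⟩)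
      have hc := compat_singleton v b false (fun x hx => hno x (by
        rw [hN, Finset.mem_insert, Finset.mem_image]
        rcases hx with hx | ⟨d, hd, hx⟩
        · exact Or.inl hx
        · exact Or.inr ⟨d, hd, hx.symm⟩))
      rcases hb.2 with h | h | h
      · refine hno v (by simp [hN]) ?_
        rw [h]; simp
      · exact h hc.1
      · exact h hc.2
    have hzb0 : ∀ b, 0 ≤ zb b := fun b => by
      simp only [hzb]; split_ifs <;> positivity
    have hx : ∀ x ∈ N, ∑ b ∈ (CU U).filter (fun b => x ∈ b.int), zb b ≤ 4 * (1 / 100) := by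
      intro x _
      have h1 : ∑ b ∈ (CU U).filter (fun b => x ∈ b.int), zb b =
          2 * ∑ b ∈ (CU U).filter (fun b => x ∈ b.int), Real.exp (-(β - 5) * (edgeBdryCard b.int : ℝ)) := by
        rw [Finset.mul_sum]
        refine Finset.sum_congr rfl fun b hb => ?_
        simp [hzb, (Finset.mem_filter.1 hb).1, Contour.len]
      rw [h1, sum_CU_eq_at U x (fun V => Real.exp (-(β - 5) * (edgeBdryCard V : ℝ)))]
      have h2 := peierls' x (U.powerset.filter (fun V => VInt V ∧ x ∈ V))
        (fun V hV => (Finset.mem_filter.1 hV).2) (β - 5) (by linarith) 4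
        (fun V hV => len_ge_four (Finset.mem_filter.1 hV).2.1.1)
      have h3 : Real.exp (-((β - 5 - 10) * ((4 : ℕ) : ℝ))) ≤ 1 / 100 :=
        exp_small (by push_cast; linarith)
      rw [neg_mul (β - 5 - 10)] at h2
      have h4 := h2.trans h3
      have h5 : ∀ t : ℝ, t ≤ 1 / 100 → 2 * (2 * t) ≤ 4 * (1 / 100) := fun t ht => by linarith
      exact h5 _ h4
    calc _ ≤ ∑ b ∈ N.biUnion (fun x => (CU U).filter (fun b => x ∈ b.int)), zb b :=
          Finset.sum_le_sum_of_subset_of_nonneg hsub fun b _ _ => hzb0 b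
      _ ≤ ∑ x ∈ N, ∑ b ∈ (CU U).filter (fun b => x ∈ b.int), zb b :=
          sum_biUnion_le _ _ _ hzb0
      _ ≤ ∑ x ∈ N, 4 * (1 / 100) := Finset.sum_le_sum hx
      _ ≤ 1 / 2 := by rw [Finset.sum_const, nsmul_eq_mul]; linarith
  have key := gz_lb compatPair (CU U) (fun γ => u γ / (1 - u γ)) (fun γ => u' γ / (1 - u' γ)) zb
    (fun γ => div_nonneg (bu γ).1 (by linarith [(bu γ).2]))
    (fun γ => by
      refine (hzle _ (bu γ).1 (bu γ).2).trans ?_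
      simp only [hu, hzb]
      split_ifs with h
      · linarith [(hw γ h).2]
      · simp)
    (fun γ => by
      refine (hzle _ (bu' γ).1 (bu' γ).2).trans ?_
      simp only [hu', hzb]
      split_ifs with h
      · linarith [(hw' γ h).2]
      · simp)
    D hDC
    (fun γ hγ => by
      obtain ⟨v, hv, rfl⟩ := Finset.mem_image.1 hγ
      have h1 : u ⟨{v}, false⟩ ≤ u' ⟨{v}, false⟩ := by
        simp only [hu, hu', hDC hγ, if_true]
        exact hle v hv
      have := zdiff_lb (bu ⟨{v}, false⟩).1 (bu ⟨{v}, false⟩).2 (bu' ⟨{v}, false⟩).2 h1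
      show u ⟨{v}, false⟩ / (1 - u ⟨{v}, false⟩) ≤ u' ⟨{v}, false⟩ / (1 - u' ⟨{v}, false⟩)
      linarith)
    (fun γ _ => by
      have h1 : u' γ / (1 - u' γ) ≤ 1 := by
        rw [div_le_one (by linarith [(bu' γ).2])]; linarith [(bu' γ).2]
      have h2 : 0 ≤ u γ / (1 - u γ) := div_nonneg (bu γ).1 (by linarith [(bu γ).2])
      show u' γ / (1 - u' γ) - u γ / (1 - u γ) ≤ 1
      linarith)
    (fun a _ => compat_self a) hbad
  have e' : FF U w' = gz (cset compatPair) (CU U)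
      (fun x => if x ∈ D then u' x / (1 - u' x) else u x / (1 - u x)) := by
    unfold FF
    refine gz_congr _ _ _ _ fun γ hγ => ?_
    by_cases hγD : γ ∈ D
    · simp only [hγD, if_true, hu', hγ]
    · simp only [hγD, if_false, hu, hγ, if_true]
      rw [heq γ hγ]
      rintro v rfl
      exact hγD (Finset.mem_image.2 ⟨v, ((mem_CU U _).1 hγ).2 (by simp), rfl⟩)
  have h2 : ∑ v ∈ U, (w' ⟨{v}, false⟩ - w ⟨{v}, false⟩) / 4 ≤
      ∑ x ∈ D, (u' x / (1 - u' x) - u x / (1 - u x)) / 4 := by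
    rw [← hsum (fun γ => (w' γ - w γ) / 4)]
    refine Finset.sum_le_sum fun γ hγ => ?_
    have hγC := hDC hγ
    have h1 : w γ ≤ w' γ := by
      obtain ⟨v, hv, rfl⟩ := Finset.mem_image.1 hγ
      exact hle v hv
    have := zdiff_lb (hw2 γ hγC).1 (hw2 γ hγC).2 (hw2' γ hγC).2 h1
    simp only [hu, hu', hγC, if_true]
    linarith
  have key2 : FF U w * Real.exp (∑ v ∈ U, (w' ⟨{v}, false⟩ - w ⟨{v}, false⟩) / 4) ≤ FF U w' := by
    rw [e']
    refine le_trans ?_ key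
    rw [e]
    have h0 : 0 ≤ FF U u := by rw [← e]; linarith
    exact mul_le_mul_of_nonneg_left (Real.exp_le_exp.2 h2) h0
  have := Real.log_le_log (by positivity) key2
  rwa [Real.log_mul (by linarith) (Real.exp_pos _).ne', Real.log_exp] at this

end

open scoped BigOperators
open Filter

noncomputable section

attribute [local instance] Classical.propDecidable

/-! ## Part 3: SOS partition functions -/

/-- configurations with general floor `c` -/
def SC (V : Finset Site) (s : BSign) (h c : ℤ) : Set (Site → ℤ) :=
  {ψ | (∀ x, x ∉ V → ψ x = h) ∧ (∀ v ∈ V, c ≤ ψ v) ∧ ∀ v ∈ innerBdry V, BSign.ok s h (ψ v)}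

/-- sums over an event -/
def ZS (β lam : ℝ) (V : Finset Site) (S : Set (Site → ℤ)) : ℝ :=
  ∑' ψ : Site → ℤ, Set.indicator S (sosWt β lam V) ψ

lemma Zsos_eq (β lam : ℝ) (V : Finset Site) (s : BSign) (h : ℤ) :
    Zsos β lam (constSign s) h V = ZS β lam V (SC V s h 0) := rfl

lemma sosEnergy_nonneg (V : Finset Site) (ψ : Site → ℤ) : 0 ≤ sosEnergy V ψ := by
  unfold sosEnergy
  refine Finset.sum_nonneg fun v _ => Finset.sum_nonneg fun d _ => ?_
  split_ifs <;> positivity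

lemma sosWt_pos (β lam : ℝ) (V : Finset Site) (ψ : Site → ℤ) : 0 < sosWt β lam V ψ :=
  Real.exp_pos _

lemma summable_exp_int (lam : ℝ) (hl : 0 < lam) (c : ℤ) :
    Summable (fun k : ℤ => if c ≤ k then Real.exp (-lam * k) else 0) := by
  have hinj : Function.Injective (fun n : ℕ => c + (n : ℤ)) := by
    intro a b h
    simpa using h
  rw [← hinj.summable_iff]
  · have h1 : Summable (fun n : ℕ => Real.exp (-lam * c) * Real.exp (-lam) ^ n) :=
      (summable_geometric_of_lt_one (Real.exp_pos _).le (by rw [Real.exp_lt_one_iff]; linarith)).mul_left _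
    refine h1.congr fun n => ?_
    have : c ≤ c + (n : ℤ) := by omega
    simp only [Function.comp, this, if_true]
    rw [← Real.exp_nat_mul, ← Real.exp_add]
    congr 1
    push_cast
    ring
  · intro k hk
    rw [if_neg]
    intro hck
    exact hk ⟨(k - c).toNat, by simp; omega⟩

lemma summable_SC (β lam : ℝ) (hβ : 0 ≤ β) (hl : 0 < lam) (V : Finset Site) (h c : ℤ)
    (S : Set (Site → ℤ)) (hS : ∀ ψ ∈ S, (∀ x, x ∉ V → ψ x = h) ∧ ∀ v ∈ V, c ≤ ψ v) :
    Summable (Set.indicator S (sosWt β lam V)) := by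
  set g : ℤ → ℝ := fun k => if c ≤ k then Real.exp (-lam * k) else 0 with hg
  have hgs := summable_exp_int lam hl c
  have hg0 : ∀ k, 0 ≤ g k := fun k => by
    simp only [hg]; split_ifs <;> positivity
  refine summable_of_sum_le (c := ∏ _v : {x // x ∈ V}, ∑' k, g k)
    (fun ψ => Set.indicator_nonneg (fun _ _ => (sosWt_pos _ _ _ _).le) ψ) ?_
  intro u
  have h1 : ∑ ψ ∈ u, Set.indicator S (sosWt β lam V) ψ = ∑ ψ ∈ u.filter (· ∈ S), sosWt β lam V ψ := by
    rw [Finset.sum_filter]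
    refine Finset.sum_congr rfl fun ψ _ => ?_
    simp [Set.indicator]
  rw [h1]
  set r : (Site → ℤ) → ({x // x ∈ V} → ℤ) := fun ψ x => ψ x.1 with hr
  set W := u.filter (· ∈ S) with hW
  have hmem : ∀ ψ ∈ W, ψ ∈ S := fun ψ hψ => (Finset.mem_filter.1 hψ).2
  have hinj : Set.InjOn r W := by
    intro a ha b hb hab
    funext x
    by_cases hx : x ∈ V
    · exact congrFun hab ⟨x, hx⟩
    · rw [(hS a (hmem a ha)).1 x hx, (hS b (hmem b hb)).1 x hx]
  have h2 : ∀ ψ ∈ W, sosWt β lam V ψ ≤ ∏ x : {x // x ∈ V}, g (r ψ x) := by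
    intro ψ hψ
    have e1 : ∏ x : {x // x ∈ V}, g (r ψ x) = ∏ x : {x // x ∈ V}, Real.exp (-lam * (ψ x.1 : ℝ)) := by
      refine Finset.prod_congr rfl fun x _ => ?_
      have := (hS ψ (hmem ψ hψ)).2 x.1 x.2
      simp [hg, hr, this]
    rw [e1, ← Real.exp_sum]
    unfold sosWt
    rw [Real.exp_le_exp]
    have e2 : ∑ x : {x // x ∈ V}, -lam * (ψ x.1 : ℝ) = -lam * sosField V ψ := by
      unfold sosField
      rw [← Finset.mul_sum]
      congr 1
      exact Finset.sum_coe_sort V (fun x => (ψ x : ℝ))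
    rw [e2]
    have := mul_nonneg hβ (sosEnergy_nonneg V ψ)
    linarith
  set T : {x // x ∈ V} → Finset ℤ := fun x => W.image (fun ψ => r ψ x) with hT
  calc ∑ ψ ∈ W, sosWt β lam V ψ ≤ ∑ ψ ∈ W, ∏ x : {x // x ∈ V}, g (r ψ x) := Finset.sum_le_sum h2
    _ = ∑ f ∈ W.image r, ∏ x : {x // x ∈ V}, g (f x) := by
        rw [Finset.sum_image hinj]
    _ ≤ ∑ f ∈ Fintype.piFinset T, ∏ x : {x // x ∈ V}, g (f x) := by
        refine Finset.sum_le_sum_of_subset_of_nonneg ?_ fun f _ _ =>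
          Finset.prod_nonneg fun x _ => hg0 _
        intro f hf
        obtain ⟨ψ, hψ, rfl⟩ := Finset.mem_image.1 hf
        rw [Fintype.mem_piFinset]
        intro x
        exact Finset.mem_image.2 ⟨ψ, hψ, rfl⟩
    _ = ∏ x : {x // x ∈ V}, ∑ k ∈ T x, g k := (Finset.prod_univ_sum T (fun _ k => g k)).symm
    _ ≤ _ := by
        refine Finset.prod_le_prod (fun x _ => Finset.sum_nonneg fun k _ => hg0 k) fun x _ => ?_
        exact hgs.sum_le_tsum _ (fun k _ => hg0 k)

lemma SC_floor {V : Finset Site} {s : BSign} {h c : ℤ} :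
    ∀ ψ ∈ SC V s h c, (∀ x, x ∉ V → ψ x = h) ∧ ∀ v ∈ V, c ≤ ψ v :=
  fun _ hψ => ⟨hψ.1, hψ.2.1⟩

lemma ZS_nonneg (β lam : ℝ) (V : Finset Site) (S : Set (Site → ℤ)) : 0 ≤ ZS β lam V S :=
  tsum_nonneg fun ψ => Set.indicator_nonneg (fun _ _ => (sosWt_pos _ _ _ _).le) ψ

lemma ZS_mono (β lam : ℝ) (V : Finset Site) (S T : Set (Site → ℤ)) (h : S ⊆ T)
    (hT : Summable (Set.indicator T (sosWt β lam V))) : ZS β lam V S ≤ ZS β lam V T := by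
  have hle : ∀ ψ, Set.indicator S (sosWt β lam V) ψ ≤ Set.indicator T (sosWt β lam V) ψ :=
    fun ψ => Set.indicator_le_indicator_of_subset h (fun _ => (sosWt_pos _ _ _ _).le) ψ
  refine Summable.tsum_le_tsum hle ?_ hT
  exact Summable.of_nonneg_of_le
    (fun ψ => Set.indicator_nonneg (fun _ _ => (sosWt_pos _ _ _ _).le) ψ) hle hT

/-! ### Four functions -/

lemma abs_min_max (x x' y y' : ℝ) :
    |min x y - min x' y'| + |max x y - max x' y'| ≤ |x - x'| + |y - y'| := by
  rcases le_total x y with h1 | h1 <;> rcases le_total x' y' with h2 | h2 <;>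
    simp only [h1, h2, min_eq_left, min_eq_right, max_eq_left, max_eq_right] <;>
    first
    | linarith
    | (cases abs_cases (x - y') <;> cases abs_cases (y - x') <;> cases abs_cases (x - x') <;>
        cases abs_cases (y - y') <;> linarith)
    | (cases abs_cases (y - x') <;> cases abs_cases (x - y') <;> cases abs_cases (x - x') <;>
        cases abs_cases (y - y') <;> linarith)

lemma energy_submod (V : Finset Site) (a b : Site → ℤ) :
    sosEnergy V (a ⊓ b) + sosEnergy V (a ⊔ b) ≤ sosEnergy V a + sosEnergy V b := by
  unfold sosEnergy
  rw [← Finset.sum_add_distrib, ← Finset.sum_add_distrib]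
  refine Finset.sum_le_sum fun v _ => ?_
  rw [← Finset.sum_add_distrib, ← Finset.sum_add_distrib]
  refine Finset.sum_le_sum fun d _ => ?_
  rw [← mul_add, ← mul_add]
  refine mul_le_mul_of_nonneg_left ?_ (by split_ifs <;> norm_num)
  have := abs_min_max (a v) (a (v + d)) (b v) (b (v + d))
  simp only [Pi.inf_apply, Pi.sup_apply]
  push_cast
  exact this

lemma field_mod (V : Finset Site) (a b : Site → ℤ) :
    sosField V (a ⊓ b) + sosField V (a ⊔ b) = sosField V a + sosField V b := by
  unfold sosField
  rw [← Finset.sum_add_distrib, ← Finset.sum_add_distrib]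
  refine Finset.sum_congr rfl fun v _ => ?_
  simp only [Pi.inf_apply, Pi.sup_apply]
  push_cast
  exact min_add_max _ _

lemma field_inf_le (V : Finset Site) (a b : Site → ℤ) :
    sosField V (a ⊓ b) ≤ sosField V b := by
  unfold sosField
  refine Finset.sum_le_sum fun v _ => ?_
  simp only [Pi.inf_apply]
  push_cast
  exact min_le_right _ _

lemma four_fn (β lam lam' : ℝ) (hβ : 0 ≤ β) (hll : lam ≤ lam') (V : Finset Site)
    (S1 S2 S3 S4 : Set (Site → ℤ))
    (h3 : ∀ a ∈ S1, ∀ b ∈ S2, a ⊓ b ∈ S3) (h4 : ∀ a ∈ S1, ∀ b ∈ S2, a ⊔ b ∈ S4)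
    (s1 : Summable (Set.indicator S1 (sosWt β lam V)))
    (s2 : Summable (Set.indicator S2 (sosWt β lam' V)))
    (s3 : Summable (Set.indicator S3 (sosWt β lam' V)))
    (s4 : Summable (Set.indicator S4 (sosWt β lam V))) :
    ZS β lam V S1 * ZS β lam' V S2 ≤ ZS β lam' V S3 * ZS β lam V S4 := by
  have nn : ∀ (l : ℝ) (S : Set (Site → ℤ)), ∀ ψ, 0 ≤ Set.indicator S (sosWt β l V) ψ := fun l S ψ =>
    Set.indicator_nonneg (fun _ _ => (sosWt_pos _ _ _ _).le) ψ
  have hfin : ∀ s t : Finset (Site → ℤ),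
      (∑ a ∈ s, Set.indicator S1 (sosWt β lam V) a) * (∑ a ∈ t, Set.indicator S2 (sosWt β lam' V) a) ≤
        ZS β lam' V S3 * ZS β lam V S4 := by
    intro s t
    have hff := four_functions_theorem (f₁ := Set.indicator S1 (sosWt β lam V))
      (f₂ := Set.indicator S2 (sosWt β lam' V)) (f₃ := Set.indicator S3 (sosWt β lam' V))
      (f₄ := Set.indicator S4 (sosWt β lam V)) (nn _ _) (nn _ _) (nn _ _) (nn _ _) (fun a b => by
        by_cases ha : a ∈ S1
        · by_cases hb : b ∈ S2
          · rw [Set.indicator_of_mem ha, Set.indicator_of_mem hb, Set.indicator_of_mem (h3 a ha b hb),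
              Set.indicator_of_mem (h4 a ha b hb)]
            unfold sosWt
            rw [← Real.exp_add, ← Real.exp_add, Real.exp_le_exp]
            have e1 := mul_le_mul_of_nonneg_left (energy_submod V a b) hβ
            have e2 := field_mod V a b
            have e3 := mul_le_mul_of_nonneg_left (field_inf_le V a b) (sub_nonneg.2 hll)
            have e4 : sosField V (a ⊔ b) = sosField V a + sosField V b - sosField V (a ⊓ b) := by
              linarith
            rw [e4]
            nlinarith
          · rw [Set.indicator_of_notMem hb, mul_zero]
            exact mul_nonneg (nn _ _ _) (nn _ _ _)
        · rw [Set.indicator_of_notMem ha, zero_mul]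
          exact mul_nonneg (nn _ _ _) (nn _ _ _)) s t
    refine hff.trans ?_
    exact mul_le_mul (s3.sum_le_tsum _ (fun _ _ => nn _ _ _)) (s4.sum_le_tsum _ (fun _ _ => nn _ _ _))
      (Finset.sum_nonneg fun _ _ => nn _ _ _) (ZS_nonneg _ _ _ _)
  have l1 : ∀ s : Finset (Site → ℤ), (∑ a ∈ s, Set.indicator S1 (sosWt β lam V) a) * ZS β lam' V S2 ≤
      ZS β lam' V S3 * ZS β lam V S4 := by
    intro s
    refine le_of_tendsto' (s2.hasSum.mul_left _) (fun t => ?_)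
    rw [← Finset.mul_sum]
    exact hfin s t
  refine le_of_tendsto' (s1.hasSum.mul_right _) (fun t => ?_)
  rw [← Finset.sum_mul]
  exact l1 t

/-! ### Shift -/

lemma sosWt_shift (β lam : ℝ) (V : Finset Site) (ψ : Site → ℤ) :
    sosWt β lam V (fun x => ψ x + 1) = Real.exp (-lam * (V.card : ℝ)) * sosWt β lam V ψ := by
  have e1 : sosEnergy V (fun x => ψ x + 1) = sosEnergy V ψ := by
    unfold sosEnergy
    refine Finset.sum_congr rfl fun v _ => Finset.sum_congr rfl fun d _ => ?_
    push_cast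
    rw [add_sub_add_right_eq_sub]
  have e2 : sosField V (fun x => ψ x + 1) = sosField V ψ + V.card := by
    unfold sosField
    push_cast
    rw [Finset.sum_add_distrib]
    simp
  unfold sosWt
  rw [e1, e2, ← Real.exp_add]
  congr 1
  ring

lemma ok_shift (s : BSign) (h t : ℤ) : BSign.ok s (h + 1) (t + 1) ↔ BSign.ok s h t := by
  cases s <;> simp [BSign.ok]

lemma ZS_shift (β lam : ℝ) (V : Finset Site) (s : BSign) (h c : ℤ) :
    ZS β lam V (SC V s (h + 1) (c + 1)) =
      Real.exp (-lam * (V.card : ℝ)) * ZS β lam V (SC V s h c) := by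
  unfold ZS
  rw [← tsum_mul_left, ← (Equiv.addRight (fun _ : Site => (1 : ℤ))).tsum_eq]
  refine tsum_congr fun ψ => ?_
  have hm : ((Equiv.addRight (fun _ : Site => (1 : ℤ))) ψ ∈ SC V s (h + 1) (c + 1)) ↔ ψ ∈ SC V s h c := by
    simp only [SC, Set.mem_setOf_eq, Equiv.coe_addRight, Pi.add_apply, ok_shift,
      add_left_inj, add_le_add_iff_right]
  by_cases hψ : ψ ∈ SC V s h c
  · rw [Set.indicator_of_mem hψ, Set.indicator_of_mem (hm.2 hψ)]
    exact sosWt_shift β lam V ψ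
  · rw [Set.indicator_of_notMem hψ, Set.indicator_of_notMem (fun hh => hψ (hm.1 hh)), mul_zero]

lemma ZS_pos (β lam : ℝ) (hβ : 0 ≤ β) (hl : 0 < lam) (V : Finset Site) (s : BSign) (h c : ℤ)
    (hc : c ≤ h) : 0 < ZS β lam V (SC V s h c) := by
  have hs := summable_SC β lam hβ hl V h c (SC V s h c) SC_floor
  have hm : (fun _ => h : Site → ℤ) ∈ SC V s h c := by
    refine ⟨fun _ _ => rfl, fun _ _ => hc, fun _ _ => ?_⟩
    cases s <;> simp [BSign.ok]
  refine hs.tsum_pos (fun ψ => Set.indicator_nonneg (fun _ _ => (sosWt_pos _ _ _ _).le) ψ)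
    (fun _ => h) ?_
  rw [Set.indicator_of_mem hm]
  exact sosWt_pos _ _ _ _

lemma SC_mono_floor (V : Finset Site) (s : BSign) (h c c' : ℤ) (hc : c ≤ c') :
    SC V s h c' ⊆ SC V s h c := fun _ hψ => ⟨hψ.1, fun v hv => hc.trans (hψ.2.1 v hv), hψ.2.2⟩

end

open scoped BigOperators
open Filter

noncomputable section

attribute [local instance] Classical.propDecidable

lemma ratio_anti (β lam lam' : ℝ) (hβ : 0 ≤ β) (hl : 0 < lam) (hll : lam ≤ lam')
    (V : Finset Site) (s : BSign) (h : ℤ) :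
    ZS β lam V (SC V s h 0) * ZS β lam' V (SC V s (h + 1) 0) ≤
      ZS β lam' V (SC V s h 0) * ZS β lam V (SC V s (h + 1) 0) := by
  have hl' : 0 < lam' := hl.trans_le hll
  refine four_fn β lam lam' hβ hll V _ _ _ _ ?_ ?_ (summable_SC β lam hβ hl V h 0 _ SC_floor)
    (summable_SC β lam' hβ hl' V (h + 1) 0 _ SC_floor) (summable_SC β lam' hβ hl' V h 0 _ SC_floor)
    (summable_SC β lam hβ hl V (h + 1) 0 _ SC_floor)
  · rintro a ⟨a1, a2, a3⟩ b ⟨b1, b2, b3⟩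
    refine ⟨fun x hx => ?_, fun v hv => le_inf (a2 v hv) (b2 v hv), fun v hv => ?_⟩
    · simp [a1 x hx, b1 x hx]
    · have := a3 v hv
      have := b3 v hv
      cases s <;> simp only [BSign.ok, Pi.inf_apply] at * <;> omega
  · rintro a ⟨a1, a2, a3⟩ b ⟨b1, b2, b3⟩
    refine ⟨fun x hx => ?_, fun v hv => (a2 v hv).trans le_sup_left, fun v hv => ?_⟩
    · simp [a1 x hx, b1 x hx]
    · have := a3 v hv
      have := b3 v hv
      cases s <;> simp only [BSign.ok, Pi.sup_apply] at * <;> omega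

lemma ratio_mono (β lam lam' : ℝ) (hβ : 0 ≤ β) (hl : 0 < lam) (hll : lam ≤ lam')
    (V : Finset Site) (s : BSign) (h : ℤ) :
    (Real.exp (lam * (V.card : ℝ)) * ZS β lam V (SC V s (h + 1) 0)) * ZS β lam' V (SC V s h 0) ≤
      (Real.exp (lam' * (V.card : ℝ)) * ZS β lam' V (SC V s (h + 1) 0)) *
        ZS β lam V (SC V s h 0) := by
  have hl' : 0 < lam' := hl.trans_le hll
  have e : ∀ l : ℝ, Real.exp (l * (V.card : ℝ)) * ZS β l V (SC V s (h + 1) 0) =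
      ZS β l V (SC V s h (-1)) := by
    intro l
    have := ZS_shift β l V s h (-1)
    rw [show (-1 : ℤ) + 1 = 0 by norm_num] at this
    rw [this, ← mul_assoc, ← Real.exp_add, neg_mul, add_neg_cancel, Real.exp_zero, one_mul]
  rw [e, e]
  refine four_fn β lam lam' hβ hll V _ _ _ _ ?_ ?_ (summable_SC β lam hβ hl V h (-1) _ SC_floor)
    (summable_SC β lam' hβ hl' V h 0 _ SC_floor) (summable_SC β lam' hβ hl' V h (-1) _ SC_floor)
    (summable_SC β lam hβ hl V h 0 _ SC_floor)
  · rintro a ⟨a1, a2, a3⟩ b ⟨b1, b2, b3⟩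
    refine ⟨fun x hx => ?_, fun v hv => le_inf (a2 v hv) (le_trans (by norm_num) (b2 v hv)),
      fun v hv => ?_⟩
    · simp [a1 x hx, b1 x hx]
    · have := a3 v hv
      have := b3 v hv
      cases s <;> simp only [BSign.ok, Pi.inf_apply] at * <;> omega
  · rintro a ⟨a1, a2, a3⟩ b ⟨b1, b2, b3⟩
    refine ⟨fun x hx => ?_, fun v hv => (b2 v hv).trans le_sup_right, fun v hv => ?_⟩
    · simp [a1 x hx, b1 x hx]
    · have := a3 v hv
      have := b3 v hv
      cases s <;> simp only [BSign.ok, Pi.sup_apply] at * <;> omega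

lemma ratio_lip (β l1 l2 : ℝ) (hβ : 0 ≤ β) (h1 : 0 < l1) (h2 : 0 < l2)
    (V : Finset Site) (s : BSign) (h : ℤ) :
    ZS β l1 V (SC V s (h + 1) 0) * ZS β l2 V (SC V s h 0) ≤
      Real.exp (|l1 - l2| * (V.card : ℝ)) *
        (ZS β l2 V (SC V s (h + 1) 0) * ZS β l1 V (SC V s h 0)) := by
  have n0 : 0 ≤ ZS β l2 V (SC V s (h + 1) 0) * ZS β l1 V (SC V s h 0) :=
    mul_nonneg (ZS_nonneg _ _ _ _) (ZS_nonneg _ _ _ _)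
  rcases le_total l1 l2 with hle | hle
  · have := ratio_mono β l1 l2 hβ h1 hle V s h
    have e : Real.exp (l2 * (V.card : ℝ)) =
        Real.exp (l1 * (V.card : ℝ)) * Real.exp (|l1 - l2| * (V.card : ℝ)) := by
      rw [← Real.exp_add, abs_of_nonpos (by linarith)]
      congr 1; ring
    rw [e] at this
    have hp := Real.exp_pos (l1 * (V.card : ℝ))
    refine le_of_mul_le_mul_left ?_ hp
    linarith
  · have := ratio_anti β l2 l1 hβ h2 hle V s h
    have h1e : 1 ≤ Real.exp (|l1 - l2| * (V.card : ℝ)) := Real.one_le_exp (by positivity)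
    nlinarith

lemma ZS_minus_neg (β lam : ℝ) (V : Finset Site) (hV : V.Nonempty) :
    ZS β lam V (SC V .minus (-1) 0) = 0 := by
  have hb : ∃ v ∈ V, v ∈ innerBdry V := by
    obtain ⟨v, hv⟩ := hV
    obtain ⟨i, -, hall, hout⟩ := ray_exit V v hv
    refine ⟨v + ((i : ℤ), 0), hall i le_rfl, ?_⟩
    refine Finset.mem_filter.2 ⟨hall i le_rfl, (1, 0), by simp [dirs], ?_⟩
    have e : v + ((i : ℤ), (0:ℤ)) + (1, 0) = v + (((i + 1 : ℕ) : ℤ), 0) := by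
      ext <;> simp [add_assoc]
    rw [e]; exact hout
  obtain ⟨v, hv, hvb⟩ := hb
  have : SC V .minus (-1) 0 = ∅ := by
    ext ψ
    simp only [Set.mem_empty_iff_false, iff_false]
    rintro ⟨-, h2, h3⟩
    have a := h2 v hv
    have b := h3 v hvb
    simp only [BSign.ok] at b
    omega
  unfold ZS
  rw [this]
  simp

lemma Wrn_nonneg (β lam : ℝ) (h : ℤ) (γ : Contour) : 0 ≤ Wrn β lam h γ := by
  unfold Wrn
  simp only [Zsos_eq]
  split_ifs <;>
  exact mul_nonneg (Real.exp_pos _).le (div_nonneg (ZS_nonneg _ _ _ _) (ZS_nonneg _ _ _ _))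

lemma Wtr_bounds (β lam : ℝ) (h : ℤ) (γ : Contour) :
    0 ≤ Wtr β lam h γ ∧ Wtr β lam h γ ≤ Real.exp (-(β - 5) * (γ.len : ℝ)) :=
  ⟨le_min (Wrn_nonneg _ _ _ _) (Real.exp_pos _).le, min_le_right _ _⟩

lemma Wrn_down_zero (β lam : ℝ) (γ : Contour) (hv : γ.valid) (hd : γ.up = false) :
    Wrn β lam 0 γ = 0 := by
  unfold Wrn
  simp only [Zsos_eq, hd]
  rw [show (0 : ℤ) - 1 = -1 by norm_num, ZS_minus_neg _ _ _ hv.1]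
  simp

lemma Wtr_down_zero (β lam : ℝ) (γ : Contour) (hv : γ.valid) (hd : γ.up = false) :
    Wtr β lam 0 γ = 0 := by
  unfold Wtr
  rw [Wrn_down_zero β lam γ hv hd]
  exact min_eq_left (Real.exp_pos _).le

lemma Wrn_lip (β l1 l2 : ℝ) (hβ : 0 ≤ β) (h1 : 0 < l1) (h2 : 0 < l2) (h : ℕ) (γ : Contour)
    (hv : γ.valid) :
    Wrn β l1 h γ ≤ Real.exp (|l1 - l2| * (γ.int.card : ℝ)) * Wrn β l2 h γ := by
  by_cases hup : γ.up = true
  · unfold Wrn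
    simp only [hup, if_true, Zsos_eq]
    have p1 := ZS_pos β l1 hβ h1 γ.int .plus h 0 (by omega)
    have p2 := ZS_pos β l2 hβ h2 γ.int .plus h 0 (by omega)
    have := ratio_lip β l1 l2 hβ h1 h2 γ.int .plus h
    rw [mul_left_comm]
    refine mul_le_mul_of_nonneg_left ?_ (Real.exp_pos _).le
    rw [← mul_div_assoc, div_le_div_iff₀ p1 p2]
    linarith
  · have hd : γ.up = false := by simpa using hup
    rcases Nat.eq_zero_or_pos h with rfl | hpos
    · rw [Nat.cast_zero, Wrn_down_zero _ _ _ hv hd, Wrn_down_zero _ _ _ hv hd, mul_zero]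
    · unfold Wrn
      simp only [hd, Zsos_eq]
      have p1 := ZS_pos β l1 hβ h1 γ.int .minus h 0 (by omega)
      have p2 := ZS_pos β l2 hβ h2 γ.int .minus h 0 (by omega)
      have := ratio_lip β l2 l1 hβ h2 h1 γ.int .minus ((h : ℤ) - 1)
      rw [sub_add_cancel, abs_sub_comm] at this
      simp only [Bool.false_eq_true, if_false]
      rw [mul_left_comm]
      refine mul_le_mul_of_nonneg_left ?_ (Real.exp_pos _).le
      rw [← mul_div_assoc, div_le_div_iff₀ p1 p2]
      linarith

lemma min_mul_le {E x y c : ℝ} (hE : 1 ≤ E) (hc : 0 ≤ c) (h : x ≤ E * y) :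
    min x c ≤ E * min y c := by
  rcases le_total y c with hy | hy
  · rw [min_eq_left hy]; exact (min_le_left _ _).trans h
  · rw [min_eq_right hy]
    refine (min_le_right _ _).trans ?_
    nlinarith

lemma Wtr_lip_aux (β l1 l2 : ℝ) (hβ : 0 ≤ β) (h1 : 0 < l1) (h2 : 0 < l2) (h : ℕ) (γ : Contour)
    (hv : γ.valid) :
    Wtr β l1 h γ - Wtr β l2 h γ ≤
      |l1 - l2| * (γ.int.card : ℝ) * Real.exp (-(β - 5) * (γ.len : ℝ)) := by
  set t := |l1 - l2| * (γ.int.card : ℝ) with ht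
  have t0 : 0 ≤ t := by positivity
  have k : Wtr β l1 h γ ≤ Real.exp t * Wtr β l2 h γ :=
    min_mul_le (Real.one_le_exp t0) (Real.exp_pos _).le (Wrn_lip β l1 l2 hβ h1 h2 h γ hv)
  have b1 := Wtr_bounds β l1 h γ
  have e1 : Real.exp (-t) * Real.exp t = 1 := by rw [← Real.exp_add]; simp
  have e2 : 1 - t ≤ Real.exp (-t) := by linarith [Real.add_one_le_exp (-t)]
  have k2 : Real.exp (-t) * Wtr β l1 h γ ≤ Wtr β l2 h γ := by
    have := mul_le_mul_of_nonneg_left k (Real.exp_pos (-t)).le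
    rwa [← mul_assoc, e1, one_mul] at this
  have k3 := mul_le_mul_of_nonneg_right e2 b1.1
  have k4 := mul_le_mul_of_nonneg_left b1.2 t0
  nlinarith

lemma Wtr_lip (β l1 l2 : ℝ) (hβ : 0 ≤ β) (h1 : 0 < l1) (h2 : 0 < l2) (h : ℕ) (γ : Contour)
    (hv : γ.valid) :
    max (Wtr β l1 h γ - Wtr β l2 h γ) 0 ≤
      |l1 - l2| * ((γ.int.card : ℝ) * Real.exp (-(β - 5) * (γ.len : ℝ))) := by
  refine max_le ?_ (by positivity)
  rw [← mul_assoc]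
  exact Wtr_lip_aux β l1 l2 hβ h1 h2 h γ hv

/-- Probability that the minimum is at least one. -/
def pmin (β lam : ℝ) (V : Finset Site) (s : BSign) (H : ℤ) : ℝ :=
  ZS β lam V (SC V s H 1) / ZS β lam V (SC V s H 0)

lemma pmin_nonneg (β lam : ℝ) (V : Finset Site) (s : BSign) (H : ℤ) : 0 ≤ pmin β lam V s H :=
  div_nonneg (ZS_nonneg _ _ _ _) (ZS_nonneg _ _ _ _)

lemma pmin_le_one (β lam : ℝ) (hβ : 0 ≤ β) (hl : 0 < lam) (V : Finset Site) (s : BSign) (H : ℤ) :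
    pmin β lam V s H ≤ 1 := by
  refine div_le_one_of_le₀ ?_ (ZS_nonneg _ _ _ _)
  exact ZS_mono _ _ _ _ _ (SC_mono_floor V s H 0 1 (by norm_num))
    (summable_SC β lam hβ hl V H 0 _ SC_floor)

lemma pmin_eq (β lam : ℝ) (V : Finset Site) (s : BSign) (H : ℤ) :
    pmin β lam V s (H + 1) = Real.exp (-lam * (V.card : ℝ)) * ZS β lam V (SC V s H 0) /
      ZS β lam V (SC V s (H + 1) 0) := by
  unfold pmin
  have := ZS_shift β lam V s H 0
  rw [zero_add] at this
  rw [this]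

lemma Wrn_up_eq (β lam : ℝ) (hβ : 0 ≤ β) (hl : 0 < lam) (h : ℕ) (γ : Contour)
    (hu : γ.up = true) :
    Wrn β lam h γ * pmin β lam γ.int .plus (h + 1) =
      Real.exp (-β * (γ.len : ℝ)) * Real.exp (-lam * (γ.int.card : ℝ)) := by
  rw [pmin_eq]
  unfold Wrn
  simp only [hu, if_true, Zsos_eq]
  have p1 := ZS_pos β lam hβ hl γ.int .plus h 0 (by omega)
  have p2 := ZS_pos β lam hβ hl γ.int .plus (h + 1) 0 (by omega)
  field_simp

lemma Wrn_dn_eq (β lam : ℝ) (h : ℤ) (γ : Contour)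
    (hd : γ.up = false) :
    Wrn β lam h γ = Real.exp (-β * (γ.len : ℝ)) * Real.exp (lam * (γ.int.card : ℝ)) *
      pmin β lam γ.int .minus h := by
  have := pmin_eq β lam γ.int .minus (h - 1)
  rw [sub_add_cancel] at this
  rw [this]
  unfold Wrn
  simp only [hd, Zsos_eq, Bool.false_eq_true, if_false]
  have e : Real.exp (lam * (γ.int.card : ℝ)) * Real.exp (-lam * (γ.int.card : ℝ)) = 1 := by
    rw [← Real.exp_add]; simp
  rw [mul_assoc]
  congr 1
  rw [← mul_div_assoc, ← mul_assoc, e, one_mul]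

lemma min_p {p x y c : ℝ} (p1 : p ≤ 1) (hc : 0 ≤ c) (x0 : 0 ≤ x) (h : p * x ≤ y)
    (hy : 0 ≤ y) : p * min x c ≤ min y c := by
  rcases le_total 0 p with hp | hp
  · refine le_min ((mul_le_mul_of_nonneg_left (min_le_left _ _) hp).trans h) ?_
    have := min_le_right x c
    nlinarith [le_min x0 hc]
  · have h1 : p * min x c ≤ 0 := mul_nonpos_of_nonpos_of_nonneg hp (le_min x0 hc)
    exact h1.trans (le_min hy hc)

/-- comparison of consecutive heights -/
lemma Wtr_compare_up (β lam : ℝ) (hβ : 0 ≤ β) (hl : 0 < lam) (h : ℕ) (γ : Contour)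
    (hu : γ.up = true) :
    pmin β lam γ.int .plus (h + 2) * Wtr β lam (h + 1 : ℕ) γ ≤ Wtr β lam h γ ∧
    pmin β lam γ.int .plus (h + 1) * Wtr β lam h γ ≤ Wtr β lam (h + 1 : ℕ) γ := by
  have e1 := Wrn_up_eq β lam hβ hl h γ hu
  have e2 := Wrn_up_eq β lam hβ hl (h + 1) γ hu
  rw [show (((h + 1 : ℕ) : ℤ) + 1) = (h : ℤ) + 2 by push_cast; ring] at e2
  have a1 := pmin_le_one β lam hβ hl γ.int .plus (h + 1)
  have a2 := pmin_le_one β lam hβ hl γ.int .plus (h + 2)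
  have w1 := Wrn_nonneg β lam h γ
  have w2 := Wrn_nonneg β lam (h + 1 : ℕ) γ
  constructor
  · refine min_p a2 (Real.exp_pos _).le w2 ?_ w1
    rw [mul_comm, e2, ← e1]
    nlinarith
  · refine min_p a1 (Real.exp_pos _).le w1 ?_ w2
    rw [mul_comm, e1, ← e2]
    nlinarith

lemma Wtr_compare_dn (β lam : ℝ) (hβ : 0 ≤ β) (hl : 0 < lam) (h : ℕ) (γ : Contour)
    (hd : γ.up = false) :
    pmin β lam γ.int .minus h * Wtr β lam (h + 1 : ℕ) γ ≤ Wtr β lam h γ ∧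
    pmin β lam γ.int .minus (h + 1) * Wtr β lam h γ ≤ Wtr β lam (h + 1 : ℕ) γ := by
  have e1 := Wrn_dn_eq β lam h γ hd
  have e2 := Wrn_dn_eq β lam (h + 1 : ℕ) γ hd
  rw [show (((h + 1 : ℕ) : ℤ)) = (h : ℤ) + 1 by push_cast; ring] at e2 ⊢
  have a1 := pmin_le_one β lam hβ hl γ.int .minus h
  have a2 := pmin_le_one β lam hβ hl γ.int .minus (h + 1)
  have b1 := pmin_nonneg β lam γ.int .minus h
  have b2 := pmin_nonneg β lam γ.int .minus (h + 1)
  have w1 := Wrn_nonneg β lam h γ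
  have w2 := Wrn_nonneg β lam (h + 1) γ
  set K := Real.exp (-β * (γ.len : ℝ)) * Real.exp (lam * (γ.int.card : ℝ)) with hK
  have hK0 : 0 ≤ K := by positivity
  constructor
  · refine min_p a1 (Real.exp_pos _).le w2 ?_ w1
    rw [e1, e2]
    nlinarith [mul_nonneg hK0 b1]
  · refine min_p a2 (Real.exp_pos _).le w1 ?_ w2
    rw [e1, e2]
    nlinarith [mul_nonneg hK0 b2]

end

open scoped BigOperators
open Filter

noncomputable section

attribute [local instance] Classical.propDecidable

/-! ## Part 4: spike estimate -/

/-- raising a configuration by one on `I` -/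
def raise (I : Finset Site) (ψ : Site → ℤ) : Site → ℤ := fun x => ψ x + if x ∈ I then 1 else 0

lemma raise_inj (I : Finset Site) : Function.Injective (raise I) := by
  intro a b hab
  funext x
  have := congrFun hab x
  simpa [raise] using this

lemma raise_term (I : Finset Site) (ψ : Site → ℤ) (v w : Site)
    (h1 : v ∈ I → w ∉ I → ψ v + 1 ≤ ψ w) (h2 : w ∈ I → v ∉ I → ψ w + 1 ≤ ψ v) :
    |(ψ v : ℝ) - ψ w| = |(raise I ψ v : ℝ) - raise I ψ w|
      + ((if v ∈ I ∧ w ∉ I then 1 else 0) + (if w ∈ I ∧ v ∉ I then 1 else 0)) := by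
  unfold raise
  by_cases hv : v ∈ I <;> by_cases hw : w ∈ I
  · simp [hv, hw]
  · have := h1 hv hw
    have h' : (ψ v : ℝ) + 1 ≤ ψ w := by exact_mod_cast this
    simp only [hv, hw, if_true, if_false]
    push_cast
    rw [abs_of_nonpos (by linarith), abs_of_nonpos (by linarith)]
    simp; ring
  · have := h2 hw hv
    have h' : (ψ w : ℝ) + 1 ≤ ψ v := by exact_mod_cast this
    simp only [hv, hw, if_true, if_false]
    push_cast
    rw [abs_of_nonneg (by linarith), abs_of_nonneg (by linarith)]
    simp; ring
  · simp [hv, hw]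

lemma energy_raise (V I : Finset Site) (hI : I ⊆ V) (ψ : Site → ℤ)
    (hg : ∀ x ∈ I, ∀ d ∈ dirs, x + d ∉ I → ψ x + 1 ≤ ψ (x + d)) :
    sosEnergy V ψ = sosEnergy V (raise I ψ) + edgeBdryCard I := by
  have e1 : sosEnergy V ψ = sosEnergy V (raise I ψ) +
      ∑ v ∈ V, ∑ d ∈ dirs, (if v + d ∈ V then (1 : ℝ) / 2 else 1) *
        ((if v ∈ I ∧ v + d ∉ I then 1 else 0) + (if v + d ∈ I ∧ v ∉ I then 1 else 0)) := by
    unfold sosEnergy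
    rw [← Finset.sum_add_distrib]
    refine Finset.sum_congr rfl fun v _ => ?_
    rw [← Finset.sum_add_distrib]
    refine Finset.sum_congr rfl fun d hd => ?_
    rw [raise_term I ψ v (v + d) (fun a b => hg v a d hd b) (fun a b => ?_), mul_add]
    have := hg (v + d) a (-d) (neg_mem_dirs hd) (by simpa using b)
    simpa using this
  rw [e1]
  congr 1
  have e2 : ∑ v ∈ V, ∑ d ∈ dirs, (if v + d ∈ V then (1 : ℝ) / 2 else 1) *
        ((if v ∈ I ∧ v + d ∉ I then 1 else 0) + (if v + d ∈ I ∧ v ∉ I then 1 else 0))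
      = ∑ p ∈ bd I, (if p.1 + p.2 ∈ V then (1 : ℝ) / 2 else 1) +
        ∑ p ∈ (V ×ˢ dirs).filter (fun p => p.1 + p.2 ∈ I ∧ p.1 ∉ I), (1 : ℝ) / 2 := by
    have : bd I = (V ×ˢ dirs).filter (fun p => p.1 ∈ I ∧ p.1 + p.2 ∉ I) := by
      ext p
      rw [mem_bd, Finset.mem_filter, Finset.mem_product]
      constructor
      · rintro ⟨a, b, c⟩; exact ⟨⟨hI a, b⟩, a, c⟩
      · rintro ⟨⟨a, b⟩, c, d⟩; exact ⟨c, b, d⟩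
    rw [this, ← Finset.sum_product' (f := fun v d => (if v + d ∈ V then (1 : ℝ) / 2 else 1) *
        ((if v ∈ I ∧ v + d ∉ I then 1 else 0) + (if v + d ∈ I ∧ v ∉ I then 1 else 0))),
      Finset.sum_filter, Finset.sum_filter, ← Finset.sum_add_distrib]
    refine Finset.sum_congr rfl fun p _ => ?_
    rw [mul_add]
    congr 1
    · split_ifs <;> simp
    · by_cases h : p.1 + p.2 ∈ I ∧ p.1 ∉ I
      · rw [if_pos h, if_pos h, if_pos (hI h.1), mul_one]
      · rw [if_neg h, if_neg h, mul_zero]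
  have e3 : ∑ p ∈ (V ×ˢ dirs).filter (fun p => p.1 + p.2 ∈ I ∧ p.1 ∉ I), (1 : ℝ) / 2 =
      ∑ p ∈ (bd I).filter (fun p => p.1 + p.2 ∈ V), (1 : ℝ) / 2 := by
    refine Finset.sum_nbij' (fun p => (p.1 + p.2, -p.2)) (fun p => (p.1 + p.2, -p.2)) ?_ ?_ ?_ ?_ ?_
    · intro p hp
      simp only [Finset.mem_filter, Finset.mem_product, mem_bd] at hp ⊢
      refine ⟨⟨hp.2.1, neg_mem_dirs hp.1.2, ?_⟩, ?_⟩
      · simpa using hp.2.2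
      · simpa using hp.1.1
    · intro p hp
      simp only [Finset.mem_filter, Finset.mem_product, mem_bd] at hp ⊢
      refine ⟨⟨hp.2, neg_mem_dirs hp.1.2.1⟩, ?_, hp.1.2.2⟩
      simpa using hp.1.1
    · intro p _; ext <;> simp
    · intro p _; ext <;> simp
    · intro p _; rfl
  rw [e2, e3, Finset.sum_filter, ← Finset.sum_add_distrib, ← card_bd]
  rw [Finset.sum_congr rfl (g := fun _ => (1 : ℝ))]
  · simp
  · intro p _
    split_ifs <;> norm_num

lemma field_raise (V I : Finset Site) (hI : I ⊆ V) (ψ : Site → ℤ) :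
    sosField V (raise I ψ) = sosField V ψ + I.card := by
  unfold sosField raise
  push_cast
  rw [Finset.sum_add_distrib]
  congr 1
  rw [Finset.sum_ite_mem, Finset.inter_eq_right.2 hI]
  simp

lemma wt_raise (β lam : ℝ) (V I : Finset Site) (hI : I ⊆ V) (ψ : Site → ℤ)
    (hg : ∀ x ∈ I, ∀ d ∈ dirs, x + d ∉ I → ψ x + 1 ≤ ψ (x + d)) :
    sosWt β lam V ψ = Real.exp (-β * edgeBdryCard I + lam * I.card) *
      sosWt β lam V (raise I ψ) := by
  unfold sosWt
  rw [← Real.exp_add, energy_raise V I hI ψ hg, field_raise V I hI]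
  congr 1; ring

lemma ZS_raise (β lam : ℝ) (V I : Finset Site) (hI : I ⊆ V) (A B : Set (Site → ℤ))
    (hAB : ∀ ψ ∈ A, raise I ψ ∈ B ∧ ∀ x ∈ I, ∀ d ∈ dirs, x + d ∉ I → ψ x + 1 ≤ ψ (x + d))
    (hB : Summable (Set.indicator B (sosWt β lam V))) :
    ZS β lam V A ≤ Real.exp (-β * edgeBdryCard I + lam * I.card) * ZS β lam V B := by
  unfold ZS
  rw [← tsum_mul_left]
  set c := Real.exp (-β * edgeBdryCard I + lam * I.card) with hc
  have hB' : Summable (fun ψ => c * Set.indicator B (sosWt β lam V) ψ) := hB.mul_left c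
  have hcomp := hB'.comp_injective (raise_inj I)
  have hle : ∀ ψ, Set.indicator A (sosWt β lam V) ψ ≤
      c * Set.indicator B (sosWt β lam V) (raise I ψ) := by
    intro ψ
    by_cases h : ψ ∈ A
    · rw [Set.indicator_of_mem h, Set.indicator_of_mem (hAB ψ h).1, hc,
        ← wt_raise β lam V I hI ψ (hAB ψ h).2]
    · rw [Set.indicator_of_notMem h]
      exact mul_nonneg (Real.exp_pos _).le
        (Set.indicator_nonneg (fun _ _ => (sosWt_pos _ _ _ _).le) _)
  have hA : Summable (Set.indicator A (sosWt β lam V)) :=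
    Summable.of_nonneg_of_le
      (fun ψ => Set.indicator_nonneg (fun _ _ => (sosWt_pos _ _ _ _).le) ψ) hle hcomp
  calc _ ≤ ∑' ψ, c * Set.indicator B (sosWt β lam V) (raise I ψ) :=
        Summable.tsum_le_tsum hle hA hcomp
    _ ≤ _ := tsum_comp_le_tsum_of_inj hB'
        (fun ψ => mul_nonneg (Real.exp_pos _).le
          (Set.indicator_nonneg (fun _ _ => (sosWt_pos _ _ _ _).le) _)) (raise_inj I)

lemma ZS_union {ι : Type*} (β lam : ℝ) (V : Finset Site) (G : Finset ι) (A : Set (Site → ℤ))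
    (B : ι → Set (Site → ℤ)) (hsub : ∀ ψ ∈ A, ∃ i ∈ G, ψ ∈ B i)
    (hB : ∀ i ∈ G, Summable (Set.indicator (B i) (sosWt β lam V))) :
    ZS β lam V A ≤ ∑ i ∈ G, ZS β lam V (B i) := by
  unfold ZS
  rw [← Summable.tsum_finsetSum hB]
  have hs : Summable (fun ψ => ∑ i ∈ G, Set.indicator (B i) (sosWt β lam V) ψ) :=
    summable_sum hB
  have nn : ∀ (S : Set (Site → ℤ)) ψ, 0 ≤ Set.indicator S (sosWt β lam V) ψ := fun S ψ =>
    Set.indicator_nonneg (fun _ _ => (sosWt_pos _ _ _ _).le) ψ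
  have hle : ∀ ψ, Set.indicator A (sosWt β lam V) ψ ≤
      ∑ i ∈ G, Set.indicator (B i) (sosWt β lam V) ψ := by
    intro ψ
    by_cases h : ψ ∈ A
    · obtain ⟨i, hi, hψ⟩ := hsub ψ h
      rw [Set.indicator_of_mem h, ← Set.indicator_of_mem hψ (sosWt β lam V)]
      exact Finset.single_le_sum (f := fun i => Set.indicator (B i) (sosWt β lam V) ψ)
        (fun j _ => nn _ _) hi
    · rw [Set.indicator_of_notMem h]
      exact Finset.sum_nonneg fun j _ => nn _ _
  exact Summable.tsum_le_tsum hle (Summable.of_nonneg_of_le (nn A) hle hs) hs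

lemma exists_I (V : Finset Site) (hV : VInt V) (ψ : Site → ℤ) (k : ℤ)
    (hoff : ∀ x, x ∉ V → k ≤ ψ x) (v : Site) (hv : ψ v ≤ k - 1) :
    ∃ I ⊆ V, VInt I ∧ v ∈ I ∧ (∀ u, adjS v u → ψ u ≤ k - 1 → u ∈ I) ∧
      ∀ x ∈ I, ∀ d ∈ dirs, x + d ∉ I → ψ x ≤ k - 1 ∧ k ≤ ψ (x + d) := by
  set A : Set Site := {x | ψ x ≤ k - 1} with hA
  set C : Set Site := {y | Relation.ReflTransGen (fun a b => adjS a b ∧ a ∈ A ∧ b ∈ A) v y} with hC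
  set D : Set Site := {y | ∃ z, z ∉ V ∧
    Relation.ReflTransGen (fun a b => adjS a b ∧ a ∉ C ∧ b ∉ C) z y} with hD
  have hAV : ∀ x ∈ A, x ∈ V := by
    intro x hx
    by_contra h
    have := hoff x h
    simp only [hA, Set.mem_setOf_eq] at hx
    omega
  have hvC : v ∈ C := Relation.ReflTransGen.refl
  have hCA : ∀ x ∈ C, x ∈ A := by
    intro x hx
    rcases Relation.ReflTransGen.cases_tail hx with h | ⟨y, _, h⟩
    · rw [h]; exact hv
    · exact h.2.2
  have hDC : ∀ x ∈ D, x ∉ C := by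
    rintro x ⟨z, hz, hx⟩
    rcases Relation.ReflTransGen.cases_tail hx with h | ⟨y, _, h⟩
    · rw [h]; exact fun hh => hz (hAV _ (hCA _ hh))
    · exact h.2.2
  have hVD : ∀ x, x ∉ V → x ∈ D := fun x hx => ⟨x, hx, Relation.ReflTransGen.refl⟩
  set I : Finset Site := V.filter (fun x => x ∉ D) with hI
  have memI : ∀ x, x ∈ I ↔ x ∉ D := by
    intro x
    rw [hI, Finset.mem_filter]
    exact ⟨fun h => h.2, fun h => ⟨by_contra fun hh => h (hVD x hh), h⟩⟩
  have hCI : ∀ x ∈ C, x ∈ I := fun x hx => (memI x).2 fun h => hDC x h hx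
  have adjd : ∀ x d : Site, d ∈ dirs → adjS x (x + d) := by
    intro x d hd; unfold adjS; simpa using hd
  have hbC : ∀ x ∈ I, ∀ y, adjS x y → y ∉ I → x ∈ C ∧ k ≤ ψ y := by
    intro x hx y hxy hy
    have hyD : y ∈ D := by by_contra h; exact hy ((memI y).2 h)
    have hxC : x ∈ C := by
      by_contra h
      obtain ⟨z, hz, hzy⟩ := hyD
      exact (memI x).1 hx ⟨z, hz, hzy.tail ⟨adjS_symm hxy, hDC y ⟨z, hz, hzy⟩, h⟩⟩
    refine ⟨hxC, ?_⟩
    by_contra h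
    have hyA : y ∈ A := by simp only [hA, Set.mem_setOf_eq]; omega
    exact hDC y hyD (Relation.ReflTransGen.tail hxC ⟨hxy, hCA x hxC, hyA⟩)
  have hCv : ∀ x ∈ C, Relation.ReflTransGen (fun a b => adjS a b ∧ a ∈ (↑I : Set Site) ∧ b ∈ (↑I : Set Site)) v x := by
    intro x hx
    induction hx with
    | refl => exact Relation.ReflTransGen.refl
    | tail h1 h2 ih =>
      exact ih.tail ⟨h2.1, hCI _ h1, hCI _ (Relation.ReflTransGen.tail h1 h2)⟩
  have hIv : ∀ x ∈ I, Relation.ReflTransGen (fun a b => adjS a b ∧ a ∈ (↑I : Set Site) ∧ b ∈ (↑I : Set Site)) x v := by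
    intro x
    have hp := univ_conn x (Set.mem_univ _) v (Set.mem_univ _)
    induction hp using Relation.ReflTransGen.head_induction_on with
    | refl => intro _; exact Relation.ReflTransGen.refl
    | head h1 h2 ih =>
      rename_i a c
      intro ha
      by_cases hc : c ∈ I
      · exact Relation.ReflTransGen.head ⟨h1.1, ha, hc⟩ (ih hc)
      · exact rtg_symm_in (hCv a (hbC a ha c h1.1 hc).1)
  have hDz : ∀ y z, z ∉ V → Relation.ReflTransGen (fun a b => adjS a b ∧ a ∉ C ∧ b ∉ C) z y →
      Relation.ReflTransGen (fun a b => adjS a b ∧ a ∈ (↑I : Set Site)ᶜ ∧ b ∈ (↑I : Set Site)ᶜ) z y := by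
    intro y z hz h
    induction h with
    | refl => exact Relation.ReflTransGen.refl
    | tail h1 h2 ih =>
      rename_i b c
      refine ih.tail ⟨h2.1, ?_, ?_⟩
      · intro hb; exact (memI b).1 hb ⟨z, hz, h1⟩
      · intro hb; exact (memI c).1 hb ⟨z, hz, h1.tail h2⟩
  refine ⟨I, Finset.filter_subset _ _, ⟨⟨v, hCI v hvC⟩, ?_, ?_⟩, hCI v hvC, ?_, ?_⟩
  · intro x hx y hy
    exact (hIv x hx).trans (rtg_symm_in (hIv y hy))
  · intro x hx y hy
    have hx' : x ∈ D := by by_contra h; exact hx ((memI x).2 h)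
    have hy' : y ∈ D := by by_contra h; exact hy ((memI y).2 h)
    obtain ⟨z, hz, h1⟩ := hx'
    obtain ⟨w, hw, h2⟩ := hy'
    refine (rtg_symm_in (hDz _ _ hz h1)).trans (Relation.ReflTransGen.trans ?_ (hDz _ _ hw h2))
    have := hV.2.2 z hz w hw
    refine Relation.ReflTransGen.mono (fun a b hab => ?_) _ _ this
    refine ⟨hab.1, ?_, ?_⟩
    · intro h; exact hab.2.1 (Finset.filter_subset _ _ h)
    · intro h; exact hab.2.2 (Finset.filter_subset _ _ h)
  · intro u hu hk
    exact hCI u (Relation.ReflTransGen.single ⟨hu, hv, hk⟩)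
  · intro x hx d hd hxd
    obtain ⟨h1, h2⟩ := hbC x hx (x + d) (adjd x d hd) hxd
    exact ⟨hCA x h1, h2⟩

/-- raising keeps configurations in `SC` -/
lemma raise_SC (V I : Finset Site) (hI : I ⊆ V) (s : BSign) (hs : s = .plus ∨ s = .minus)
    (H k : ℤ) (hk : k ≤ H) (ψ : Site → ℤ) (hψ : ψ ∈ SC V s H 0)
    (hg : ∀ x ∈ I, ∀ d ∈ dirs, x + d ∉ I → ψ x ≤ k - 1) : raise I ψ ∈ SC V s H 0 := by
  obtain ⟨h1, h2, h3⟩ := hψ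
  refine ⟨fun x hx => ?_, fun v hv => ?_, fun v hv => ?_⟩
  · unfold raise
    rw [if_neg (fun h => hx (hI h)), add_zero, h1 x hx]
  · unfold raise
    have := h2 v hv
    split_ifs <;> omega
  · have hok := h3 v hv
    unfold raise
    by_cases hvI : v ∈ I
    · obtain ⟨_, d, hd, hvd⟩ := Finset.mem_filter.1 hv
      have := hg v hvI d hd (fun h => hvd (hI h))
      rcases hs with rfl | rfl
      · simp only [BSign.ok, hvI, if_true] at *; omega
      · simp only [BSign.ok, hvI, if_true] at *; omega
    · simpa [hvI] using hok

/-- both heights at most `k` -/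
def R2 (V : Finset Site) (s : BSign) (H : ℤ) (u v : Site) (k : ℤ) : Set (Site → ℤ) :=
  {ψ | ψ ∈ SC V s H 0 ∧ ψ u ≤ k ∧ ψ v ≤ k}

lemma summ_sub (β lam : ℝ) (hβ : 0 ≤ β) (hl : 0 < lam) (V : Finset Site) (s : BSign) (H : ℤ)
    (S : Set (Site → ℤ)) (hS : ∀ ψ ∈ S, ψ ∈ SC V s H 0) :
    Summable (Set.indicator S (sosWt β lam V)) :=
  summable_SC β lam hβ hl V H 0 _ fun ψ h => SC_floor ψ (hS ψ h)

lemma card_le_len (V I : Finset Site) (hI : I ⊆ V) : I.card ≤ edgeBdryCard V * edgeBdryCard I := by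
  have h1 := isoper V
  have h2 := isoper I
  have h3 := Finset.card_le_card hI
  have : I.card ^ 2 ≤ (edgeBdryCard V * edgeBdryCard I) ^ 2 := by
    rw [mul_pow, sq I.card]
    exact Nat.mul_le_mul (h3.trans h1) h2
  exact (Nat.pow_le_pow_iff_left (by norm_num)).1 this

lemma lam_card_le (lam : ℝ) (hl : 0 < lam) (V I : Finset Site) (hI : I ⊆ V)
    (hlen : lam * edgeBdryCard V ≤ 1) : lam * I.card ≤ edgeBdryCard I := by
  have h : (I.card : ℝ) ≤ edgeBdryCard V * edgeBdryCard I := by exact_mod_cast card_le_len V I hI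
  have h0 : (0 : ℝ) ≤ edgeBdryCard I := Nat.cast_nonneg _
  calc lam * I.card ≤ lam * (edgeBdryCard V * edgeBdryCard I) := by gcongr
    _ = (lam * edgeBdryCard V) * edgeBdryCard I := by ring
    _ ≤ 1 * edgeBdryCard I := by gcongr
    _ = _ := one_mul _

lemma R2_step (β lam : ℝ) (hβ : 100 ≤ β) (hl : 0 < lam) (V : Finset Site) (hV : VInt V)
    (hlen : lam * edgeBdryCard V ≤ 1) (s : BSign) (hs : s = .plus ∨ s = .minus)
    (H k : ℤ) (hk : k ≤ H) (v d : Site) (hd : d ∈ dirs) :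
    ZS β lam V (R2 V s H (v + d) v (k - 1)) ≤
      Real.exp (-(β - 11) * 6) * ZS β lam V (R2 V s H (v + d) v k) := by
  set G := V.powerset.filter (fun I => VInt I ∧ v ∈ I ∧ v + d ∈ I) with hG
  set B : Finset Site → Set (Site → ℤ) := fun I => {ψ | ψ ∈ R2 V s H (v + d) v (k - 1) ∧
    ∀ x ∈ I, ∀ d ∈ dirs, x + d ∉ I → ψ x ≤ k - 1 ∧ k ≤ ψ (x + d)} with hB
  have hsum : ∀ k, Summable (Set.indicator (R2 V s H (v + d) v k) (sosWt β lam V)) := fun k =>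
    summ_sub β lam (by linarith) hl V s H _ fun ψ h => h.1
  have h1 : ZS β lam V (R2 V s H (v + d) v (k - 1)) ≤ ∑ I ∈ G, ZS β lam V (B I) := by
    refine ZS_union β lam V G _ B ?_ ?_
    · intro ψ hψ
      obtain ⟨I, hIV, hI, hvI, hu, hb⟩ := exists_I V hV ψ k
        (fun x hx => by rw [hψ.1.1 x hx]; exact hk) v hψ.2.2
      refine ⟨I, ?_, hψ, hb⟩
      rw [hG, Finset.mem_filter, Finset.mem_powerset]
      exact ⟨hIV, hI, hvI, hu _ (by unfold adjS; simpa using hd) hψ.2.1⟩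
    · intro I _
      exact summ_sub β lam (by linarith) hl V s H _ fun ψ h => h.1.1
  have h2 : ∀ I ∈ G, ZS β lam V (B I) ≤
      Real.exp (-(β - 1) * (edgeBdryCard I : ℝ)) * ZS β lam V (R2 V s H (v + d) v k) := by
    intro I hI
    rw [hG, Finset.mem_filter, Finset.mem_powerset] at hI
    obtain ⟨hIV, hIi, hvI, huI⟩ := hI
    refine (ZS_raise β lam V I hIV (B I) (R2 V s H (v + d) v k) ?_ (hsum k)).trans ?_
    · rintro ψ ⟨hψ, hg⟩
      refine ⟨⟨raise_SC V I hIV s hs H k hk ψ hψ.1 fun x hx d hd h => (hg x hx d hd h).1, ?_, ?_⟩,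
        fun x hx d hd h => ?_⟩
      · have := hψ.2.1
        simp only [raise, huI, if_true]; omega
      · have := hψ.2.2
        simp only [raise, hvI, if_true]; omega
      · have := hg x hx d hd h
        omega
    · refine mul_le_mul_of_nonneg_right (Real.exp_le_exp.2 ?_) (ZS_nonneg _ _ _ _)
      have := lam_card_le lam hl V I hIV hlen
      linarith
  have hd0 : v + d ≠ v := by
    intro h
    have : d = 0 := by simpa using h
    rw [mem_dirs, this] at hd
    simp [Prod.ext_iff] at hd
  have h3 : ∑ I ∈ G, Real.exp (-(β - 1) * (edgeBdryCard I : ℝ)) ≤ Real.exp (-((β - 1) - 10) * (6 : ℕ)) := by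
    refine peierls' v G ?_ (β - 1) (by linarith) 6 ?_
    · intro I hI
      rw [hG, Finset.mem_filter] at hI
      exact ⟨hI.2.1, hI.2.2.1⟩
    · intro I hI
      rw [hG, Finset.mem_filter] at hI
      refine len_ge_six ?_
      have : ({v + d, v} : Finset Site) ⊆ I := by
        intro x hx
        simp only [Finset.mem_insert, Finset.mem_singleton] at hx
        rcases hx with rfl | rfl
        · exact hI.2.2.2
        · exact hI.2.2.1
      have := Finset.card_le_card this
      rwa [Finset.card_pair hd0] at this
  calc _ ≤ ∑ I ∈ G, ZS β lam V (B I) := h1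
    _ ≤ ∑ I ∈ G, Real.exp (-(β - 1) * (edgeBdryCard I : ℝ)) * ZS β lam V (R2 V s H (v + d) v k) :=
        Finset.sum_le_sum h2
    _ = (∑ I ∈ G, Real.exp (-(β - 1) * (edgeBdryCard I : ℝ))) * ZS β lam V (R2 V s H (v + d) v k) := by
        rw [Finset.sum_mul]
    _ ≤ Real.exp (-((β - 1) - 10) * (6 : ℕ)) * ZS β lam V (R2 V s H (v + d) v k) := by
        exact mul_le_mul_of_nonneg_right h3 (ZS_nonneg _ _ _ _)
    _ = _ := by
        congr 2; push_cast; ring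

/-- height at `v` at most `k` -/
def Q1 (V : Finset Site) (s : BSign) (H : ℤ) (v : Site) (k : ℤ) : Set (Site → ℤ) :=
  {ψ | ψ ∈ SC V s H 0 ∧ ψ v ≤ k}

lemma Q1_step (β lam : ℝ) (hβ : 100 ≤ β) (hl : 0 < lam) (V : Finset Site)
    (s : BSign) (hs : s = .plus ∨ s = .minus)
    (H k : ℤ) (hk : k ≤ H) (v : Site) (hv : v ∈ V) :
    ZS β lam V (Q1 V s H v (k - 1)) ≤ Real.exp (-4 * β + lam) * ZS β lam V (Q1 V s H v k) +
      ∑ d ∈ dirs, ZS β lam V (R2 V s H (v + d) v (k - 1)) := by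
  set B : Set (Site → ℤ) := {ψ | ψ ∈ Q1 V s H v (k - 1) ∧ ∀ d ∈ dirs, k ≤ ψ (v + d)} with hB
  have hβ0 : 0 ≤ β := by linarith
  have h1 : ZS β lam V (Q1 V s H v (k - 1)) ≤ ∑ o ∈ Finset.insertNone dirs,
      ZS β lam V (o.elim B fun d => R2 V s H (v + d) v (k - 1)) := by
    refine ZS_union β lam V _ _ _ ?_ ?_
    · intro ψ hψ
      by_cases h : ∀ d ∈ dirs, k ≤ ψ (v + d)
      · exact ⟨none, by simp, hψ, h⟩
      · push Not at h
        obtain ⟨d, hd, h⟩ := h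
        exact ⟨some d, by simpa using hd, hψ.1, by omega, hψ.2⟩
    · intro o _
      cases o with
      | none => exact summ_sub β lam hβ0 hl V s H _ fun ψ h => h.1.1
      | some d => exact summ_sub β lam hβ0 hl V s H _ fun ψ h => h.1
  rw [Finset.sum_insertNone] at h1
  refine h1.trans (add_le_add_left ?_ _)
  have hIV : ({v} : Finset Site) ⊆ V := by simpa using hv
  refine (ZS_raise β lam V {v} hIV B (Q1 V s H v k) ?_
    (summ_sub β lam hβ0 hl V s H _ fun ψ h => h.1)).trans ?_
  · rintro ψ ⟨hψ, hg⟩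
    refine ⟨⟨raise_SC V {v} hIV s hs H k hk ψ hψ.1 ?_, ?_⟩, ?_⟩
    · intro x hx d hd _
      rw [Finset.mem_singleton] at hx
      rw [hx]; exact hψ.2
    · have := hψ.2
      simp only [raise, Finset.mem_singleton, if_true]; omega
    · intro x hx d hd _
      rw [Finset.mem_singleton] at hx
      have a := hg d hd
      have b := hψ.2
      rw [hx]; omega
  · refine le_of_eq ?_
    rw [len_singleton]
    congr 2
    simp; ring

lemma spike (β lam : ℝ) (hβ : 100 ≤ β) (hl : 0 < lam) (V : Finset Site) (hV : VInt V)
    (hlen : lam * edgeBdryCard V ≤ 1) (s : BSign) (hs : s = .plus ∨ s = .minus)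
    (H : ℤ) (v : Site) (hv : v ∈ V) (m : ℕ) :
    ZS β lam V (Q1 V s H v (H - m)) ≤ (2 - (1 / 2) ^ m) * Real.exp (-4 * β + lam) ^ m *
      ZS β lam V (SC V s H 0) := by
  set Z := ZS β lam V (SC V s H 0) with hZ
  have hZ0 : 0 ≤ Z := ZS_nonneg _ _ _ _
  have hβ0 : 0 ≤ β := by linarith
  set a := Real.exp (-4 * β + lam) with ha
  have ha0 : 0 < a := Real.exp_pos _
  set κ := Real.exp (-(β - 11) * 6) with hκ
  have hκ0 : 0 < κ := Real.exp_pos _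
  have hκa : κ ≤ a / 10 := by
    have h1 : κ = Real.exp (-(2 * β - 66 + lam)) * a := by
      rw [hκ, ha, ← Real.exp_add]; congr 1; ring
    have h2 := exp_small (show (10:ℝ) ≤ 2 * β - 66 + lam by linarith)
    rw [h1]
    nlinarith
  have hR : ∀ m : ℕ, ∀ d ∈ dirs, ZS β lam V (R2 V s H (v + d) v (H - m)) ≤ κ ^ m * Z := by
    intro m d hd
    induction m with
    | zero =>
      rw [pow_zero, one_mul]
      exact ZS_mono _ _ _ _ _ (fun ψ h => h.1) (summ_sub β lam hβ0 hl V s H _ fun ψ h => h)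
    | succ m ih =>
      have := R2_step β lam hβ hl V hV hlen s hs H (H - m) (by omega) v d hd
      rw [show H - ((m + 1 : ℕ) : ℤ) = H - m - 1 by push_cast; ring]
      refine this.trans ?_
      rw [pow_succ', mul_assoc]
      exact mul_le_mul_of_nonneg_left ih hκ0.le
  induction m with
  | zero =>
    norm_num
    exact ZS_mono _ _ _ _ _ (fun ψ h => h.1) (summ_sub β lam hβ0 hl V s H _ fun ψ h => h)
  | succ m ih =>
    have h1 := Q1_step β lam hβ hl V s hs H (H - m) (by omega) v hv
    have h2 : ∑ d ∈ dirs, ZS β lam V (R2 V s H (v + d) v (H - (m + 1 : ℕ))) ≤ 4 * (κ ^ (m + 1) * Z) := by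
      refine (Finset.sum_le_sum fun d hd => hR (m + 1) d hd).trans ?_
      rw [Finset.sum_const, show dirs.card = 4 by simp [dirs]]
      simp
    rw [show H - ((m + 1 : ℕ) : ℤ) = H - m - 1 by push_cast; ring] at h2 ⊢
    have h3 : κ ^ (m + 1) ≤ (1 / 10) ^ (m + 1) * a ^ (m + 1) := by
      rw [← mul_pow]
      exact pow_le_pow_left₀ hκ0.le (by linarith) _
    have h4 : (4 : ℝ) * (1 / 10) ^ (m + 1) ≤ (1 / 2) ^ (m + 1) := by
      have e : ((1:ℝ) / 10) ^ (m + 1) = (1 / 5) ^ (m + 1) * (1 / 2) ^ (m + 1) := by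
        rw [← mul_pow]; norm_num
      have h5 : ((1:ℝ) / 5) ^ (m + 1) ≤ 1 / 5 := by
        rw [pow_succ]
        have : ((1:ℝ) / 5) ^ m ≤ 1 := pow_le_one₀ (by norm_num) (by norm_num)
        linarith
      have h6 : (0:ℝ) < (1 / 2) ^ (m + 1) := by positivity
      rw [e]; nlinarith
    have h7 : 4 * (κ ^ (m + 1) * Z) ≤ (1 / 2) ^ (m + 1) * a ^ (m + 1) * Z := by
      have hp : 0 ≤ a ^ (m + 1) := by positivity
      calc 4 * (κ ^ (m + 1) * Z) ≤ 4 * ((1 / 10) ^ (m + 1) * a ^ (m + 1) * Z) := by gcongr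
        _ = (4 * (1 / 10) ^ (m + 1)) * (a ^ (m + 1) * Z) := by ring
        _ ≤ (1 / 2) ^ (m + 1) * (a ^ (m + 1) * Z) := by
          exact mul_le_mul_of_nonneg_right h4 (mul_nonneg hp hZ0)
        _ = _ := by ring
    have h8 := mul_le_mul_of_nonneg_left ih ha0.le
    refine (h1.trans (add_le_add h8 (h2.trans h7))).trans (le_of_eq ?_)
    rw [pow_succ (1 / 2 : ℝ), pow_succ a]
    ring

lemma pmin_lb (β lam : ℝ) (hβ : 100 ≤ β) (hl : 0 < lam) (V : Finset Site) (hV : VInt V)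
    (hlen : lam * edgeBdryCard V ≤ 1) (s : BSign) (hs : s = .plus ∨ s = .minus) (H : ℕ) :
    1 - 2 * V.card * Real.exp (-4 * β + lam) ^ H ≤ pmin β lam V s H := by
  set a := Real.exp (-4 * β + lam) with ha
  have hβ0 : 0 ≤ β := by linarith
  have hZ : 0 < ZS β lam V (SC V s H 0) := ZS_pos β lam hβ0 hl V s H 0 (by omega)
  have h1 : ZS β lam V (SC V s H 0) ≤ ∑ o ∈ Finset.insertNone V,
      ZS β lam V (o.elim (SC V s H 1) fun v => Q1 V s H v 0) := by
    refine ZS_union β lam V _ _ _ ?_ ?_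
    · intro ψ hψ
      by_cases h : ∀ v ∈ V, 1 ≤ ψ v
      · exact ⟨none, by simp, hψ.1, h, hψ.2.2⟩
      · push Not at h
        obtain ⟨v, hv, h⟩ := h
        exact ⟨some v, by simpa using hv, hψ, by omega⟩
    · intro o _
      cases o with
      | none => exact summable_SC β lam hβ0 hl V H 1 _ SC_floor
      | some d => exact summ_sub β lam hβ0 hl V s H _ fun ψ h => h.1
  rw [Finset.sum_insertNone] at h1
  have h2 : ∑ v ∈ V, ZS β lam V (Q1 V s H v 0) ≤ ∑ v ∈ V, 2 * a ^ H * ZS β lam V (SC V s H 0) := by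
    refine Finset.sum_le_sum fun v hv => ?_
    have := spike β lam hβ hl V hV hlen s hs H v hv H
    rw [sub_self] at this
    refine this.trans (mul_le_mul_of_nonneg_right (mul_le_mul_of_nonneg_right ?_ ?_) hZ.le)
    · have : (0:ℝ) < (1 / 2) ^ H := by positivity
      linarith
    · positivity
  rw [Finset.sum_const, nsmul_eq_mul] at h2
  unfold pmin
  rw [le_div_iff₀ hZ]
  simp only [Option.elim_none, Option.elim_some] at h1
  nlinarith

end

open scoped BigOperators
open Filter

noncomputable section

attribute [local instance] Classical.propDecidable

/-! ## Part 5: comparison of free energies -/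

/-- bound for the change of weight of a contour between consecutive heights -/
def gg (β lam : ℝ) (n : ℕ) (V : Finset Site) : ℝ :=
  2 * V.card * Real.exp (-4 * β + lam) ^ n * Real.exp (-(β - 5) * (edgeBdryCard V : ℝ)) +
    if 1 < lam * (edgeBdryCard V : ℝ) then Real.exp (-(β - 5) * (edgeBdryCard V : ℝ)) else 0

lemma gg_nonneg (β lam : ℝ) (n : ℕ) (V : Finset Site) : 0 ≤ gg β lam n V := by
  unfold gg
  have : (0:ℝ) ≤ if 1 < lam * (edgeBdryCard V : ℝ) then Real.exp (-(β - 5) * (edgeBdryCard V : ℝ)) else 0 := by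
    split_ifs <;> positivity
  positivity

lemma a_le (β lam : ℝ) (hβ : 1000 ≤ β) (hl1 : lam ≤ 1) : Real.exp (-4 * β + lam) ≤ 1 / 100 := by
  have := exp_small (show (10:ℝ) ≤ 4 * β - lam by linarith)
  rwa [show -(4 * β - lam) = -4 * β + lam by ring] at this

lemma csum (β : ℝ) (hβ : 1000 ≤ β) (U : Finset Site) (v : Site) :
    ∑ V ∈ U.powerset.filter (fun V => VInt V ∧ v ∈ V),
      (V.card : ℝ) * Real.exp (-(β - 5) * (edgeBdryCard V : ℝ)) ≤ 2 * Real.exp (-(β - 16) * 4) := by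
  have h1 := peierls' v (U.powerset.filter (fun V => VInt V ∧ v ∈ V))
    (fun V hV => (Finset.mem_filter.1 hV).2) (β - 6) (by linarith) 4
    (fun V hV => len_ge_four (Finset.mem_filter.1 hV).2.1.1)
  have h2 : ∀ V : Finset Site, (V.card : ℝ) * Real.exp (-(β - 5) * (edgeBdryCard V : ℝ)) ≤
      2 * Real.exp (-(β - 6) * (edgeBdryCard V : ℝ)) := by
    intro V
    have h3 : (V.card : ℝ) ≤ (edgeBdryCard V : ℝ) ^ 2 := by exact_mod_cast isoper V
    have h4 := Real.quadratic_le_exp_of_nonneg (Nat.cast_nonneg (α := ℝ) (edgeBdryCard V))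
    have h5 : (0:ℝ) ≤ edgeBdryCard V := Nat.cast_nonneg _
    have h6 : (V.card : ℝ) ≤ 2 * Real.exp (edgeBdryCard V : ℝ) := by linarith
    calc _ ≤ 2 * Real.exp (edgeBdryCard V : ℝ) * Real.exp (-(β - 5) * (edgeBdryCard V : ℝ)) := by gcongr
      _ = _ := by
        rw [mul_assoc, ← Real.exp_add]; congr 2; ring
  refine (Finset.sum_le_sum fun V _ => h2 V).trans ?_
  rw [← Finset.mul_sum]
  refine mul_le_mul_of_nonneg_left (h1.trans (le_of_eq ?_)) (by norm_num)
  congr 1; push_cast; ring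

lemma gsum (β lam : ℝ) (hβ : 1000 ≤ β) (hl : 0 < lam) (h n : ℕ) (hh : 20 * ((h : ℝ) + 1) * lam ≤ 1)
    (U : Finset Site) (v : Site) :
    ∑ V ∈ U.powerset.filter (fun V => VInt V ∧ v ∈ V), gg β lam n V ≤
      4 * Real.exp (-4 * β + lam) ^ n * Real.exp (-(β - 16) * 4) +
        Real.exp (-10 * β * (h + 1)) := by
  unfold gg
  rw [Finset.sum_add_distrib]
  refine add_le_add ?_ ?_
  · have := csum β hβ U v
    have e : ∀ V : Finset Site, 2 * (V.card : ℝ) * Real.exp (-4 * β + lam) ^ n *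
        Real.exp (-(β - 5) * (edgeBdryCard V : ℝ)) = 2 * Real.exp (-4 * β + lam) ^ n *
        ((V.card : ℝ) * Real.exp (-(β - 5) * (edgeBdryCard V : ℝ))) := fun V => by ring
    simp_rw [e]
    rw [← Finset.mul_sum]
    have h0 : 0 ≤ 2 * Real.exp (-4 * β + lam) ^ n := by positivity
    nlinarith [mul_le_mul_of_nonneg_left this h0]
  · have h1 := peierls' v (U.powerset.filter (fun V => VInt V ∧ v ∈ V))
      (fun V hV => (Finset.mem_filter.1 hV).2) (β / 2 - 5) (by linarith) 0 (fun V hV => Nat.zero_le _)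
    rw [Nat.cast_zero, mul_zero, Real.exp_zero] at h1
    have h2 : ∀ V : Finset Site, (if 1 < lam * (edgeBdryCard V : ℝ) then
        Real.exp (-(β - 5) * (edgeBdryCard V : ℝ)) else 0) ≤
        Real.exp (-10 * β * (h + 1)) * Real.exp (-(β / 2 - 5) * (edgeBdryCard V : ℝ)) := by
      intro V
      split_ifs with hV
      · rw [← Real.exp_add]
        refine Real.exp_le_exp.2 ?_
        have h3 : 20 * ((h : ℝ) + 1) ≤ edgeBdryCard V := by
          by_contra hc
          push Not at hc
          nlinarith
        nlinarith
      · positivity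
    refine (Finset.sum_le_sum fun V _ => h2 V).trans ?_
    rw [← Finset.mul_sum]
    have := mul_le_mul_of_nonneg_left h1 (Real.exp_pos (-10 * β * ((h:ℝ) + 1))).le
    linarith

lemma Wtr_cmp (β lam : ℝ) (hβ : 1000 ≤ β) (hl : 0 < lam) (hl1 : lam ≤ 1) (h : ℕ) (γ : Contour)
    (hv : γ.valid) :
    max (Wtr β lam h γ - Wtr β lam (h + 1 : ℕ) γ) 0 ≤ gg β lam (h + 1) γ.int ∧
    max (Wtr β lam (h + 1 : ℕ) γ - Wtr β lam h γ) 0 ≤ gg β lam h γ.int := by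
  have b1 := Wtr_bounds β lam h γ
  have b2 := Wtr_bounds β lam (h + 1 : ℕ) γ
  have hlen : γ.len = edgeBdryCard γ.int := rfl
  rw [hlen] at b1 b2
  set a := Real.exp (-4 * β + lam) with ha
  have ha0 : 0 < a := Real.exp_pos _
  have ha1 : a ≤ 1 := (a_le β lam hβ hl1).trans (by norm_num)
  set E := Real.exp (-(β - 5) * (edgeBdryCard γ.int : ℝ)) with hE
  have hc0 : (0:ℝ) ≤ γ.int.card := Nat.cast_nonneg _
  have hE0 : 0 < E := Real.exp_pos _
  refine ⟨max_le ?_ (gg_nonneg _ _ _ _), max_le ?_ (gg_nonneg _ _ _ _)⟩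
  all_goals
    unfold gg
    rw [← ha, ← hE]
    by_cases hL : 1 < lam * (edgeBdryCard γ.int : ℝ)
    · rw [if_pos hL]
      have h1 : 0 ≤ 2 * (γ.int.card : ℝ) * a ^ (h + 1) * E := by positivity
      have h2 : 0 ≤ 2 * (γ.int.card : ℝ) * a ^ h * E := by positivity
      linarith [b1.1, b1.2, b2.1, b2.2]
    rw [if_neg hL, add_zero]
    push Not at hL
  · have key : (1 - 2 * γ.int.card * a ^ (h + 1)) * Wtr β lam h γ ≤ Wtr β lam (h + 1 : ℕ) γ := by
      by_cases hu : γ.up = true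
      · have c := (Wtr_compare_up β lam (by linarith) hl h γ hu).2
        have p := pmin_lb β lam (by linarith) hl γ.int hv hL .plus (Or.inl rfl) (h + 1)
        push_cast at p c ⊢
        exact (mul_le_mul_of_nonneg_right p b1.1).trans c
      · have c := (Wtr_compare_dn β lam (by linarith) hl h γ (by simpa using hu)).2
        have p := pmin_lb β lam (by linarith) hl γ.int hv hL .minus (Or.inr rfl) (h + 1)
        push_cast at p c ⊢
        exact (mul_le_mul_of_nonneg_right p b1.1).trans c
    have := mul_le_mul_of_nonneg_left b1.2 (show 0 ≤ 2 * (γ.int.card : ℝ) * a ^ (h + 1) by positivity)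
    linarith
  · have key : (1 - 2 * γ.int.card * a ^ h) * Wtr β lam (h + 1 : ℕ) γ ≤ Wtr β lam h γ := by
      by_cases hu : γ.up = true
      · have c := (Wtr_compare_up β lam (by linarith) hl h γ hu).1
        have p := pmin_lb β lam (by linarith) hl γ.int hv hL .plus (Or.inl rfl) (h + 2)
        have hpow : a ^ (h + 2) ≤ a ^ h := pow_le_pow_of_le_one ha0.le ha1 (by omega)
        have p' : 1 - 2 * γ.int.card * a ^ h ≤ 1 - 2 * γ.int.card * a ^ (h + 2) := by
          have := mul_le_mul_of_nonneg_left hpow (show 0 ≤ 2 * (γ.int.card : ℝ) by positivity)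
          linarith
        have p2 := p'.trans p
        push_cast at p2 c b2 ⊢
        exact (mul_le_mul_of_nonneg_right p2 b2.1).trans c
      · have c := (Wtr_compare_dn β lam (by linarith) hl h γ (by simpa using hu)).1
        have p := pmin_lb β lam (by linarith) hl γ.int hv hL .minus (Or.inr rfl) h
        exact (mul_le_mul_of_nonneg_right p b2.1).trans c
    have := mul_le_mul_of_nonneg_left b2.2 (show 0 ≤ 2 * (γ.int.card : ℝ) * a ^ h by positivity)
    linarith

lemma Wtr_half (β lam : ℝ) (hβ : 1000 ≤ β) (h : ℤ) (γ : Contour) (hv : γ.valid) :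
    0 ≤ Wtr β lam h γ ∧ Wtr β lam h γ ≤ 1 / 2 := by
  have b := Wtr_bounds β lam h γ
  refine ⟨b.1, b.2.trans ?_⟩
  have h4 : (4:ℝ) ≤ γ.len := by exact_mod_cast len_ge_four hv.1
  have := exp_small (show (10:ℝ) ≤ (β - 5) * γ.len by nlinarith)
  rw [neg_mul]
  linarith

/-- upper comparison in finite volume -/
lemma FF_upper (β lam : ℝ) (hβ : 1000 ≤ β) (hl : 0 < lam) (hl1 : lam ≤ 1) (h : ℕ)
    (hh : 20 * ((h : ℝ) + 1) * lam ≤ 1) (U : Finset Site) :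
    Real.log (FF U (Wtr β lam (h + 1 : ℕ))) ≤ Real.log (FF U (Wtr β lam h)) +
      8 * (4 * Real.exp (-4 * β + lam) ^ h * Real.exp (-(β - 16) * 4) +
        Real.exp (-10 * β * (h + 1))) * U.card := by
  have h1 := FF_ub U (Wtr β lam h) (Wtr β lam (h + 1 : ℕ))
    (fun γ hγ => Wtr_half β lam hβ _ γ ((mem_CU _ _).1 hγ).1)
    (fun γ hγ => Wtr_half β lam hβ _ γ ((mem_CU _ _).1 hγ).1)
  have h2 : ∑ γ ∈ CU U, max (Wtr β lam (h + 1 : ℕ) γ - Wtr β lam h γ) 0 ≤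
      ∑ γ ∈ CU U, gg β lam h γ.int :=
    Finset.sum_le_sum fun γ hγ => (Wtr_cmp β lam hβ hl hl1 h γ ((mem_CU _ _).1 hγ).1).2
  have h3 := sum_CU_total U (gg β lam h) (gg_nonneg β lam h) _ (fun v _ => gsum β lam hβ hl h h hh U v)
  linarith

lemma ZS_disj (β lam : ℝ) (V : Finset Site) (A : Set (Site → ℤ)) (ψ : Site → ℤ) (hψ : ψ ∉ A)
    (hA : Summable (Set.indicator A (sosWt β lam V))) :
    ZS β lam V (A ∪ {ψ}) = ZS β lam V A + sosWt β lam V ψ := by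
  unfold ZS
  rw [Set.indicator_union_of_disjoint (by simpa using hψ)]
  have hs : HasSum (Set.indicator {ψ} (sosWt β lam V)) (sosWt β lam V ψ) := by
    have := hasSum_ite_eq ψ (sosWt β lam V ψ)
    refine this.congr_fun ?_ 
    intro x
    by_cases hx : x = ψ <;> simp [hx]
  rw [Summable.tsum_add hA hs.summable, hs.tsum_eq]

lemma innerBdry_singleton (v : Site) : v ∈ innerBdry {v} := by
  refine Finset.mem_filter.2 ⟨by simp, (1, 0), by simp [dirs], ?_⟩
  simp [Prod.ext_iff]

lemma ZS_sing (β lam : ℝ) (hβ : 0 ≤ β) (hl : 0 < lam) (v : Site) (h : ℕ) :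
    ZS β lam {v} (SC {v} .minus h 0) = ZS β lam {v} (SC {v} .minus h 1) +
      Real.exp (-4 * β * h) := by
  set ψ0 : Site → ℤ := fun x => if x = v then 0 else h with hψ0
  have e : SC {v} .minus h 0 = SC {v} .minus h 1 ∪ {ψ0} := by
    ext ψ
    constructor
    · rintro ⟨h1, h2, h3⟩
      by_cases hp : 1 ≤ ψ v
      · left
        exact ⟨h1, fun x hx => by rw [Finset.mem_singleton] at hx; rw [hx]; exact hp, h3⟩
      · right
        have := h2 v (by simp)
        rw [Set.mem_singleton_iff]
        funext x
        by_cases hx : x = v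
        · simp only [hψ0, hx, if_true]; omega
        · simp only [hψ0, hx, if_false]
          exact h1 x (by simpa using hx)
    · rintro (hψ | hψ)
      · exact SC_mono_floor _ _ _ _ _ (by norm_num) hψ
      · rw [Set.mem_singleton_iff] at hψ
        rw [hψ]
        refine ⟨?_, ?_, ?_⟩
        · intro x hx
          rw [Finset.mem_singleton] at hx
          simp [hψ0, hx]
        · intro x _
          simp only [hψ0]; split_ifs <;> omega
        · intro x _
          simp only [hψ0, BSign.ok]; split_ifs <;> omega
  rw [e, ZS_disj β lam {v} _ ψ0 ?_ (summable_SC β lam hβ hl {v} h 1 _ SC_floor)]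
  · congr 1
    unfold sosWt sosEnergy sosField
    congr 1
    have ht : ∀ d ∈ dirs, (if v + d ∈ ({v} : Finset Site) then (1 : ℝ) / 2 else 1) *
        |((ψ0 v : ℤ) : ℝ) - ((ψ0 (v + d) : ℤ) : ℝ)| = h := by
      intro d hd
      have hd0 : d ≠ 0 := by
        intro h0
        rw [mem_dirs, h0] at hd
        simp [Prod.ext_iff] at hd
      simp [hψ0, hd0]
    rw [Finset.sum_singleton, Finset.sum_singleton, Finset.sum_congr rfl ht, Finset.sum_const,
      show dirs.card = 4 by simp [dirs]]
    simp [hψ0]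
    ring
  · rintro ⟨-, h2, -⟩
    have := h2 v (by simp)
    simp [hψ0] at this

lemma T_le (β lam : ℝ) (hβ : 1000 ≤ β) (hl : 0 < lam) (hl1 : lam ≤ 1) (v : Site) (h : ℕ) :
    Real.exp (lam * h) * ZS β lam {v} (SC {v} .minus h 0) ≤ 2 - (1 / 2) ^ h := by
  have hβ0 : 0 ≤ β := by linarith
  induction h with
  | zero =>
    rw [ZS_sing β lam hβ0 hl v 0]
    have := ZS_shift β lam {v} .minus (-1) 0
    rw [ZS_minus_neg β lam {v} ⟨v, by simp⟩] at this
    norm_num at this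
    norm_num [this]
  | succ h ih =>
    rw [ZS_sing β lam hβ0 hl v (h + 1)]
    have := ZS_shift β lam {v} .minus h 0
    rw [zero_add] at this
    push_cast at this ⊢
    rw [this]
    set T := ZS β lam {v} (SC {v} .minus h 0)
    have e1 : Real.exp (lam * (h + 1)) * (Real.exp (-lam * ((({v} : Finset Site).card : ℕ) : ℝ)) * T +
        Real.exp (-4 * β * (h + 1))) = Real.exp (lam * h) * T + Real.exp (-4 * β + lam) ^ (h + 1) := by
      rw [mul_add, ← mul_assoc, ← Real.exp_add, ← Real.exp_add, ← Real.exp_nat_mul]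
      congr 3
      · simp; ring
      · push_cast; ring
    have h2 : Real.exp (-4 * β + lam) ^ (h + 1) ≤ (1 / 2) ^ (h + 1) :=
      pow_le_pow_left₀ (Real.exp_pos _).le ((a_le β lam hβ hl1).trans (by norm_num)) _
    have h3 : ((1:ℝ) / 2) ^ h = 2 * (1 / 2) ^ (h + 1) := by rw [pow_succ]; ring
    simp only [Finset.card_singleton] at e1 ⊢
    rw [e1]
    linarith

lemma pmin_ub (β lam : ℝ) (hβ : 1000 ≤ β) (hl : 0 < lam) (hl1 : lam ≤ 1) (v : Site) (h : ℕ) :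
    pmin β lam {v} .minus h ≤ 1 - Real.exp (-4 * β + lam) ^ h / 2 := by
  have hβ0 : 0 ≤ β := by linarith
  have hZ : 0 < ZS β lam {v} (SC {v} .minus h 0) := ZS_pos β lam hβ0 hl _ _ _ _ (by omega)
  have e := ZS_sing β lam hβ0 hl v h
  have hT := T_le β lam hβ hl hl1 v h
  have hp : (0:ℝ) < (1 / 2) ^ h := by positivity
  unfold pmin
  rw [div_le_iff₀ hZ]
  have ea : Real.exp (-4 * β + lam) ^ h = Real.exp (lam * h) * Real.exp (-4 * β * h) := by
    rw [← Real.exp_nat_mul, ← Real.exp_add]; congr 1; ring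
  rw [ea]
  have := mul_le_mul_of_nonneg_left (hT.trans (show 2 - (1/2:ℝ)^h ≤ 2 by linarith)) (Real.exp_pos (-4 * β * h)).le
  nlinarith

/-- gain from down singletons -/
lemma Wtr_gain (β lam : ℝ) (hβ : 1000 ≤ β) (hl : 0 < lam) (hl1 : 4 * lam ≤ 1) (v : Site) (h : ℕ) :
    Wtr β lam h ⟨{v}, false⟩ + Real.exp (-4 * β + lam) ^ (h + 1) / 4 ≤
      Wtr β lam (h + 1 : ℕ) ⟨{v}, false⟩ := by
  have hβ0 : 0 ≤ β := by linarith
  set a := Real.exp (-4 * β + lam) with ha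
  have ha0 : 0 < a := Real.exp_pos _
  have hlen : (Contour.len ⟨{v}, false⟩ : ℕ) = 4 := len_singleton v
  have hW : ∀ n : ℕ, Wtr β lam n ⟨{v}, false⟩ = a * pmin β lam {v} .minus n := by
    intro n
    have e := Wrn_dn_eq β lam n ⟨{v}, false⟩ rfl
    have e2 : Wrn β lam n ⟨{v}, false⟩ = a * pmin β lam {v} .minus n := by
      rw [e, hlen, ← Real.exp_add, ha]
      congr 2
      simp; ring
    unfold Wtr
    rw [e2, hlen]
    refine min_eq_left ?_
    have p1 := pmin_le_one β lam hβ0 hl {v} .minus n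
    have : a ≤ Real.exp (-(β - 5) * ((4 : ℕ) : ℝ)) := Real.exp_le_exp.2 (by push_cast; linarith)
    nlinarith
  rw [hW, hW]
  have u := pmin_ub β lam hβ hl (by linarith) v h
  have l := pmin_lb β lam (by linarith) hl {v} (singleton_VInt v) (by rw [len_singleton]; push_cast; linarith) .minus (Or.inr rfl) (h + 1)
  have hs := a_le β lam hβ (by linarith)
  rw [← ha] at u l hs
  simp only [Finset.card_singleton, Nat.cast_one] at l
  have hp : 0 < a ^ h := by positivity
  rw [pow_succ] at l ⊢
  nlinarith [mul_le_mul_of_nonneg_left u ha0.le, mul_le_mul_of_nonneg_left l ha0.le, mul_pos ha0 hp]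

/-- lower comparison in finite volume -/
lemma FF_lower (β lam : ℝ) (hβ : 1000 ≤ β) (hl : 0 < lam) (h : ℕ)
    (hh : 20 * ((h : ℝ) + 1) * lam ≤ 1) (U : Finset Site) :
    Real.log (FF U (Wtr β lam h)) + Real.exp (-4 * β + lam) ^ (h + 1) / 16 * U.card ≤
      Real.log (FF U (Wtr β lam (h + 1 : ℕ))) +
      8 * (4 * Real.exp (-4 * β + lam) ^ (h + 1) * Real.exp (-(β - 16) * 4) +
        Real.exp (-10 * β * (h + 1))) * U.card := by
  have hh4 : 4 * lam ≤ 1 := by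
    have : (0:ℝ) ≤ h := Nat.cast_nonneg _
    nlinarith
  set w : Contour → ℝ := fun γ => if ∃ v, γ = ⟨{v}, false⟩ then Wtr β lam (h + 1 : ℕ) γ
    else Wtr β lam h γ with hw
  have wb : ∀ γ, w γ = Wtr β lam (h + 1 : ℕ) γ ∨ w γ = Wtr β lam h γ := by
    intro γ; simp only [hw]; split_ifs <;> simp
  have wsing : ∀ v, w ⟨{v}, false⟩ = Wtr β lam (h + 1 : ℕ) ⟨{v}, false⟩ := by
    intro v
    simp only [hw]
    rw [if_pos ⟨v, rfl⟩]
  have h1 := FF_lb β (by linarith) U (Wtr β lam h) w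
    (fun γ _ => Wtr_bounds β lam h γ)
    (fun γ _ => by rcases wb γ with e | e <;> rw [e] <;> exact Wtr_bounds β lam _ γ)
    (fun v _ => by
      rw [wsing]
      have := Wtr_gain β lam hβ hl hh4 v h
      have : 0 < Real.exp (-4 * β + lam) ^ (h + 1) := by positivity
      linarith)
    (fun γ _ hγ => by
      simp only [hw]
      rw [if_neg]
      rintro ⟨v, hv⟩
      exact hγ v hv)
  have h2 : Real.exp (-4 * β + lam) ^ (h + 1) / 16 * U.card ≤
      ∑ v ∈ U, (w ⟨{v}, false⟩ - Wtr β lam h ⟨{v}, false⟩) / 4 := by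
    rw [mul_comm, ← nsmul_eq_mul, ← Finset.sum_const]
    refine Finset.sum_le_sum fun v _ => ?_
    rw [wsing]
    have := Wtr_gain β lam hβ hl hh4 v h
    linarith
  have h3 := FF_ub U (Wtr β lam (h + 1 : ℕ)) w
    (fun γ hγ => Wtr_half β lam hβ _ γ ((mem_CU _ _).1 hγ).1)
    (fun γ hγ => by
      rcases wb γ with e | e <;> rw [e] <;> exact Wtr_half β lam hβ _ γ ((mem_CU _ _).1 hγ).1)
  have h4 : ∑ γ ∈ CU U, max (w γ - Wtr β lam (h + 1 : ℕ) γ) 0 ≤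
      ∑ γ ∈ CU U, gg β lam (h + 1) γ.int := by
    refine Finset.sum_le_sum fun γ hγ => ?_
    rcases wb γ with e | e <;> rw [e]
    · rw [sub_self, max_self]; exact gg_nonneg _ _ _ _
    · exact (Wtr_cmp β lam hβ hl (by linarith) h γ ((mem_CU _ _).1 hγ).1).1
  have h5 := sum_CU_total U (gg β lam (h + 1)) (gg_nonneg β lam (h + 1)) _
    (fun v _ => gsum β lam hβ hl h (h + 1) hh U v)
  linarith

lemma FF_lip (β l1 l2 : ℝ) (hβ : 1000 ≤ β) (h1 : 0 < l1) (h2 : 0 < l2) (h : ℕ) (U : Finset Site) :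
    Real.log (FF U (Wtr β l1 h)) ≤ Real.log (FF U (Wtr β l2 h)) + 1 / 4 * |l1 - l2| * U.card := by
  have a1 := FF_ub U (Wtr β l2 h) (Wtr β l1 h)
    (fun γ hγ => Wtr_half β l2 hβ _ γ ((mem_CU _ _).1 hγ).1)
    (fun γ hγ => Wtr_half β l1 hβ _ γ ((mem_CU _ _).1 hγ).1)
  have a2 : ∑ γ ∈ CU U, max (Wtr β l1 h γ - Wtr β l2 h γ) 0 ≤
      ∑ γ ∈ CU U, |l1 - l2| * ((γ.int.card : ℝ) * Real.exp (-(β - 5) * (edgeBdryCard γ.int : ℝ))) :=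
    Finset.sum_le_sum fun γ hγ => Wtr_lip β l1 l2 (by linarith) h1 h2 h γ ((mem_CU _ _).1 hγ).1
  rw [← Finset.mul_sum] at a2
  have a3 := sum_CU_total U (fun V => (V.card : ℝ) * Real.exp (-(β - 5) * (edgeBdryCard V : ℝ)))
    (fun V => by positivity) _ (fun v _ => csum β hβ U v)
  have a4 := exp_small (show (10:ℝ) ≤ (β - 16) * 4 by linarith)
  rw [← neg_mul] at a4
  have a5 := mul_le_mul_of_nonneg_left a3 (abs_nonneg (l1 - l2))
  have a6 : (0:ℝ) ≤ |l1 - l2| * U.card := by positivity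
  have a7 := mul_le_mul_of_nonneg_right a4 a6
  linarith

end

open scoped BigOperators
open Filter

noncomputable section

attribute [local instance] Classical.propDecidable

/-! ## Part 6: passage to the limit and conclusion -/

lemma box_card_pos (n : ℕ) : 0 < (box n).card := by
  refine Finset.card_pos.2 ⟨(0, 0), ?_⟩
  unfold box
  simp only [Finset.mem_product, Finset.mem_Icc]
  omega

lemma logZ_eq (β lam : ℝ) (hβ : 1000 ≤ β) (h : ℕ) (U : Finset Site) :
    Real.log (Ztr β lam (constSign .free) h U) =
      -lam * h * U.card + Real.log (FF U (Wtr β lam h)) := by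
  rw [Ztr_eq β lam h U]
  · have := FF_ge_one U (Wtr β lam h)
      (fun γ hγ => Wtr_half β lam hβ _ γ ((mem_CU _ _).1 hγ).1)
    rw [Real.log_mul (Real.exp_pos _).ne' (by linarith), Real.log_exp]
    push_cast
    rfl
  · intro γ hγ
    have := Wtr_half β lam hβ h γ ((mem_CU _ _).1 hγ).1
    exact ⟨this.1, by linarith [this.2]⟩
  · intro h0 γ hγ hd
    rw [h0]
    exact Wtr_down_zero β lam γ ((mem_CU _ _).1 hγ).1 hd

lemma P_tendsto (β : ℝ) (hβ : 1000 ≤ β) (ftr : ℕ → ℝ → ℝ) (hf : FTRlimit β ftr) (h : ℕ)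
    (lam : ℝ) (hl : 0 < lam) (hl1 : lam ≤ 1) :
    Tendsto (fun n => Real.log (FF (box n) (Wtr β lam h)) / ((box n).card : ℝ)) atTop
      (nhds (ftr h lam + lam * h)) := by
  have := (hf h lam hl hl1 (constSign .free)).add_const (lam * h)
  refine this.congr fun n => ?_
  have hc : (0:ℝ) < (box n).card := by exact_mod_cast box_card_pos n
  rw [logZ_eq β lam hβ h (box n)]
  field_simp
  ring

lemma P_le (β : ℝ) (hβ : 1000 ≤ β) (ftr : ℕ → ℝ → ℝ) (hf : FTRlimit β ftr) (h h' : ℕ)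
    (lam lam' : ℝ) (hl : 0 < lam) (hl1 : lam ≤ 1) (hl' : 0 < lam') (hl1' : lam' ≤ 1) (c : ℝ)
    (H : ∀ U, Real.log (FF U (Wtr β lam h)) ≤ Real.log (FF U (Wtr β lam' h')) + c * U.card) :
    ftr h lam + lam * h ≤ ftr h' lam' + lam' * h' + c := by
  refine le_of_tendsto_of_tendsto' (P_tendsto β hβ ftr hf h lam hl hl1)
    ((P_tendsto β hβ ftr hf h' lam' hl' hl1').add_const c) fun n => ?_
  have hc : (0:ℝ) < (box n).card := by exact_mod_cast box_card_pos n
  rw [div_add' _ _ _ hc.ne']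
  exact div_le_div_of_nonneg_right (H (box n)) hc.le

lemma num_small (β : ℝ) (hβ : 1000 ≤ β) (h : ℕ) (lam : ℝ)
    (hl : lam ≤ Real.exp (-4 * β * h - 2 * β)) : 20 * ((h : ℝ) + 1) * lam ≤ 1 := by
  have h0 : (0:ℝ) ≤ h := Nat.cast_nonneg _
  have h1 := Real.add_one_le_exp (4 * β * h + 2 * β)
  have h2 : 20 * ((h : ℝ) + 1) ≤ Real.exp (4 * β * h + 2 * β) := by nlinarith
  calc 20 * ((h : ℝ) + 1) * lam ≤ 20 * ((h : ℝ) + 1) * Real.exp (-4 * β * h - 2 * β) := by gcongr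
    _ ≤ Real.exp (4 * β * h + 2 * β) * Real.exp (-4 * β * h - 2 * β) := by gcongr
    _ = 1 := by rw [← Real.exp_add]; ring_nf; exact Real.exp_zero

lemma exp_m (x : ℝ) (hx : 1000 ≤ x) : Real.exp (-x) ≤ 1 / 1000 := by
  have h1 := Real.add_one_le_exp x
  rw [Real.exp_neg, ← one_div]
  exact one_div_le_one_div_of_le (by norm_num) (by linarith)

lemma ftr_upper (β : ℝ) (hβ : 1000 ≤ β) (ftr : ℕ → ℝ → ℝ) (hf : FTRlimit β ftr) (h : ℕ) :
    ftr (h + 1) (Real.exp (-4 * β * h - 2 * β)) < ftr h (Real.exp (-4 * β * h - 2 * β)) := by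
  set lam := Real.exp (-4 * β * h - 2 * β) with hlam
  have h0 : (0:ℝ) ≤ h := Nat.cast_nonneg _
  have hl : 0 < lam := Real.exp_pos _
  have hh := num_small β hβ h lam le_rfl
  have hl1 : lam ≤ 1 := by nlinarith
  have key := P_le β hβ ftr hf (h + 1) h lam lam hl hl1 hl hl1 _
    (FF_upper β lam hβ hl hl1 h hh)
  push_cast at key
  have e1 : Real.exp (-4 * β + lam) ^ h * Real.exp (-(β - 16) * 4) ≤ lam / 1000 := by
    have : Real.exp (-4 * β + lam) ^ h * Real.exp (-(β - 16) * 4) =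
        lam * Real.exp (-(2 * β - 64 - lam * h)) := by
      rw [← Real.exp_nat_mul, ← Real.exp_add]
      nth_rw 2 [hlam]
      rw [← Real.exp_add]
      congr 1; ring
    rw [this]
    have := exp_m (2 * β - 64 - lam * h) (by nlinarith)
    nlinarith
  have e2 : Real.exp (-10 * β * (h + 1)) ≤ lam / 1000 := by
    have : Real.exp (-10 * β * (h + 1)) = lam * Real.exp (-(6 * β * h + 8 * β)) := by
      rw [hlam, ← Real.exp_add]; congr 1; ring
    rw [this]
    have := exp_m (6 * β * h + 8 * β) (by nlinarith)
    nlinarith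
  nlinarith

lemma ftr_lower (β : ℝ) (hβ : 1000 ≤ β) (ftr : ℕ → ℝ → ℝ) (hf : FTRlimit β ftr) (h : ℕ) :
    ftr h (Real.exp (-4 * β * h - 5 * β)) < ftr (h + 1) (Real.exp (-4 * β * h - 5 * β)) := by
  set lam := Real.exp (-4 * β * h - 5 * β) with hlam
  have h0 : (0:ℝ) ≤ h := Nat.cast_nonneg _
  have hl : 0 < lam := Real.exp_pos _
  have hh := num_small β hβ h lam (Real.exp_le_exp.2 (by linarith))
  have hl1 : lam ≤ 1 := by nlinarith
  set A := Real.exp (-4 * β + lam) ^ (h + 1) with hA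
  have hA0 : 0 < A := by positivity
  have key := P_le β hβ ftr hf h (h + 1) lam lam hl hl1 hl hl1
    (8 * (4 * A * Real.exp (-(β - 16) * 4) + Real.exp (-10 * β * (h + 1))) - A / 16)
    (fun U => by
      have := FF_lower β lam hβ hl h hh U
      linarith)
  push_cast at key
  have e0 : Real.exp (-4 * β * (h + 1)) ≤ A := by
    rw [hA, ← Real.exp_nat_mul]
    refine Real.exp_le_exp.2 ?_
    push_cast
    nlinarith
  have e1 := exp_m ((β - 16) * 4) (by linarith)
  rw [← neg_mul] at e1
  have e2 : Real.exp (-10 * β * (h + 1)) ≤ A / 1000 := by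
    have : Real.exp (-10 * β * (h + 1)) =
        Real.exp (-4 * β * (h + 1)) * Real.exp (-(6 * β * (h + 1))) := by
      rw [← Real.exp_add]; congr 1; ring
    rw [this]
    have := exp_m (6 * β * (h + 1)) (by nlinarith)
    have h5 := Real.exp_pos (-(6 * β * ((h:ℝ) + 1)))
    nlinarith
  have e3 : lam ≤ A / 1000 := by
    have : lam = Real.exp (-4 * β * (h + 1)) * Real.exp (-β) := by
      rw [hlam, ← Real.exp_add]; congr 1; ring
    rw [this]
    have := exp_m β hβ
    have h5 := Real.exp_pos (-β)
    nlinarith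
  have e4 := mul_le_mul_of_nonneg_left e1 hA0.le
  linarith

lemma ftr_lip (β : ℝ) (hβ : 1000 ≤ β) (ftr : ℕ → ℝ → ℝ) (hf : FTRlimit β ftr) (h : ℕ)
    (l1 l2 : ℝ) (h1 : 0 < l1) (h1' : l1 ≤ 1) (h2 : 0 < l2) (h2' : l2 ≤ 1) :
    |(ftr h l1 + l1 * h) - (ftr h l2 + l2 * h)| ≤ 1 / 4 * |l1 - l2| := by
  have a := P_le β hβ ftr hf h h l1 l2 h1 h1' h2 h2' _ (FF_lip β l1 l2 hβ h1 h2 h)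
  have b := P_le β hβ ftr hf h h l2 l1 h2 h2' h1 h1' _ (FF_lip β l2 l1 hβ h2 h1 h)
  rw [abs_sub_comm l2 l1] at b
  rw [abs_le]
  constructor <;> linarith

lemma g_bounds (β : ℝ) (hβ : 1000 ≤ β) (ftr : ℕ → ℝ → ℝ) (hf : FTRlimit β ftr) (h : ℕ)
    (l1 l2 : ℝ) (h1 : 0 < l1) (h12 : l1 ≤ l2) (h2' : l2 ≤ 1) :
    (l2 - l1) / 2 ≤ (ftr h l2 - ftr (h + 1) l2) - (ftr h l1 - ftr (h + 1) l1) ∧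
    (ftr h l2 - ftr (h + 1) l2) - (ftr h l1 - ftr (h + 1) l1) ≤ 2 * (l2 - l1) := by
  have a := ftr_lip β hβ ftr hf h l2 l1 (by linarith) h2' h1 (by linarith)
  have b := ftr_lip β hβ ftr hf (h + 1) l2 l1 (by linarith) h2' h1 (by linarith)
  rw [abs_of_nonneg (show 0 ≤ l2 - l1 by linarith), abs_le] at a b
  push_cast at a b
  constructor <;> linarith [a.1, a.2, b.1, b.2]

lemma exists_crit (β : ℝ) (hβ : 1000 ≤ β) (ftr : ℕ → ℝ → ℝ) (hf : FTRlimit β ftr) (h : ℕ) :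
    ∃ c, Real.exp (-4 * β * h - 5 * β) < c ∧ c < Real.exp (-4 * β * h - 2 * β) ∧
      ftr (h + 1) c = ftr h c ∧ (∀ l, 0 < l → l < c → ftr h l < ftr (h + 1) l) ∧
      (∀ l, c < l → l ≤ 1 → ftr (h + 1) l < ftr h l) := by
  have hu := ftr_upper β hβ ftr hf h
  have hlo := ftr_lower β hβ ftr hf h
  set x := Real.exp (-4 * β * h - 5 * β) with hx
  set y := Real.exp (-4 * β * h - 2 * β) with hy
  have hx0 : 0 < x := Real.exp_pos _
  have hxy : x ≤ y := Real.exp_le_exp.2 (by linarith)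
  have hy1 : y ≤ 1 := by
    have := num_small β hβ h y le_rfl
    have h0 : (0:ℝ) ≤ h := Nat.cast_nonneg _
    have : 0 < y := Real.exp_pos _
    nlinarith
  set g : ℝ → ℝ := fun l => ftr h l - ftr (h + 1) l with hg
  have hcont : ContinuousOn g (Set.Icc x y) := by
    have : LipschitzOnWith 2 g (Set.Icc x y) := by
      refine LipschitzOnWith.of_dist_le_mul fun a ha b hb => ?_
      rw [Real.dist_eq, Real.dist_eq]
      push_cast
      rcases le_total a b with hab | hab
      · have := g_bounds β hβ ftr hf h a b (by linarith [ha.1]) hab (by linarith [hb.2])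
        rw [abs_sub_comm, abs_sub_comm a b, abs_of_nonneg (show 0 ≤ b - a by linarith), abs_le]
        simp only [hg]
        constructor <;> linarith [this.1, this.2]
      · have := g_bounds β hβ ftr hf h b a (by linarith [hb.1]) hab (by linarith [ha.2])
        rw [abs_of_nonneg (show 0 ≤ a - b by linarith), abs_le]
        simp only [hg]
        constructor <;> linarith [this.1, this.2]
    exact this.continuousOn
  have hgx : g x < 0 := by simp only [hg]; linarith
  have hgy : 0 < g y := by simp only [hg]; linarith
  obtain ⟨c, hc, hc0⟩ := intermediate_value_Icc hxy hcont (show (0:ℝ) ∈ Set.Icc (g x) (g y) from ⟨hgx.le, hgy.le⟩)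
  have hcx : x < c := lt_of_le_of_ne hc.1 (fun e => by rw [← e] at hc0; linarith)
  have hcy : c < y := lt_of_le_of_ne hc.2 (fun e => by rw [e] at hc0; linarith)
  simp only [hg] at hc0
  refine ⟨c, hcx, hcy, by linarith, ?_, ?_⟩
  · intro l hl hlc
    have := (g_bounds β hβ ftr hf h l c hl hlc.le (by linarith)).1
    linarith
  · intro l hcl hl1
    have := (g_bounds β hβ ftr hf h c l (by linarith) hcl.le hl1).1
    linarith

end

/-- Proposition 4.6 of the paper: the critical points. There is an
absolute `β₀` such that for `β > β₀` there is a sequence `(λ_c^{(i)})_{i≥0}` of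
positive reals with `I_i = [e^{-4βi-2β}, e^{-4βi-β}] ⊆ [λ_c^{(i)}, λ_c^{(i-1)}]`
(with `λ_c^{(-1)} := ∞`) such that, for the truncated free energies
`f^tr_h(λ) = lim |Λ_n|⁻¹ log Z^tr_{η,h,Λ_n}`:
(1) if `λ_c^{(i)} < λ < λ_c^{(i-1)}` then `f^tr_i(λ) > f^tr_j(λ)` for all `j ≠ i`;
(2) at `λ = λ_c^{(i)}`, `f^tr_{i+1} = f^tr_i > f^tr_j` for all `j ∉ {i, i+1}`. -/
theorem statement13 :
    ∃ β₀ : ℝ, ∀ β : ℝ, β₀ < β →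
      ∃ lamc : ℕ → ℝ, (∀ i, 0 < lamc i) ∧
        (∀ i : ℕ, ∀ lam : ℝ,
          Real.exp (-4 * β * (i : ℝ) - 2 * β) ≤ lam →
          lam ≤ Real.exp (-4 * β * (i : ℝ) - β) →
          lamc i ≤ lam ∧ (i = 0 ∨ lam ≤ lamc (i - 1))) ∧
        ∀ ftr : ℕ → ℝ → ℝ, FTRlimit β ftr →
          ((∀ i : ℕ, ∀ lam : ℝ, 0 < lam → lam ≤ 1 → lamc i < lam →
              (i = 0 ∨ lam < lamc (i - 1)) →
              ∀ j : ℕ, j ≠ i → ftr j lam < ftr i lam) ∧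
           (∀ i : ℕ,
              ftr (i + 1) (lamc i) = ftr i (lamc i) ∧
              ∀ j : ℕ, j ≠ i → j ≠ i + 1 → ftr j (lamc i) < ftr i (lamc i))) := by
  refine ⟨1000, fun β hβ' => ?_⟩
  have hβ : 1000 ≤ β := hβ'.le
  by_cases hex : ∃ ftr, FTRlimit β ftr
  · obtain ⟨f0, hf0⟩ := hex
    choose lamc hA hB hE hL hG using exists_crit β hβ f0 hf0
    have hpos : ∀ i, 0 < lamc i := fun i => (Real.exp_pos _).trans (hA i)
    have hone : ∀ i, lamc i ≤ 1 := by
      intro i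
      refine (hB i).le.trans (Real.exp_le_one_iff.2 ?_)
      have h0 : (0:ℝ) ≤ i := Nat.cast_nonneg _
      nlinarith
    have hanti : StrictAnti lamc := by
      refine strictAnti_nat_of_succ_lt fun i => ((hB (i + 1)).trans_le ?_).trans (hA i)
      refine Real.exp_le_exp.2 ?_
      push_cast
      linarith
    refine ⟨lamc, hpos, ?_, ?_⟩
    · intro i lam h1 h2
      refine ⟨(hB i).le.trans h1, ?_⟩
      rcases Nat.eq_zero_or_pos i with h | h
      · exact Or.inl h
      · right
        obtain ⟨k, rfl⟩ : ∃ k, i = k + 1 := ⟨i - 1, by omega⟩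
        refine h2.trans (le_trans (Real.exp_le_exp.2 ?_) (hA k).le)
        push_cast
        linarith
    · intro ftr hf
      have heq : ∀ h lam, 0 < lam → lam ≤ 1 → ftr h lam = f0 h lam := fun h lam hl hl1 =>
        tendsto_nhds_unique (hf h lam hl hl1 (constSign .free)) (hf0 h lam hl hl1 (constSign .free))
      -- monotonicity in the height above and below the optimum
      have down : ∀ i lam, lam ≤ 1 → lamc i < lam → ∀ n, f0 (i + n + 1) lam < f0 i lam := by
        intro i lam hl1 hi n
        induction n with
        | zero => exact hG i lam hi hl1
        | succ n ih =>
          refine lt_trans ?_ ih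
          refine hG (i + n + 1) lam (lt_trans (hanti (by omega)) hi) hl1
      have up : ∀ i lam, 0 < lam → lam < lamc i → ∀ n, n ≤ i → f0 (i - n) lam < f0 (i + 1) lam := by
        intro i lam hl hi n
        induction n with
        | zero => intro _; exact hL i lam hl hi
        | succ n ih =>
          intro hn
          refine lt_trans ?_ (ih (by omega))
          have := hL (i - (n + 1)) lam hl (hi.trans_le (hanti.antitone (by omega)))
          rwa [show i - (n + 1) + 1 = i - n by omega] at this
      refine ⟨?_, ?_⟩
      · intro i lam hl hl1 hi hi' j hj
        rw [heq j lam hl hl1, heq i lam hl hl1]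
        rcases lt_or_gt_of_ne hj with h | h
        · rcases hi' with h0 | h0
          · omega
          · have := up (i - 1) lam hl h0 (i - 1 - j) (by omega)
            rwa [show i - 1 - (i - 1 - j) = j by omega, show i - 1 + 1 = i by omega] at this
        · have := down i lam hl1 hi (j - i - 1)
          rwa [show i + (j - i - 1) + 1 = j by omega] at this
      · intro i
        refine ⟨by rw [heq _ _ (hpos i) (hone i), heq _ _ (hpos i) (hone i)]; exact hE i, ?_⟩
        intro j hj hj'
        rw [heq _ _ (hpos i) (hone i), heq _ _ (hpos i) (hone i)]
        rcases lt_or_gt_of_ne hj with h | h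
        · have := up (i - 1) (lamc i) (hpos i) (hanti (by omega)) (i - 1 - j) (by omega)
          rwa [show i - 1 - (i - 1 - j) = j by omega, show i - 1 + 1 = i by omega] at this
        · have := down (i + 1) (lamc i) (hone i) (hanti (by omega)) (j - i - 2)
          rwa [show i + 1 + (j - i - 2) + 1 = j by omega, hE i] at this
  · refine ⟨fun i => Real.exp (-4 * β * i - 3 * β), fun i => Real.exp_pos _, ?_, ?_⟩
    · intro i lam h1 h2
      refine ⟨(Real.exp_le_exp.2 (by linarith)).trans h1, ?_⟩
      rcases Nat.eq_zero_or_pos i with h | h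
      · exact Or.inl h
      · right
        obtain ⟨k, rfl⟩ : ∃ k, i = k + 1 := ⟨i - 1, by omega⟩
        refine h2.trans (Real.exp_le_exp.2 ?_)
        simp only [Nat.add_sub_cancel]
        push_cast
        linarith
    · intro ftr hf
      exact absurd ⟨ftr, hf⟩ hex
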